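/- arXiv:1611.05499 — 3 statements merged into one kernel-verified Lean document; each statement's English description precedes it below -/
import Mathlib

section
/- Let q be an odd prime power, n ≥ 1, λ a partition of 2n, and let x ∈ sp(2n,q) be nilpotent of Jordan type λ. Then the number of nilpotent elements y ∈ sp(2n,q) with xy = yx equals q^e, where e is the natural number with 2e = ∑_{k ≥ 1} (λ'_k)² + o(λ) − 2 ∑_{i ≥ 1} ⌊m_i(λ)/2⌋. -/
open Matrix

/-- The `2n × 2n` matrix `J = [[0, I],[-I, 0]]` defining the symplectic group. -/
noncomputable def sympJ (F : Type) [Field F] (n : ℕ) :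
    Matrix (Fin n ⊕ Fin n) (Fin n ⊕ Fin n) F :=
  Matrix.fromBlocks 0 1 (-1) 0

set_option linter.all false

/-! ### Part 1: nilpotent skew endomorphisms of a nondegenerate form -/

structure EForm {F V : Type} [Field F] [AddCommGroup V] [Module F V]
    (B : LinearMap.BilinForm F V) (ε : F) (δ : ℕ) : Prop where
  symm : ∀ a b, B a b = ε * B b a
  nd : ∀ a, (∀ b, B a b = 0) → a = 0
  eps : (ε = 1 ∧ δ = 0) ∨ (ε = -1 ∧ δ = 1)
  two : (2 : F) ≠ 0

def IsoSub {F V : Type} [Field F] [AddCommGroup V] [Module F V]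
    (B : LinearMap.BilinForm F V) (W : Submodule F V) : Prop :=
  ∀ a ∈ W, ∀ b ∈ W, B a b = 0

def SkewEnd {F V : Type} [Field F] [AddCommGroup V] [Module F V]
    (B : LinearMap.BilinForm F V) (y : V →ₗ[F] V) : Prop :=
  ∀ a b, B (y a) b = - B a (y b)

section part1

variable {F V : Type} [Field F] [Fintype F] [AddCommGroup V] [Module F V] [Finite V]

theorem stb_card_eq (A : Type) [AddCommGroup A] [Module F A] [Finite A] :
    (Nat.card A : ℚ) = (Fintype.card F : ℚ) ^ Module.finrank F A := by
  have := Module.natCard_eq_pow_finrank (K := F) (V := A)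
  rw [this, Nat.card_eq_fintype_card]; push_cast; rfl

theorem stb_qpos : (0 : ℚ) < Fintype.card F := by
  exact_mod_cast Fintype.card_pos

/-- fibres of a nonzero functional -/
theorem stb_card_fiber (A : Type) [AddCommGroup A] [Module F A] [Finite A]
    (f : A →ₗ[F] F) (hf : f ≠ 0) :
    (Nat.card {a : A // f a = 1} : ℚ) = (Fintype.card F : ℚ) ^ (Module.finrank F A - 1) := by
  obtain ⟨a0, ha0⟩ : ∃ a, f a ≠ 0 := by
    by_contra h; push Not at h; exact hf (LinearMap.ext h)
  set a1 := (f a0)⁻¹ • a0 with ha1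
  have h1 : f a1 = 1 := by simp [ha1, ha0]
  let e : {a : A // f a = 1} ≃ LinearMap.ker f :=
    { toFun := fun a => ⟨a.1 - a1, by simp [h1, a.2]⟩
      invFun := fun b => ⟨b.1 + a1, by have := b.2; rw [LinearMap.mem_ker] at this; simp [h1, this]⟩
      left_inv := fun a => by simp
      right_inv := fun b => by simp }
  rw [Nat.card_congr e, stb_card_eq (F := F)]
  have h2 := LinearMap.finrank_range_add_finrank_ker f
  have h3 : LinearMap.range f = ⊤ := LinearMap.range_eq_top.2 (by
    intro c; exact ⟨c • a1, by simp [h1]⟩)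
  rw [h3, finrank_top, Module.finrank_self] at h2
  congr 1
  omega

/-- number of hyperplanes of `W` that are complements of `u`. -/
theorem stb_card_compl (W : Submodule F V) (u : V) (hu : u ∈ W) (hu0 : u ≠ 0) :
    (Nat.card {U : Submodule F V // u ∉ U ∧ U ⊔ Submodule.span F {u} = W} : ℚ) =
      (Fintype.card F : ℚ) ^ (Module.finrank F W - 1) := by
  have : Finite (Module.Dual F W) := Module.finite_of_finite F
  have hev : Module.Dual.eval F W ⟨u, hu⟩ ≠ 0 := by
    intro h
    have := (Module.eval_apply_eq_zero_iff F (⟨u, hu⟩ : W)).1 h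
    exact hu0 (by simpa using this)
  have := stb_card_fiber (F := F) (Module.Dual F W) (Module.Dual.eval F W ⟨u, hu⟩) hev
  rw [Subspace.dual_finrank_eq] at this
  rw [← this]
  congr 1
  symm
  refine Nat.card_congr (Equiv.ofBijective
    (fun f => ⟨(LinearMap.ker f.1).map W.subtype, ?_, ?_⟩) ⟨?_, ?_⟩)
  · rintro ⟨w, hw, hwu⟩
    have : w = ⟨u, hu⟩ := Subtype.ext hwu
    subst this
    have h1 := f.2
    have hw' : f.1 ⟨u, hu⟩ = 0 := hw
    rw [Module.Dual.eval_apply, hw'] at h1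
    exact zero_ne_one h1
  · apply le_antisymm
    · apply sup_le
      · exact Submodule.map_subtype_le _ _
      · simpa using hu
    · intro w hw
      have h1 : f.1 ⟨u, hu⟩ = 1 := f.2
      rw [Submodule.mem_sup]
      refine ⟨w - f.1 ⟨w, hw⟩ • u, ⟨⟨w, hw⟩ - f.1 ⟨w, hw⟩ • ⟨u, hu⟩, ?_, rfl⟩,
        f.1 ⟨w, hw⟩ • u, Submodule.mem_span_singleton.2 ⟨_, rfl⟩, by simp⟩
      change f.1 (⟨w, hw⟩ - f.1 ⟨w, hw⟩ • ⟨u, hu⟩) = 0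
      rw [map_sub, map_smul, h1]; simp
  · rintro ⟨f, hf⟩ ⟨g, hg⟩ h
    have hf : f ⟨u, hu⟩ = 1 := hf
    have hg : g ⟨u, hu⟩ = 1 := hg
    simp only [Subtype.mk.injEq] at h
    have h := Submodule.map_injective_of_injective (Submodule.injective_subtype W) h
    apply Subtype.ext
    apply LinearMap.ext
    intro w
    have : w - f w • (⟨u, hu⟩ : W) ∈ LinearMap.ker f := by
      rw [LinearMap.mem_ker, map_sub, map_smul, hf]; simp
    have h0 : w - f w • (⟨u, hu⟩ : W) ∈ LinearMap.ker g := h ▸ this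
    simp only [LinearMap.mem_ker, map_sub, map_smul, hg, smul_eq_mul, mul_one] at h0
    exact (sub_eq_zero.1 h0).symm
  · rintro ⟨U, hU1, hU2⟩
    have hUW : U ≤ W := hU2 ▸ le_sup_left
    obtain ⟨g, hg1, hg2⟩ := Submodule.exists_le_ker_of_notMem (p := U.comap W.subtype) (v := ⟨u, hu⟩)
      (by simpa using hU1)
    refine ⟨⟨(g ⟨u, hu⟩)⁻¹ • g, ?_⟩, ?_⟩
    · simp [hg1]
    · apply Subtype.ext
      apply le_antisymm
      · rintro _ ⟨w, hw, rfl⟩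
        have hw : g w = 0 := by simpa [hg1] using hw
        have hwW : (w : V) ∈ U ⊔ Submodule.span F {u} := hU2 ▸ w.2
        obtain ⟨a, ha, b, hb, hab⟩ := Submodule.mem_sup.1 hwW
        obtain ⟨c, rfl⟩ := Submodule.mem_span_singleton.1 hb
        have hwe : w = ⟨a, hUW ha⟩ + c • ⟨u, hu⟩ := Subtype.ext hab.symm
        have h0 : g ⟨a, hUW ha⟩ = 0 := hg2 (show (⟨a, hUW ha⟩ : W) ∈ _ from ha)
        rw [hwe, map_add, h0, map_smul, zero_add, smul_eq_mul] at hw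
        have hc : c = 0 := by simpa [hg1] using hw
        subst hc
        simpa [← hab] using ha
      · intro a ha
        refine ⟨⟨a, hUW ha⟩, ?_, rfl⟩
        have h0 : g ⟨a, hUW ha⟩ = 0 := hg2 (show (⟨a, hUW ha⟩ : W) ∈ _ from ha)
        simp [h0]

theorem stb_finrank_compl (U W : Submodule F V) (u : V) (hu : u ∉ U)
    (h : U ⊔ Submodule.span F {u} = W) : Module.finrank F W = Module.finrank F U + 1 := by
  have h1 := Submodule.finrank_sup_add_finrank_inf_eq U (Submodule.span F {u})
  have hu0 : u ≠ 0 := fun h => hu (h ▸ U.zero_mem)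
  have h2 : U ⊓ Submodule.span F {u} = ⊥ := by
    rw [eq_bot_iff]
    rintro a ⟨ha, hb⟩
    obtain ⟨c, rfl⟩ := Submodule.mem_span_singleton.1 hb
    by_cases hc : c = 0
    · simp [hc]
    · exact absurd ((Submodule.smul_mem_iff _ hc).1 ha) hu
  rw [h, h2, finrank_bot, finrank_span_singleton hu0] at h1
  omega

open Classical in
/-- Sum of a function of the dimension over isotropic subspaces contained in `K`. -/
noncomputable def isoSum [Fintype (Submodule F V)] (P : Submodule F V → Prop) (c : ℕ → ℚ) : ℚ :=
  ∑ W : Submodule F V with P W, c (Module.finrank F W)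

theorem isoSum_compl [Fintype (Submodule F V)] (P : Submodule F V → Prop)
    (u : V) (hu0 : u ≠ 0) (hP : ∀ U W : Submodule F V, u ∉ U → U ⊔ Submodule.span F {u} = W →
      (P U ↔ P W)) (c : ℕ → ℚ) :
    isoSum P c = isoSum (fun W => P W ∧ u ∈ W)
      (fun d => c d + (Fintype.card F : ℚ) ^ (d - 1) * c (d - 1)) := by
  classical
  unfold isoSum
  rw [Finset.sum_add_distrib]
  rw [← Finset.sum_filter_add_sum_filter_not (s := Finset.univ.filter P) (p := fun W => u ∈ W)]
  rw [Finset.filter_filter]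
  congr 1
  · exact Finset.sum_congr (by ext; simp) (fun _ _ => rfl)
  rw [Finset.filter_filter]
  rw [← Finset.sum_fiberwise_of_maps_to (t := Finset.univ.filter (fun W => P W ∧ u ∈ W))
    (g := fun U => U ⊔ Submodule.span F {u})]
  · refine Finset.sum_congr (by ext; simp) ?_
    intro W hW
    simp only [Finset.mem_filter, Finset.mem_univ, true_and] at hW
    rw [← stb_card_compl W u hW.2 hu0]
    rw [Finset.sum_congr rfl (g := fun _ => c (Module.finrank F W - 1))]
    · rw [Finset.sum_const, nsmul_eq_mul]
      congr 2
      rw [Nat.card_eq_fintype_card, Fintype.card_subtype]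
      congr 1
      ext U
      simp only [Finset.mem_filter, Finset.mem_univ, true_and]
      constructor
      · tauto
      · intro h; exact ⟨⟨(hP U W h.1 h.2).2 hW.1, h.1⟩, h.2⟩
    · intro U hU
      simp only [Finset.mem_filter, Finset.mem_univ, true_and] at hU
      rw [stb_finrank_compl U W u hU.1.2 hU.2]; simp
  · intro U hU
    simp only [Finset.mem_filter, Finset.mem_univ, true_and] at hU ⊢
    exact ⟨(hP U _ hU.2 rfl).1 hU.1, Submodule.mem_sup_right (Submodule.mem_span_singleton_self u)⟩

end part1

section part2

variable {F V : Type} [Field F] [Fintype F] [AddCommGroup V] [Module F V] [Finite V]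

theorem isoSum_hyp [Fintype (Submodule F V)] (B : LinearMap.BilinForm F V) (V' : Submodule F V)
    [Fintype (Submodule F V')]
    (z : V) (hz : z ∉ V') (hzz : B z z = 0) (h1 : ∀ a ∈ V', B z a = 0 ∧ B a z = 0)
    (h2 : ∀ a, B z a = 0 → ∃ c : F, a - c • z ∈ V') (c : ℕ → ℚ) :
    isoSum (fun W => IsoSub B W ∧ z ∈ W) c =
      isoSum (IsoSub (B.restrict V')) (fun d => c (d + 1)) := by
  classical
  unfold isoSum
  have key : ∀ W' : Submodule F V', z ∉ W'.map V'.subtype := by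
    rintro W' ⟨a, -, ha⟩
    exact hz (ha ▸ a.2)
  refine (Finset.sum_bij' (fun W' _ => W'.map V'.subtype ⊔ Submodule.span F {z})
    (fun W _ => W.comap V'.subtype) ?_ ?_ ?_ ?_ ?_).symm
  · intro W' hW'
    simp only [Finset.mem_filter, Finset.mem_univ, true_and] at hW' ⊢
    refine ⟨?_, Submodule.mem_sup_right (Submodule.mem_span_singleton_self z)⟩
    intro a ha b hb
    obtain ⟨a1, ⟨a2, ha2, rfl⟩, a3, ha3, rfl⟩ := Submodule.mem_sup.1 ha
    obtain ⟨b1, ⟨b2, hb2, rfl⟩, b3, hb3, rfl⟩ := Submodule.mem_sup.1 hb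
    obtain ⟨s, rfl⟩ := Submodule.mem_span_singleton.1 ha3
    obtain ⟨t, rfl⟩ := Submodule.mem_span_singleton.1 hb3
    have e1 : B a2 b2 = 0 := hW' a2 ha2 b2 hb2
    simp [e1, hzz, (h1 a2 a2.2).2, (h1 b2 b2.2).1]
  · intro W hW
    simp only [Finset.mem_filter, Finset.mem_univ, true_and] at hW ⊢
    intro a ha b hb
    exact hW.1 a ha b hb
  · intro W' hW'
    ext a
    constructor
    · intro ha
      obtain ⟨a1, ⟨a2, ha2, rfl⟩, a3, ha3, h⟩ := Submodule.mem_sup.1 (Submodule.mem_comap.1 ha)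
      obtain ⟨s, rfl⟩ := Submodule.mem_span_singleton.1 ha3
      simp only [Submodule.subtype_apply] at h
      have hs : s = 0 := by
        by_contra hs
        apply hz
        rw [← Submodule.smul_mem_iff V' hs]
        have : s • z = (a - a2 : V') := by rw [Submodule.coe_sub, ← h]; simp
        rw [this]; exact Submodule.coe_mem _
      subst hs
      have : a2 = a := by apply Subtype.ext; simpa using h
      exact this ▸ ha2
    · intro ha
      exact Submodule.mem_sup_left ⟨a, ha, rfl⟩
  · intro W hW
    simp only [Finset.mem_filter, Finset.mem_univ, true_and] at hW
    apply le_antisymm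
    · apply sup_le
      · exact Submodule.map_comap_le _ _
      · simpa using hW.2
    · intro a ha
      obtain ⟨s, hs⟩ := h2 a (hW.1 z hW.2 a ha)
      rw [Submodule.mem_sup]
      refine ⟨a - s • z, ⟨⟨_, hs⟩, ?_, rfl⟩, s • z, Submodule.mem_span_singleton.2 ⟨_, rfl⟩, by simp⟩
      exact W.sub_mem ha (W.smul_mem _ hW.2)
  · intro W' hW'
    rw [stb_finrank_compl _ _ z (key W') rfl, Submodule.finrank_map_subtype_eq]

def hypSub (B : LinearMap.BilinForm F V) (u v : V) : Submodule F V :=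
  LinearMap.ker (B u) ⊓ LinearMap.ker (B v)

theorem mem_hypSub (B : LinearMap.BilinForm F V) (u v a : V) :
    a ∈ hypSub B u v ↔ B u a = 0 ∧ B v a = 0 := Iff.rfl

variable {B : LinearMap.BilinForm F V} {ε : F} {δ : ℕ}

theorem EForm.eps2 (h : EForm B ε δ) : ε * ε = 1 := by
  rcases h.eps with h | h <;> simp [h.1]

theorem EForm.eps0 (h : EForm B ε δ) : ε ≠ 0 := by
  rcases h.eps with h | h <;> simp [h.1]

theorem EForm.symm0 (h : EForm B ε δ) {a b : V} (hab : B a b = 0) : B b a = 0 := by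
  rw [h.symm, hab, mul_zero]

structure HypPair (B : LinearMap.BilinForm F V) (u v : V) : Prop where
  uu : B u u = 0
  vv : B v v = 0
  uv : B u v = 1

theorem hyp_exists (h : EForm B ε δ) (u : V) (hu0 : u ≠ 0) (huu : B u u = 0) :
    ∃ v, HypPair B u v := by
  obtain ⟨w, hw⟩ : ∃ w, B u w ≠ 0 := by
    by_contra hc; push Not at hc; exact hu0 (h.nd u hc)
  have h2 := h.two
  set w1 := (B u w)⁻¹ • w with hw1
  have e1 : B u w1 = 1 := by simp [hw1, hw]
  have e2 : B w1 u = ε := by rw [h.symm, e1, mul_one]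
  rcases h.eps with he | he
  · refine ⟨w1 - (B w1 w1 / 2) • u, huu, ?_, by simp [e1, huu]⟩
    simp [huu, e1, e2, he.1]
    field_simp; ring
  · refine ⟨w1, huu, ?_, e1⟩
    have := h.symm w1 w1
    rw [he.1] at this
    have h3 : 2 * B w1 w1 = 0 := by linear_combination this
    simpa [h2] using h3

theorem hyp_decomp (h : EForm B ε δ) {u v : V} (hp : HypPair B u v) (a : V) :
    a - (ε * B v a) • u - (B u a) • v ∈ hypSub B u v := by
  have e2 : B v u = ε := by rw [h.symm, hp.uv, mul_one]
  rw [mem_hypSub]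
  constructor
  · simp [hp.uu, hp.uv]
  · simp [e2, hp.vv]
    linear_combination (- B v a) * h.eps2

noncomputable def hypProj (h : EForm B ε δ) {u v : V} (hp : HypPair B u v) :
    V →ₗ[F] hypSub B u v where
  toFun a := ⟨_, hyp_decomp h hp a⟩
  map_add' a b := by apply Subtype.ext; simp [mul_add, add_smul]; abel
  map_smul' c a := by
    apply Subtype.ext; simp [smul_sub, smul_smul]; ring_nf

theorem hypProj_coe (h : EForm B ε δ) {u v : V} (hp : HypPair B u v) (a : V) :
    (hypProj h hp a : V) = a - (ε * B v a) • u - (B u a) • v := rfl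

theorem hypProj_of_mem (h : EForm B ε δ) {u v : V} (hp : HypPair B u v) (a : hypSub B u v) :
    hypProj h hp a = a := by
  apply Subtype.ext
  rw [hypProj_coe, ((mem_hypSub B u v a).1 a.2).1, ((mem_hypSub B u v a).1 a.2).2]; simp

theorem hyp_finrank (h : EForm B ε δ) {u v : V} (hp : HypPair B u v) :
    Module.finrank F V = Module.finrank F (hypSub B u v) + 2 := by
  have e2 : B v u = ε := by rw [h.symm, hp.uv, mul_one]
  let e : V ≃ₗ[F] (F × F) × hypSub B u v :=
    LinearEquiv.ofBijective (((B u).prod (B v)).prod (hypProj h hp)) (by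
      constructor
      · rw [← LinearMap.ker_eq_bot, eq_bot_iff]
        intro a ha
        simp at ha
        have := hypProj_coe h hp a
        rw [ha.1.1, ha.1.2, ha.2] at this
        simpa using this.symm
      · rintro ⟨⟨s, t⟩, w⟩
        have hw := (mem_hypSub B u v w).1 w.2
        refine ⟨(ε * t) • u + s • v + w, ?_⟩
        have e3 : ε * t * ε = t := by linear_combination t * h.eps2
        have e4 : B u ((ε * t) • u + s • v + w) = s := by simp [hp.uu, hp.uv, hw.1]
        have e5 : B v ((ε * t) • u + s • v + w) = t := by simp [hp.vv, e2, hw.2, e3]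
        refine Prod.ext (Prod.ext e4 e5) (Subtype.ext ?_)
        change (hypProj h hp _ : V) = _
        rw [hypProj_coe, e4, e5]; abel)
  rw [e.finrank_eq]; simp; omega

theorem hyp_eform (h : EForm B ε δ) {u v : V} (hp : HypPair B u v) :
    EForm (B.restrict (hypSub B u v)) ε δ where
  symm a b := h.symm a b
  nd a ha := by
    apply Subtype.ext
    apply h.nd
    intro b
    have h1 := ha (hypProj h hp b)
    have h2 : B a (hypProj h hp b : V) = 0 := h1
    have ha' := (mem_hypSub B u v a).1 a.2
    rw [hypProj_coe] at h2
    simpa [h.symm0 ha'.1, h.symm0 ha'.2] using h2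
  eps := h.eps
  two := h.two

theorem card_hyp (h : EForm B ε δ) {u : V} (hu0 : u ≠ 0) (huu : B u u = 0) :
    (Nat.card {v : V // HypPair B u v} : ℚ) * Fintype.card F =
      (Fintype.card F : ℚ) ^ (Module.finrank F V - 1 + δ) := by
  have hB : B u ≠ 0 := by
    intro hc; exact hu0 (h.nd u (fun b => by rw [hc]; rfl))
  have hc := stb_card_fiber V (B u) hB
  have h2 := h.two
  rcases h.eps with he | he
  · rw [he.2, add_zero, ← hc]
    have hvu : ∀ v, B u v = 1 → B v u = 1 := by
      intro v hv; rw [h.symm, hv, he.1, mul_one]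
    let e : {v : V // HypPair B u v} × F ≃ {a : V // B u a = 1} :=
      { toFun := fun p => ⟨p.1.1 + p.2 • u, by simp [p.1.2.uv, huu]⟩
        invFun := fun a => ⟨⟨a.1 - (B a.1 a.1 / 2) • u, huu, by
          simp [huu, a.2, hvu a.1 a.2]; field_simp; ring, by simp [a.2, huu]⟩, B a.1 a.1 / 2⟩
        left_inv := by
          rintro ⟨⟨v, hv⟩, t⟩
          have e1 : B (v + t • u) (v + t • u) / 2 = t := by
            simp [hv.vv, hv.uv, hvu v hv.uv, huu]; field_simp; ring
          refine Prod.ext (Subtype.ext ?_) e1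
          simp only [e1]; abel
        right_inv := by
          rintro ⟨a, ha⟩
          apply Subtype.ext
          simp }
    rw [← Nat.card_congr e, Nat.card_prod, Nat.card_eq_fintype_card (α := F)]; push_cast; rfl
  · have hn : 0 < Module.finrank F V := by
      have : Nontrivial V := ⟨u, 0, hu0⟩
      exact Module.finrank_pos
    rw [he.2, pow_succ, ← hc]
    congr 2
    refine Nat.card_congr (Equiv.subtypeEquivRight (fun v => ⟨fun hv => hv.uv, fun hv => ⟨huu, ?_, hv⟩⟩))
    have := h.symm v v
    rw [he.1] at this
    have h3 : 2 * B v v = 0 := by linear_combination this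
    simpa [h2] using h3

end part2

def stbA (q : ℚ) (δ : ℕ) : ℕ → ℚ
  | 0 => 1
  | k + 1 => q ^ (k + δ) * stbA q δ k

def stbMu (q : ℚ) : ℕ → ℚ
  | 0 => 1
  | d + 1 => - q ^ d * stbMu q d

def stbC (q : ℚ) (δ n d : ℕ) : ℚ := stbMu q d * (q ^ d * stbA q δ (n - d) - q ^ (n / 2))

theorem stbC_rec (q : ℚ) (δ n d : ℕ) (hd : d ≤ n) (hq : q ≠ 0) :
    stbC q δ (n + 2) (d + 1) + q ^ d * stbC q δ (n + 2) d +
      q ^ (n + δ) * (stbC q δ (n + 2) (d + 1) / q ^ d) = - q ^ (n + 1 + δ) * stbC q δ n d := by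
  obtain ⟨k, rfl⟩ := Nat.exists_eq_add_of_le hd
  unfold stbC
  have e1 : d + k + 2 - (d + 1) = k + 1 := by omega
  have e2 : d + k + 2 - d = k + 2 := by omega
  have e3 : d + k - d = k := by omega
  have e4 : (d + k + 2) / 2 = (d + k) / 2 + 1 := by omega
  rw [e1, e2, e3, e4]
  have : q ^ d ≠ 0 := pow_ne_zero _ hq
  simp only [stbA, stbMu]
  field_simp
  ring

section part3

variable {F V : Type} [Field F] [Fintype F] [AddCommGroup V] [Module F V] [Finite V]
variable {B : LinearMap.BilinForm F V} {ε : F} {δ : ℕ}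

theorem isoSum_congr [Fintype (Submodule F V)] {P Q : Submodule F V → Prop} {c c' : ℕ → ℚ}
    (hPQ : ∀ W, P W ↔ Q W) (hc : ∀ W, P W → c (Module.finrank F W) = c' (Module.finrank F W)) :
    isoSum P c = isoSum Q c' := by
  classical
  have : P = Q := funext fun W => propext (hPQ W)
  subst this
  unfold isoSum
  apply Finset.sum_congr rfl
  intro W hW
  exact hc W (by simpa using hW)

theorem isoSum_K [Fintype (Submodule F V)] (h : EForm B ε δ) (K : Submodule F V) (u : V)
    (hu0 : u ≠ 0) (hK : u ∈ K) (huK : ∀ k ∈ K, B u k = 0) (c : ℕ → ℚ) :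
    isoSum (fun W => IsoSub B W ∧ W ≤ K) c = isoSum (fun W => (IsoSub B W ∧ W ≤ K) ∧ u ∈ W)
      (fun d => c d + (Fintype.card F : ℚ) ^ (d - 1) * c (d - 1)) := by
  apply isoSum_compl _ u hu0
  rintro U W hU rfl
  constructor
  · rintro ⟨h1, h2⟩
    constructor
    · intro a ha b hb
      obtain ⟨a1, ha1, a3, ha3, rfl⟩ := Submodule.mem_sup.1 ha
      obtain ⟨b1, hb1, b3, hb3, rfl⟩ := Submodule.mem_sup.1 hb
      obtain ⟨s, rfl⟩ := Submodule.mem_span_singleton.1 ha3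
      obtain ⟨t, rfl⟩ := Submodule.mem_span_singleton.1 hb3
      simp [h1 a1 ha1 b1 hb1, huK u hK, huK b1 (h2 hb1), h.symm0 (huK a1 (h2 ha1))]
    · exact sup_le h2 (by simpa using hK)
  · rintro ⟨h1, h2⟩
    exact ⟨fun a ha b hb => h1 a (Submodule.mem_sup_left ha) b (Submodule.mem_sup_left hb),
      le_sup_left.trans h2⟩

theorem isoSum_K_mu [Fintype (Submodule F V)] (h : EForm B ε δ) (K : Submodule F V) (u : V)
    (hu0 : u ≠ 0) (hK : u ∈ K) (huK : ∀ k ∈ K, B u k = 0) :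
    isoSum (fun W => IsoSub B W ∧ W ≤ K) (stbMu (Fintype.card F)) = 0 := by
  classical
  rw [isoSum_K h K u hu0 hK huK]
  unfold isoSum
  apply Finset.sum_eq_zero
  intro W hW
  simp only [Finset.mem_filter, Finset.mem_univ, true_and] at hW
  have : Nontrivial W := ⟨⟨u, hW.2⟩, 0, fun h => hu0 (congrArg Subtype.val h)⟩
  obtain ⟨d, hd⟩ : ∃ d, Module.finrank F W = d + 1 :=
    ⟨_, (Nat.succ_pred_eq_of_pos (Module.finrank_pos (R := F) (M := W))).symm⟩
  simp [hd, stbMu]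

theorem isoSum_u (h : EForm B ε δ) [Fintype (Submodule F V)] {u v : V} (hp : HypPair B u v)
    [Fintype (Submodule F (hypSub B u v))] (c : ℕ → ℚ) :
    isoSum (fun W => IsoSub B W ∧ u ∈ W) c =
      isoSum (IsoSub (B.restrict (hypSub B u v))) (fun d => c (d + 1)) := by
  have e2 : B v u = ε := by rw [h.symm, hp.uv, mul_one]
  apply isoSum_hyp B (hypSub B u v) u _ hp.uu
  · intro a ha
    rw [mem_hypSub] at ha
    exact ⟨ha.1, h.symm0 ha.1⟩
  · intro a ha
    refine ⟨ε * B v a, ?_⟩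
    have := hyp_decomp h hp a
    rw [ha] at this
    simpa using this
  · rw [mem_hypSub]
    intro hc
    exact h.eps0 (e2 ▸ hc.2)

theorem isoSum_v (h : EForm B ε δ) [Fintype (Submodule F V)] {u v : V} (hp : HypPair B u v)
    [Fintype (Submodule F (hypSub B u v))] (c : ℕ → ℚ) :
    isoSum (fun W => IsoSub B W ∧ v ∈ W) c =
      isoSum (IsoSub (B.restrict (hypSub B u v))) (fun d => c (d + 1)) := by
  apply isoSum_hyp B (hypSub B u v) v _ hp.vv
  · intro a ha
    rw [mem_hypSub] at ha
    exact ⟨ha.2, h.symm0 ha.2⟩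
  · intro a ha
    refine ⟨B u a, ?_⟩
    have := hyp_decomp h hp a
    rw [ha] at this
    simpa using this
  · rw [mem_hypSub]
    intro hc
    exact zero_ne_one (hc.1.symm.trans hp.uv)

theorem isoSum_opp [Fintype (Submodule F V)] {u : V} (huu : B u u = 0)
    [Fintype {v : V // HypPair B u v}] (c : ℕ → ℚ) :
    isoSum (fun W => IsoSub B W ∧ ¬ W ≤ LinearMap.ker (B u)) c =
      ∑ v : {v : V // HypPair B u v}, isoSum (fun W => IsoSub B W ∧ v.1 ∈ W)
        (fun d => c d / (Fintype.card F : ℚ) ^ (d - 1)) := by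
  classical
  unfold isoSum
  simp_rw [Finset.sum_filter]
  rw [Finset.sum_comm]
  apply Finset.sum_congr rfl
  intro W _
  by_cases hW : IsoSub B W
  · simp only [hW, true_and]
    rw [← Finset.sum_filter, Finset.sum_const, nsmul_eq_mul]
    have hcard : ((Finset.univ.filter (fun v : {v : V // HypPair B u v} => v.1 ∈ W)).card : ℚ)
        = (Nat.card {w : W // (B u).domRestrict W w = 1} : ℚ) := by
      rw [← Fintype.card_subtype, ← Nat.card_eq_fintype_card]
      congr 1
      refine Nat.card_congr
        { toFun := fun v => ⟨⟨v.1.1, v.2⟩, v.1.2.uv⟩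
          invFun := fun w => ⟨⟨w.1.1, huu, hW _ w.1.2 _ w.1.2, w.2⟩, w.1.2⟩
          left_inv := fun _ => rfl
          right_inv := fun _ => rfl }
    rw [hcard]
    by_cases hk : W ≤ LinearMap.ker (B u)
    · have : IsEmpty {w : W // (B u).domRestrict W w = 1} := by
        constructor
        rintro ⟨w, hw⟩
        have h0 : B u w = 0 := hk w.2
        have h1 : B u w = 1 := hw
        exact zero_ne_one (h0.symm.trans h1)
      rw [Nat.card_of_isEmpty]
      simp [hk]
    · rw [stb_card_fiber]
      · have := pow_ne_zero (Module.finrank F W - 1) (stb_qpos (F := F)).ne'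
        simp only [hk, not_false_eq_true, if_true]
        field_simp
      · intro h0
        apply hk
        intro w hw
        exact LinearMap.congr_fun h0 ⟨w, hw⟩
  · simp [hW]

theorem isoSum_lin [Fintype (Submodule F V)] (P : Submodule F V → Prop) (c c' : ℕ → ℚ) (t : ℚ) :
    isoSum P (fun d => c d + t * c' d) = isoSum P c + t * isoSum P c' := by
  classical
  unfold isoSum
  rw [Finset.mul_sum, Finset.sum_add_distrib]

theorem isoE_step (h : EForm B ε δ) [Fintype (Submodule F V)] {u : V} (hu0 : u ≠ 0)
    (huu : B u u = 0) (n : ℕ) (hn : Module.finrank F V = n + 2)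
    (IH : ∀ v, HypPair B u v → ∀ [Fintype (Submodule F (hypSub B u v))],
      isoSum (IsoSub (B.restrict (hypSub B u v))) (stbC (Fintype.card F) δ n) = 0) :
    isoSum (IsoSub B) (stbC (Fintype.card F) δ (n + 2)) = 0 := by
  classical
  have hq := (stb_qpos (F := F)).ne'
  have : Fintype {v : V // HypPair B u v} := Fintype.ofFinite _
  have : ∀ v, Fintype (Submodule F (hypSub B u v)) := fun v => Fintype.ofFinite _
  set c := stbC (Fintype.card F) δ (n + 2) with hc
  have hcard := card_hyp h hu0 huu
  rw [hn, Nat.card_eq_fintype_card] at hcard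
  have hcard' : (Fintype.card {v : V // HypPair B u v} : ℚ) = (Fintype.card F : ℚ) ^ (n + δ) := by
    have e : n + 2 - 1 + δ = n + δ + 1 := by omega
    rw [e, pow_succ] at hcard
    exact mul_right_cancel₀ hq hcard
  have hsplit : isoSum (IsoSub B) c = isoSum (fun W => IsoSub B W ∧ W ≤ LinearMap.ker (B u)) c +
      isoSum (fun W => IsoSub B W ∧ ¬ W ≤ LinearMap.ker (B u)) c := by
    unfold isoSum
    rw [← Finset.sum_filter_add_sum_filter_not _ (fun W => W ≤ LinearMap.ker (B u))]
    rw [Finset.filter_filter, Finset.filter_filter]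
    congr 1 <;> exact Finset.sum_congr (by ext; simp) (fun _ _ => rfl)
  have hS1 : ∀ v, HypPair B u v → isoSum (fun W => IsoSub B W ∧ W ≤ LinearMap.ker (B u)) c =
      isoSum (IsoSub (B.restrict (hypSub B u v)))
        (fun d => c (d + 1) + (Fintype.card F : ℚ) ^ d * c d) := by
    intro v hp
    rw [isoSum_K h (LinearMap.ker (B u)) u hu0 huu (fun k hk => hk)]
    have := isoSum_u h hp (fun d => c d + (Fintype.card F : ℚ) ^ (d - 1) * c (d - 1))
    simp only [Nat.add_sub_cancel] at this
    rw [← this]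
    apply isoSum_congr
    · intro W
      constructor
      · rintro ⟨⟨h1, -⟩, h3⟩; exact ⟨h1, h3⟩
      · rintro ⟨h1, h3⟩; exact ⟨⟨h1, fun w hw => h1 u h3 w hw⟩, h3⟩
    · intros; rfl
  have hS2 := isoSum_opp (B := B) huu c
  have key : (Fintype.card {v : V // HypPair B u v} : ℚ) * isoSum (IsoSub B) c = 0 := by
    rw [hsplit, mul_add, hS2]
    have e1 : (Fintype.card {v : V // HypPair B u v} : ℚ) *
        isoSum (fun W => IsoSub B W ∧ W ≤ LinearMap.ker (B u)) c =
        ∑ v : {v : V // HypPair B u v}, isoSum (fun W => IsoSub B W ∧ W ≤ LinearMap.ker (B u)) c := by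
      rw [Finset.sum_const, nsmul_eq_mul, Finset.card_univ]
    rw [e1, Finset.mul_sum, ← Finset.sum_add_distrib]
    apply Finset.sum_eq_zero
    rintro ⟨v, hp⟩ _
    rw [hS1 v hp, isoSum_v h hp, ← isoSum_lin, hcard']
    simp only [Nat.add_sub_cancel]
    have hfin : Module.finrank F (hypSub B u v) = n := by
      have := hyp_finrank h hp; omega
    rw [isoSum_congr (c' := fun d => 0 + (- (Fintype.card F : ℚ) ^ (n + 1 + δ)) *
      stbC (Fintype.card F) δ n d) (fun W => Iff.rfl)]
    · rw [isoSum_lin (c := fun _ => 0), IH v hp]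
      simp [isoSum]
    · intro W _
      rw [hc, stbC_rec _ _ _ _ (hfin ▸ Submodule.finrank_le W) hq]
      ring
  rcases mul_eq_zero.1 key with h0 | h0
  · rw [hcard'] at h0
    exact absurd h0 (pow_ne_zero _ hq)
  · exact h0

noncomputable def nilc (B : LinearMap.BilinForm F V) (W : Submodule F V) : ℕ :=
  Nat.card {y : V →ₗ[F] V // SkewEnd B y ∧ IsNilpotent y ∧ W ≤ LinearMap.ker y}

theorem nil_radical {y : V →ₗ[F] V} (hy : SkewEnd B y) (hn : IsNilpotent y) (h0 : y ≠ 0) :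
    ∃ u, u ≠ 0 ∧ y u = 0 ∧ ∀ k, y k = 0 → B u k = 0 := by
  classical
  obtain ⟨m, hm⟩ : ∃ m, y ^ (m + 1) ≠ 0 ∧ y ^ (m + 2) = 0 := by
    have hex : ∃ N, y ^ N = 0 := hn
    have hs := Nat.find_spec hex
    have hmin := fun m => Nat.find_min hex (m := m)
    rcases hN : Nat.find hex with _ | _ | N
    · rw [hN, pow_zero] at hs
      exfalso; apply h0
      calc y = y * 1 := (mul_one y).symm
        _ = 0 := by rw [hs, mul_zero]
    · rw [hN] at hs; exact absurd (by simpa using hs) h0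
    · refine ⟨N, hmin _ (by omega), ?_⟩
      rw [hN] at hs; exact hs
  obtain ⟨a, ha⟩ : ∃ a, (y ^ (m + 1)) a ≠ 0 := by
    by_contra hc; push Not at hc; exact hm.1 (LinearMap.ext hc)
  refine ⟨_, ha, ?_, ?_⟩
  · have : (y ^ (m + 2)) a = 0 := by rw [hm.2]; rfl
    rwa [pow_succ', Module.End.mul_apply] at this
  · intro k hk
    rw [pow_succ', Module.End.mul_apply, hy, hk]; simp

theorem nil_double (h : EForm B ε δ) [Fintype (Submodule F V)] :
    (∑ᶠ W ∈ {W : Submodule F V | IsoSub B W}, stbMu (Fintype.card F) (Module.finrank F W) *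
      ((nilc B W : ℚ) - 1)) = 0 := by
  classical
  have : Finite (V →ₗ[F] V) := DFunLike.finite _
  have : Fintype {y : V →ₗ[F] V // SkewEnd B y ∧ IsNilpotent y} := Fintype.ofFinite _
  have hcoe : {W : Submodule F V | IsoSub B W} =
    ((Finset.univ.filter (fun W => IsoSub B W) : Finset (Submodule F V)) : Set (Submodule F V)) := by
    ext; simp
  rw [hcoe, finsum_mem_coe_finset]
  simp_rw [mul_sub, mul_one]
  rw [Finset.sum_sub_distrib, sub_eq_zero]
  have e1 : ∀ W : Submodule F V, (nilc B W : ℚ) =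
      ∑ y : {y : V →ₗ[F] V // SkewEnd B y ∧ IsNilpotent y}, if W ≤ LinearMap.ker y.1 then 1 else 0 := by
    intro W
    rw [← Finset.sum_filter, Finset.sum_const, nsmul_eq_mul, mul_one, ← Fintype.card_subtype,
      ← Nat.card_eq_fintype_card]
    unfold nilc
    congr 1
    exact Nat.card_congr
      { toFun := fun y => ⟨⟨y.1, y.2.1, y.2.2.1⟩, y.2.2.2⟩
        invFun := fun y => ⟨y.1.1, y.1.2.1, y.1.2.2, y.2⟩
        left_inv := fun _ => rfl
        right_inv := fun _ => rfl }
  simp_rw [e1, Finset.mul_sum]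
  rw [Finset.sum_comm]
  have hz : SkewEnd B 0 := fun a b => by simp
  rw [Finset.sum_eq_single (⟨0, hz, IsNilpotent.zero⟩ :
    {y : V →ₗ[F] V // SkewEnd B y ∧ IsNilpotent y})]
  · simp
  · rintro ⟨y, hy, hn⟩ _ hne
    have hy0 : y ≠ 0 := fun h => hne (Subtype.ext h)
    obtain ⟨u, hu0, huy, hk⟩ := nil_radical hy hn hy0
    have := isoSum_K_mu h (LinearMap.ker y) u hu0 huy hk
    unfold isoSum at this
    refine Eq.trans ?_ this
    simp only [mul_ite, mul_one, mul_zero]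
    rw [← Finset.sum_filter, Finset.filter_filter]
  · simp

end part3

section part4

variable {F V : Type} [Field F] [Fintype F] [AddCommGroup V] [Module F V] [Finite V]
variable {B : LinearMap.BilinForm F V} {ε : F} {δ : ℕ}

noncomputable def hypExt (h : EForm B ε δ) {u v : V} (hp : HypPair B u v)
    (y : hypSub B u v →ₗ[F] hypSub B u v) (e : hypSub B u v) (t : F) : V →ₗ[F] V :=
  (hypSub B u v).subtype ∘ₗ y ∘ₗ hypProj h hp + (B u).smulRight ((e : V) + t • u) -
    (B.flip e).smulRight u

theorem hypExt_apply (h : EForm B ε δ) {u v : V} (hp : HypPair B u v)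
    (y : hypSub B u v →ₗ[F] hypSub B u v) (e : hypSub B u v) (t : F) (a : V) :
    hypExt h hp y e t a = (y (hypProj h hp a) : V) + B u a • ((e : V) + t • u) - B a e • u := rfl

theorem hyp_mem1 {u v : V} (a : hypSub B u v) : B u a = 0 := a.2.1
theorem hyp_mem2 {u v : V} (a : hypSub B u v) : B v a = 0 := a.2.2
theorem hyp_mem3 (h : EForm B ε δ) {u v : V} (a : hypSub B u v) : B a u = 0 := h.symm0 a.2.1
theorem hyp_mem4 (h : EForm B ε δ) {u v : V} (a : hypSub B u v) : B a v = 0 := h.symm0 a.2.2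

theorem hyp_B1 (h : EForm B ε δ) {u v : V} (hp : HypPair B u v) (c : hypSub B u v) (b : V) :
    B c (hypProj h hp b) = B c b := by
  rw [hypProj_coe]; simp [hyp_mem3 h, hyp_mem4 h]

theorem hyp_B2 (h : EForm B ε δ) {u v : V} (hp : HypPair B u v) (c : hypSub B u v) (b : V) :
    B (hypProj h hp b) c = B b c := by
  rw [hypProj_coe]; simp [hyp_mem1, hyp_mem2]

theorem hypProj_u (h : EForm B ε δ) {u v : V} (hp : HypPair B u v) : hypProj h hp u = 0 := by
  apply Subtype.ext
  have e2 : B v u = ε := by rw [h.symm, hp.uv, mul_one]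
  rw [hypProj_coe, e2, h.eps2, hp.uu]; simp

theorem hypProj_v (h : EForm B ε δ) {u v : V} (hp : HypPair B u v) : hypProj h hp v = 0 := by
  apply Subtype.ext
  rw [hypProj_coe, hp.vv, hp.uv]; simp

theorem hypExt_skew (h : EForm B ε δ) {u v : V} (hp : HypPair B u v)
    (y : hypSub B u v →ₗ[F] hypSub B u v) (e : hypSub B u v) (t : F)
    (hy : SkewEnd (B.restrict (hypSub B u v)) y) (ht : t = - ε * t) :
    SkewEnd B (hypExt h hp y e t) := by
  intro a b
  rw [hypExt_apply, hypExt_apply]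
  have h1 : B (y (hypProj h hp a)) b = - B a (y (hypProj h hp b)) := by
    have h2 := hyp_B1 h hp (y (hypProj h hp a)) b
    have h3 := hyp_B2 h hp (y (hypProj h hp b)) a
    rw [← h2, ← h3]
    exact hy (hypProj h hp a) (hypProj h hp b)
  simp only [map_add, map_sub, map_smul, LinearMap.add_apply, LinearMap.sub_apply,
    LinearMap.smul_apply, smul_eq_mul, h1]
  rw [h.symm a u, h.symm b e]
  linear_combination (B u a * B u b) * ht - (B u a * B (↑e) b) * h.eps2

theorem hypExt_u (h : EForm B ε δ) {u v : V} (hp : HypPair B u v)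
    (y : hypSub B u v →ₗ[F] hypSub B u v) (e : hypSub B u v) (t : F) (a : V) :
    B u (hypExt h hp y e t a) = 0 := by
  rw [hypExt_apply]; simp [hyp_mem1, hp.uu]

theorem hypExt_uu (h : EForm B ε δ) {u v : V} (hp : HypPair B u v)
    (y : hypSub B u v →ₗ[F] hypSub B u v) (e : hypSub B u v) (t : F) :
    hypExt h hp y e t u = 0 := by
  rw [hypExt_apply]; simp [hyp_mem1, hp.uu, hypProj_u]

theorem hypExt_v (h : EForm B ε δ) {u v : V} (hp : HypPair B u v)
    (y : hypSub B u v →ₗ[F] hypSub B u v) (e : hypSub B u v) (t : F) :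
    hypExt h hp y e t v = e + t • u := by
  rw [hypExt_apply]; simp [hyp_mem2, hp.uv, hypProj_v]

theorem hypExt_proj (h : EForm B ε δ) {u v : V} (hp : HypPair B u v)
    (y : hypSub B u v →ₗ[F] hypSub B u v) (e : hypSub B u v) (t : F) (a : V) (ha : B u a = 0) :
    hypProj h hp (hypExt h hp y e t a) = y (hypProj h hp a) := by
  rw [hypExt_apply, ha]
  simp [hypProj_u, hypProj_of_mem]

theorem hypExt_proj_pow (h : EForm B ε δ) {u v : V} (hp : HypPair B u v)
    (y : hypSub B u v →ₗ[F] hypSub B u v) (e : hypSub B u v) (t : F) (a : V) (ha : B u a = 0)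
    (k : ℕ) :
    hypProj h hp ((hypExt h hp y e t ^ k) a) = (y ^ k) (hypProj h hp a) ∧
      B u ((hypExt h hp y e t ^ k) a) = 0 := by
  induction k with
  | zero => simp [ha]
  | succ k ih =>
    rw [pow_succ', pow_succ', Module.End.mul_apply, Module.End.mul_apply]
    exact ⟨by rw [hypExt_proj _ _ _ _ _ _ ih.2, ih.1], hypExt_u ..⟩

theorem hypExt_nil (h : EForm B ε δ) {u v : V} (hp : HypPair B u v)
    (y : hypSub B u v →ₗ[F] hypSub B u v) (e : hypSub B u v) (t : F) :
    IsNilpotent (hypExt h hp y e t) ↔ IsNilpotent y := by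
  constructor
  · rintro ⟨N, hN⟩
    refine ⟨N, ?_⟩
    ext a
    have := (hypExt_proj_pow h hp y e t a (hyp_mem1 a) N).1
    rw [hN, hypProj_of_mem] at this
    rw [← this]; simp
  · rintro ⟨N, hN⟩
    refine ⟨N + 2, ?_⟩
    ext a
    have := (hypExt_proj_pow h hp y e t (hypExt h hp y e t a) (hypExt_u ..) N)
    rw [hN] at this
    set b := (hypExt h hp y e t ^ N) (hypExt h hp y e t a) with hb
    have h2 : (hypExt h hp y e t ^ (N + 2)) a = hypExt h hp y e t b := by
      rw [hb, pow_succ', Module.End.mul_apply, pow_succ, Module.End.mul_apply]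
    rw [h2]
    have h3 := congrArg Subtype.val this.1
    rw [hypProj_coe, this.2] at h3
    simp only [zero_smul, sub_zero, LinearMap.zero_apply, ZeroMemClass.coe_zero] at h3
    rw [sub_eq_zero.1 h3, map_smul, hypExt_uu]
    simp

theorem hyp_back (h : EForm B ε δ) {u v : V} (hp : HypPair B u v) (y : V →ₗ[F] V)
    (hy : SkewEnd B y) (hu : y u = 0) :
    hypExt h hp (hypProj h hp ∘ₗ y ∘ₗ (hypSub B u v).subtype) (hypProj h hp (y v))
      (ε * B v (y v)) = y := by
  have hyu : ∀ a, B u (y a) = 0 := fun a => by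
    have := hy u a
    rw [hu] at this
    simpa using this.symm
  have hd : ∀ a, y a = (hypProj h hp (y a) : V) + (ε * B v (y a)) • u := fun a => by
    rw [hypProj_coe, hyu]; simp
  ext a
  rw [hypExt_apply]
  have ha : a = (hypProj h hp a : V) + (ε * B v a) • u + (B u a) • v := by
    rw [hypProj_coe]; abel
  have e1 : y a = y (hypProj h hp a) + B u a • y v := by
    conv_lhs => rw [ha]
    simp [hu]
  rw [← hd v, e1, hd (hypProj h hp a : V)]
  have e2 : ε * B v (y (hypProj h hp a)) = - B a (hypProj h hp (y v)) := by
    have := hy v (hypProj h hp a)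
    have h5 : B (hypProj h hp (y v)) a = B (y v) (hypProj h hp a) := by
      rw [← hyp_B1 h hp, hyp_B2]
    rw [h.symm a, h5, this]; ring
  rw [e2]
  simp only [LinearMap.comp_apply, Submodule.subtype_apply]
  rw [neg_smul]; abel

theorem hypExt_ker (h : EForm B ε δ) {u v : V} (hp : HypPair B u v)
    (y : hypSub B u v →ₗ[F] hypSub B u v) (e : hypSub B u v) (t : F)
    (W : Submodule F V) (hW : IsoSub B W) (hu : u ∈ W) :
    W ≤ LinearMap.ker (hypExt h hp y e t) ↔
      W.comap (hypSub B u v).subtype ≤ LinearMap.ker y ∧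
      ∀ w ∈ W.comap (hypSub B u v).subtype, B w e = 0 := by
  have hpw : ∀ w ∈ W, hypProj h hp w ∈ W.comap (hypSub B u v).subtype := by
    intro w hw
    rw [Submodule.mem_comap, Submodule.subtype_apply, hypProj_coe, hW u hu w hw]
    simp only [zero_smul, sub_zero]
    exact W.sub_mem hw (W.smul_mem _ hu)
  constructor
  · intro hk
    have : ∀ w ∈ W.comap (hypSub B u v).subtype, y w = 0 ∧ B w e = 0 := by
      intro w hw
      have h1 : hypExt h hp y e t w = 0 := hk hw
      rw [hypExt_apply, hyp_mem1, hypProj_of_mem] at h1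
      simp only [zero_smul, add_zero] at h1
      have h2 := congrArg (B v) h1
      have e2 : B v u = ε := by rw [h.symm, hp.uv, mul_one]
      simp [hyp_mem2, e2, h.eps0] at h2
      rw [h2] at h1
      simp at h1
      exact ⟨h1, h2⟩
    exact ⟨fun w hw => (this w hw).1, fun w hw => (this w hw).2⟩
  · rintro ⟨h1, h2⟩ w hw
    rw [LinearMap.mem_ker, hypExt_apply, hW u hu w hw]
    have h3 := h1 (hpw w hw)
    have h4 := h2 _ (hpw w hw)
    rw [LinearMap.mem_ker] at h3
    rw [hyp_B2] at h4
    rw [h3, h4]; simp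

theorem hyp_props (h : EForm B ε δ) {u v : V} (hp : HypPair B u v)
    (W : Submodule F V) (hW : IsoSub B W) (hu : u ∈ W) (y : V →ₗ[F] V)
    (hy : SkewEnd B y ∧ IsNilpotent y ∧ W ≤ LinearMap.ker y) :
    SkewEnd (B.restrict (hypSub B u v)) (hypProj h hp ∘ₗ y ∘ₗ (hypSub B u v).subtype) ∧
    IsNilpotent (hypProj h hp ∘ₗ y ∘ₗ (hypSub B u v).subtype) ∧
    W.comap (hypSub B u v).subtype ≤
      LinearMap.ker (hypProj h hp ∘ₗ y ∘ₗ (hypSub B u v).subtype) ∧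
    (∀ w ∈ W.comap (hypSub B u v).subtype, B w (hypProj h hp (y v)) = 0) ∧
    ε * B v (y v) = -ε * (ε * B v (y v)) := by
  have hb := hyp_back h hp y hy.1 (hy.2.2 hu)
  have hn := hy.2.1
  have hk := hy.2.2
  rw [← hb, hypExt_nil] at hn
  rw [← hb, hypExt_ker h hp _ _ _ W hW hu] at hk
  refine ⟨?_, hn, hk.1, hk.2, ?_⟩
  · intro a b
    have h1 := hy.1 a b
    have h2 := hyp_B2 h hp b (y a)
    have h3 := hyp_B1 h hp a (y b)
    rw [← h2, ← h3] at h1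
    exact h1
  · have := hy.1 v v
    rw [h.symm] at this
    linear_combination ε * this

noncomputable def hypEquiv (h : EForm B ε δ) {u v : V} (hp : HypPair B u v)
    (W : Submodule F V) (hW : IsoSub B W) (hu : u ∈ W) :
    {y : V →ₗ[F] V // SkewEnd B y ∧ IsNilpotent y ∧ W ≤ LinearMap.ker y} ≃
    {y : hypSub B u v →ₗ[F] hypSub B u v // SkewEnd (B.restrict (hypSub B u v)) y ∧
        IsNilpotent y ∧ W.comap (hypSub B u v).subtype ≤ LinearMap.ker y} ×
      {e : hypSub B u v // ∀ w ∈ W.comap (hypSub B u v).subtype, B w e = 0} ×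
      {t : F // t = -ε * t} where
  toFun y := ⟨⟨hypProj h hp ∘ₗ y.1 ∘ₗ (hypSub B u v).subtype,
      (hyp_props h hp W hW hu y.1 y.2).1, (hyp_props h hp W hW hu y.1 y.2).2.1,
      (hyp_props h hp W hW hu y.1 y.2).2.2.1⟩,
    ⟨hypProj h hp (y.1 v), (hyp_props h hp W hW hu y.1 y.2).2.2.2.1⟩,
    ⟨ε * B v (y.1 v), (hyp_props h hp W hW hu y.1 y.2).2.2.2.2⟩⟩
  invFun p := ⟨hypExt h hp p.1.1 p.2.1.1 p.2.2.1, hypExt_skew _ _ _ _ _ p.1.2.1 p.2.2.2,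
    (hypExt_nil ..).2 p.1.2.2.1, (hypExt_ker h hp _ _ _ W hW hu).2 ⟨p.1.2.2.2, p.2.1.2⟩⟩
  left_inv y := Subtype.ext (hyp_back h hp y.1 y.2.1 (y.2.2.2 hu))
  right_inv p := by
    obtain ⟨⟨y, hy⟩, ⟨e, he⟩, ⟨t, ht⟩⟩ := p
    refine Prod.ext (Subtype.ext ?_) (Prod.ext (Subtype.ext ?_) (Subtype.ext ?_))
    · ext a
      simp only [LinearMap.comp_apply, Submodule.subtype_apply]
      rw [hypExt_proj _ _ _ _ _ _ (hyp_mem1 a), hypProj_of_mem]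
    · simp only
      rw [hypExt_v, map_add, map_smul, hypProj_of_mem, hypProj_u]
      simp
    · have e2 : B v u = ε := by rw [h.symm, hp.uv, mul_one]
      simp only
      rw [hypExt_v]
      simp [hyp_mem2, e2]
      linear_combination t * h.eps2

theorem card_eps (h : EForm B ε δ) : (Nat.card {t : F // t = -ε * t} : ℚ) = (Fintype.card F : ℚ) ^ δ := by
  rcases h.eps with ⟨rfl, rfl⟩ | ⟨rfl, rfl⟩
  · have : Unique {t : F // t = -1 * t} :=
      { default := ⟨0, by simp⟩
        uniq := by
          rintro ⟨t, ht⟩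
          apply Subtype.ext
          have : (2 : F) * t = 0 := by linear_combination ht
          exact (mul_eq_zero.1 this).resolve_left h.two }
    rw [Nat.card_unique]; simp
  · have : Nat.card {t : F // t = - -1 * t} = Nat.card F :=
      Nat.card_congr (Equiv.subtypeUnivEquiv (by simp))
    rw [this]; simp

theorem card_perp (h : EForm B ε δ) (W : Submodule F V) :
    (Nat.card {e : V // ∀ w ∈ W, B w e = 0} : ℚ) =
      (Fintype.card F : ℚ) ^ (Module.finrank F V - Module.finrank F W) := by
  have hnd : B.Nondegenerate := by
    constructor
    · intro a ha; exact h.nd a ha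
    · intro a ha; exact h.nd a (fun b => h.symm0 (ha b))
  have hr : B.IsRefl := fun a b hab => h.symm0 hab
  rw [← LinearMap.BilinForm.finrank_orthogonal hnd, ← stb_card_eq]
  rfl

theorem comap_finrank (h : EForm B ε δ) {u v : V} (hp : HypPair B u v)
    (W : Submodule F V) (hW : IsoSub B W) (hu : u ∈ W) :
    Module.finrank F W = Module.finrank F (W.comap (hypSub B u v).subtype) + 1 := by
  have h1 : Module.finrank F (W.comap (hypSub B u v).subtype) =
      Module.finrank F ((W.comap (hypSub B u v).subtype).map (hypSub B u v).subtype) :=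
    (LinearEquiv.finrank_eq (Submodule.equivMapOfInjective _ (Submodule.subtype_injective _) _))
  rw [h1]
  apply stb_finrank_compl _ _ u
  · rintro ⟨a, -, ha⟩
    have := hyp_mem2 a
    have e2 : B v u = ε := by rw [h.symm, hp.uv, mul_one]
    rw [← Submodule.subtype_apply, ha, e2] at this
    exact h.eps0 this
  · apply le_antisymm
    · refine sup_le ?_ (by simpa using hu)
      rw [Submodule.map_le_iff_le_comap]
    · intro w hw
      have : w = (hypProj h hp w : V) + (ε * B v w) • u := by
        rw [hypProj_coe, hW u hu w hw]; simp
      rw [this]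
      refine Submodule.add_mem_sup ⟨hypProj h hp w, ?_, rfl⟩
        (Submodule.smul_mem _ _ (Submodule.mem_span_singleton_self _))
      show (hypProj h hp w : V) ∈ W
      rw [hypProj_coe, hW u hu w hw]
      simp only [zero_smul, sub_zero]
      exact W.sub_mem hw (W.smul_mem _ hu)

theorem nilc_hyp (h : EForm B ε δ) {u v : V} (hp : HypPair B u v)
    (W : Submodule F V) (hW : IsoSub B W) (hu : u ∈ W) :
    (nilc B W : ℚ) = nilc (B.restrict (hypSub B u v)) (W.comap (hypSub B u v).subtype) *
      (Fintype.card F : ℚ) ^ (Module.finrank F V - 1 - Module.finrank F W + δ) := by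
  have h1 := comap_finrank h hp W hW hu
  have h2 := hyp_finrank h hp
  have h3 := card_perp (hyp_eform h hp) (W.comap (hypSub B u v).subtype)
  unfold nilc
  rw [Nat.card_congr (hypEquiv h hp W hW hu), Nat.card_prod, Nat.card_prod]
  push_cast
  rw [card_eps h, pow_add]
  have : Module.finrank F V - 1 - Module.finrank F W =
    Module.finrank F (hypSub B u v) - Module.finrank F (W.comap (hypSub B u v).subtype) := by omega
  rw [this, ← h3]
  rfl

end part4

section part5

theorem aniso_finrank {F V : Type} [Field F] [Fintype F] [AddCommGroup V] [Module F V] [Finite V]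
    {B : LinearMap.BilinForm F V} {δ : ℕ} (h : EForm B 1 δ)
    (han : ∀ u, B u u = 0 → u = 0) : Module.finrank F V ≤ 2 := by
  classical
  by_contra hlt
  have : Module.Finite F V := Module.Finite.of_finite
  have hsymm : LinearMap.IsSymm B := ⟨fun a b => by rw [h.symm, one_mul, RingHom.id_apply]⟩
  have : Invertible (2 : F) := invertibleOfNonzero h.two
  obtain ⟨v, hv⟩ := LinearMap.BilinForm.exists_orthogonal_basis (K := F) (B := B) hsymm
  let i0 : Fin (Module.finrank F V) := ⟨0, by omega⟩
  let i1 : Fin (Module.finrank F V) := ⟨1, by omega⟩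
  let i2 : Fin (Module.finrank F V) := ⟨2, by omega⟩
  have hne : ∀ i, B (v i) (v i) ≠ 0 := fun i hi => v.ne_zero i (han _ hi)
  have hodd : Fintype.card F % 2 = 1 := by
    rcases Nat.mod_two_eq_zero_or_one (Fintype.card F) with h0 | h1
    · exfalso
      have := FiniteField.even_card_iff_char_two (F := F) |>.2 h0
      apply h.two
      have := CharP.cast_eq_zero F (ringChar F)
      simp_all
    · exact h1
  open Polynomial in
  obtain ⟨s, t, hst⟩ := FiniteField.exists_root_sum_quadratic
    (f := C (B (v i0) (v i0)) * X ^ 2 + C 0 * X + C 0)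
    (g := C (B (v i1) (v i1)) * X ^ 2 + C 0 * X + C (B (v i2) (v i2)))
    (Polynomial.degree_quadratic (hne _)) (Polynomial.degree_quadratic (hne _)) hodd
  simp at hst
  have ho : ∀ i j, i ≠ j → B (v i) (v j) = 0 := fun i j hij => hv hij
  have h01 : i0 ≠ i1 := by simp [i0, i1]
  have h02 : i0 ≠ i2 := by simp [i0, i2]
  have h12 : i1 ≠ i2 := by simp [i1, i2]
  have hz := han (s • v i0 + t • v i1 + v i2) (by
    simp [ho _ _ h01, ho _ _ h02, ho _ _ h12, ho _ _ h01.symm, ho _ _ h02.symm, ho _ _ h12.symm]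
    linear_combination hst)
  have := congrArg (fun w => v.repr w i2) hz
  simp [h02, h12, Finsupp.single_apply] at this

theorem aniso_A {F V : Type} [Field F] [Fintype F] [AddCommGroup V] [Module F V] [Finite V]
    {B : LinearMap.BilinForm F V} {ε : F} {δ : ℕ} (h : EForm B ε δ)
    (han : ∀ u, B u u = 0 → u = 0) :
    stbA (Fintype.card F) δ (Module.finrank F V) =
      (Fintype.card F : ℚ) ^ (Module.finrank F V / 2) := by
  rcases h.eps with ⟨rfl, rfl⟩ | ⟨rfl, rfl⟩
  · have := aniso_finrank h han
    interval_cases Module.finrank F V <;> simp [stbA]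
  · have : Subsingleton V := by
      refine ⟨fun a b => ?_⟩
      have hz : ∀ a : V, a = 0 := fun a => han a (by
        have := h.symm a a
        have h2 : (2 : F) * B a a = 0 := by linear_combination this
        exact (mul_eq_zero.1 h2).resolve_left h.two)
      rw [hz a, hz b]
    rw [Module.finrank_zero_of_subsingleton]
    simp [stbA]

theorem nilc_aniso {F V : Type} [Field F] [Fintype F] [AddCommGroup V] [Module F V] [Finite V]
    {B : LinearMap.BilinForm F V} (han : ∀ u, B u u = 0 → u = 0) : nilc B ⊥ = 1 := by
  unfold nilc
  have hz : SkewEnd B 0 := fun a b => by simp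
  have : Unique {y : V →ₗ[F] V // SkewEnd B y ∧ IsNilpotent y ∧ ⊥ ≤ LinearMap.ker y} :=
    { default := ⟨0, hz, IsNilpotent.zero, bot_le⟩
      uniq := by
        rintro ⟨y, h1, h2, h3⟩
        apply Subtype.ext
        by_contra h0
        obtain ⟨u, hu, hy, hk⟩ := nil_radical h1 h2 h0
        exact hu (han u (hk u hy)) }
  exact Nat.card_unique

theorem iso_aniso {F V : Type} [Field F] [Fintype F] [AddCommGroup V] [Module F V] [Finite V]
    {B : LinearMap.BilinForm F V} (han : ∀ u, B u u = 0 → u = 0) (W : Submodule F V)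
    (hW : IsoSub B W) : W = ⊥ := by
  rw [eq_bot_iff]
  intro w hw
  exact han w (hW w hw w hw)

theorem iso_bot {F V : Type} [Field F] [Fintype F] [AddCommGroup V] [Module F V] [Finite V]
    {B : LinearMap.BilinForm F V} : IsoSub B ⊥ := by
  intro a ha b hb
  rw [(Submodule.mem_bot F).1 ha]; simp

theorem steinberg_main (n : ℕ) : ∀ (F V : Type) [Field F] [Fintype F] [AddCommGroup V] [Module F V]
    [Finite V] [Fintype (Submodule F V)] (B : LinearMap.BilinForm F V) (ε : F) (δ : ℕ)
    (_ : EForm B ε δ) (_ : Module.finrank F V = n),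
    (∀ W : Submodule F V, IsoSub B W → (Fintype.card F : ℚ) ^ (n / 2) * nilc B W =
      (Fintype.card F : ℚ) ^ (Module.finrank F W) *
        stbA (Fintype.card F) δ (n - Module.finrank F W)) ∧
    isoSum (IsoSub B) (stbC (Fintype.card F) δ n) = 0 := by
  classical
  induction n using Nat.strong_induction_on with
  | _ n ih =>
  intro F V _ _ _ _ _ _ B ε δ h hn
  have hq := (stb_qpos (F := F)).ne'
  by_cases han : ∀ u, B u u = 0 → u = 0
  · have hA := aniso_A h han
    rw [hn] at hA
    constructor
    · intro W hW
      rw [iso_aniso han W hW, nilc_aniso han, finrank_bot]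
      simp [hA]
    · unfold isoSum
      apply Finset.sum_eq_zero
      intro W hW
      rw [iso_aniso han W (by simpa using hW), finrank_bot]
      simp [stbC, hA]
  · push Not at han
    obtain ⟨u, huu, hu0⟩ := han
    obtain ⟨v, hp⟩ := hyp_exists h u hu0 huu
    obtain ⟨m, rfl⟩ : ∃ m, n = m + 2 := ⟨_, by rw [← hn]; exact hyp_finrank h hp⟩
    have hb : isoSum (IsoSub B) (stbC (Fintype.card F) δ (m + 2)) = 0 := by
      apply isoE_step h hu0 huu m hn
      intro v hp _
      exact (ih m (by omega) F (hypSub B u v) _ ε δ (hyp_eform h hp)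
        (by have := hyp_finrank h hp; omega)).2
    have ha : ∀ W : Submodule F V, IsoSub B W → W ≠ ⊥ →
      (Fintype.card F : ℚ) ^ ((m + 2) / 2) * nilc B W =
      (Fintype.card F : ℚ) ^ (Module.finrank F W) *
        stbA (Fintype.card F) δ (m + 2 - Module.finrank F W) := by
      intro W hW hWb
      obtain ⟨u, huW, hu0⟩ := W.exists_mem_ne_zero_of_ne_bot hWb
      obtain ⟨v, hp⟩ := hyp_exists h u hu0 (hW u huW u huW)
      have : Fintype (Submodule F (hypSub B u v)) := Fintype.ofFinite _
      have hf := hyp_finrank h hp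
      have hm : Module.finrank F (hypSub B u v) = m := by omega
      have hc := comap_finrank h hp W hW huW
      have IH := (ih m (by omega) F (hypSub B u v) _ ε δ (hyp_eform h hp) hm).1
        (W.comap (hypSub B u v).subtype) (fun a ha b hb => hW _ ha _ hb)
      have hle := Submodule.finrank_le (W.comap (hypSub B u v).subtype)
      rw [hm] at hle
      rw [nilc_hyp h hp W hW huW, hn, hc]
      set d := Module.finrank F (W.comap (hypSub B u v).subtype)
      obtain ⟨k, rfl⟩ := Nat.exists_eq_add_of_le hle
      have e1 : (d + k + 2) / 2 = (d + k) / 2 + 1 := by omega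
      have e2 : d + k + 2 - 1 - (d + 1) = k := by omega
      have e3 : d + k + 2 - (d + 1) = k + 1 := by omega
      have e4 : d + k - d = k := by omega
      rw [e4] at IH
      rw [e1, e2, e3, stbA]
      rw [pow_succ, pow_succ]
      linear_combination ((Fintype.card F : ℚ) * (Fintype.card F : ℚ) ^ (k + δ)) * IH
    refine ⟨fun W hW => ?_, hb⟩
    by_cases hWb : W = ⊥
    · subst hWb
      have hd := nil_double h
      have hcoe : {W : Submodule F V | IsoSub B W} =
        ((Finset.univ.filter (fun W => IsoSub B W) : Finset (Submodule F V)) :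
          Set (Submodule F V)) := by
        ext; simp
      rw [hcoe, finsum_mem_coe_finset] at hd
      have hd2 : ∑ W : Submodule F V with IsoSub B W, (stbMu (Fintype.card F) (Module.finrank F W) *
        ((Fintype.card F : ℚ) ^ ((m + 2) / 2) * nilc B W -
          (Fintype.card F : ℚ) ^ (Module.finrank F W) *
        stbA (Fintype.card F) δ (m + 2 - Module.finrank F W))) = 0 := by
        have h3 : ∑ W : Submodule F V with IsoSub B W, (stbMu (Fintype.card F) (Module.finrank F W) *
        ((Fintype.card F : ℚ) ^ ((m + 2) / 2) * nilc B W -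
          (Fintype.card F : ℚ) ^ (Module.finrank F W) *
        stbA (Fintype.card F) δ (m + 2 - Module.finrank F W))) =
          (Fintype.card F : ℚ) ^ ((m + 2) / 2) * (∑ W : Submodule F V with IsoSub B W,
            stbMu (Fintype.card F) (Module.finrank F W) * ((nilc B W : ℚ) - 1)) -
          isoSum (IsoSub B) (stbC (Fintype.card F) δ (m + 2)) := by
          unfold isoSum
          rw [Finset.mul_sum, ← Finset.sum_sub_distrib]
          refine Finset.sum_congr (by ext; simp) fun W _ => ?_
          unfold stbC
          ring
        rw [h3, hd, hb]; simp
      rw [Finset.sum_eq_single_of_mem ⊥ (by simp [iso_bot])] at hd2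
      · simp [stbMu] at hd2
        simp
        linear_combination hd2
      · intro W hW hWb
        rw [ha W (by simpa using hW) hWb]; ring
    · exact ha W hW hWb

theorem steinberg {F V : Type} [Field F] [Fintype F] [AddCommGroup V] [Module F V]
    [Finite V] {B : LinearMap.BilinForm F V} {ε : F} {δ : ℕ} (h : EForm B ε δ) :
    (Fintype.card F : ℚ) ^ (Module.finrank F V / 2) *
      (Nat.card {y : V →ₗ[F] V // SkewEnd B y ∧ IsNilpotent y} : ℚ) =
        stbA (Fintype.card F) δ (Module.finrank F V) := by
  have : Fintype (Submodule F V) := Fintype.ofFinite _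
  have := (steinberg_main _ F V B ε δ h rfl).1 ⊥ iso_bot
  simp at this
  rw [← this]
  congr 2
  exact Nat.card_congr (Equiv.subtypeEquivRight (by simp))

end part5

section part6

/-- functions on `P` with prescribed symmetry under `σ`. -/
def symSub (F : Type) [Field F] {P : Type} (σ : P → P) (η : P → F) : Submodule F (P → F) where
  carrier := {c | ∀ p, c (σ p) = η p * c p}
  add_mem' := by
    intro a b ha hb p
    simp only [Pi.add_apply, ha p, hb p]; ring
  zero_mem' := by intro p; simp
  smul_mem' := by
    intro t a ha p
    simp only [Pi.smul_apply, smul_eq_mul, ha p]; ring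

theorem mem_symSub {F : Type} [Field F] {P : Type} (σ : P → P) (η : P → F) (c : P → F) :
    c ∈ symSub F σ η ↔ ∀ p, c (σ p) = η p * c p := Iff.rfl

theorem symSub_card (F : Type) [Field F] [Fintype F] (h2 : (2 : F) ≠ 0) {P : Type} [Fintype P]
    [DecidableEq P] [DecidableEq F] (σ : P → P) (hσ : Function.Involutive σ) (η : P → F)
    (hη : ∀ p, η p = 0 ∨ η p = 1 ∨ η p = -1) (hση : ∀ p, η (σ p) = η p) :
    ∃ d : ℕ, Nat.card (symSub F σ η) = Fintype.card F ^ d ∧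
      2 * d + (Finset.univ.filter (fun p => σ p = p ∧ η p = -1)).card =
        (Finset.univ.filter (fun p => η p ≠ 0)).card +
        (Finset.univ.filter (fun p => σ p = p ∧ η p = 1)).card := by
  classical
  let f := Fintype.equivFin P
  have hm1 : (-1 : F) ≠ 1 := by
    intro h; apply h2; linear_combination -h
  have hm0 : (-1 : F) ≠ 0 := by simp
  have hsq : ∀ p, η p ≠ 0 → η p * η p = 1 := by
    intro p hp
    rcases hη p with h | h | h
    · exact absurd h hp
    · simp [h]
    · simp [h]
  let I := {p : P // (f p < f (σ p) ∧ η p ≠ 0) ∨ (σ p = p ∧ η p = 1)}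
  let E : symSub F σ η ≃ (I → F) :=
    { toFun := fun c i => c.1 i.1
      invFun := fun g => ⟨fun p => if h : (f p < f (σ p) ∧ η p ≠ 0) ∨ (σ p = p ∧ η p = 1) then
          g ⟨p, h⟩ else if h' : (f (σ p) < f p ∧ η p ≠ 0) then
          η p * g ⟨σ p, Or.inl ⟨by rw [hσ p]; exact h'.1, by rw [hση]; exact h'.2⟩⟩ else 0, by
          intro p
          simp only
          rcases lt_trichotomy (f p) (f (σ p)) with hlt | heq | hgt
          · have hne : σ p ≠ p := fun h => by rw [h] at hlt; exact lt_irrefl _ hlt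
            by_cases h0 : η p = 0
            · simp [hσ p, hση, h0]
            · have hne2 : σ (σ p) ≠ σ p := by rw [hσ p]; exact hne.symm
              simp [hσ p, hση, h0, hlt, hlt.not_gt, hne.symm, hne]
          · have he : σ p = p := (f.injective heq).symm
            simp only [he, lt_irrefl, false_and, false_or, true_and]
            by_cases h1 : η p = 1
            · simp [h1]
            · simp [h1]
          · have hne : σ p ≠ p := fun h => by rw [h] at hgt; exact lt_irrefl _ hgt
            by_cases h0 : η p = 0
            · simp [hσ p, hση, h0]
            · simp [hσ p, hση, h0, hgt, hgt.not_gt, hne.symm, hne]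
              rw [← mul_assoc, hsq p h0, one_mul]⟩
      left_inv := by
        rintro ⟨c, hc⟩
        apply Subtype.ext
        funext p
        rw [mem_symSub] at hc
        simp only
        split_ifs with h h'
        · rfl
        · rw [hc p, ← mul_assoc, hsq p h'.2, one_mul]
        · have hcp := hc p
          push Not at h h'
          by_cases h0 : η p = 0
          · have := hc (σ p)
            rw [hσ p, hση, h0, zero_mul] at this
            exact this.symm
          · have he : f p = f (σ p) := by
              rcases lt_trichotomy (f p) (f (σ p)) with hlt | heq | hgt
              · exact absurd (h.1 hlt) h0
              · exact heq
              · exact absurd (h' hgt) h0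
            have he : σ p = p := (f.injective he).symm
            rcases hη p with h3 | h3 | h3
            · exact absurd h3 h0
            · exact absurd h3 (h.2 he)
            · rw [he, h3] at hcp
              have : (2 : F) * c p = 0 := by linear_combination hcp
              exact ((mul_eq_zero.1 this).resolve_left h2).symm
      right_inv := by
        intro g
        funext i
        simp only
        rw [dif_pos i.2] }
  refine ⟨Fintype.card I, ?_, ?_⟩
  · rw [Nat.card_congr E, Nat.card_eq_fintype_card, Fintype.card_fun]
  · have hI : Fintype.card I = (Finset.univ.filter (fun p => f p < f (σ p) ∧ η p ≠ 0)).card +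
        (Finset.univ.filter (fun p => σ p = p ∧ η p = 1)).card := by
      rw [← Finset.card_union_of_disjoint, ← Finset.filter_or, ← Fintype.card_subtype]
      rw [Finset.disjoint_filter]
      rintro p _ ⟨h1, _⟩ ⟨h3, _⟩
      rw [h3] at h1; exact lt_irrefl _ h1
    have hsw : (Finset.univ.filter (fun p => f p < f (σ p) ∧ η p ≠ 0)).card =
        (Finset.univ.filter (fun p => f (σ p) < f p ∧ η p ≠ 0)).card := by
      apply Finset.card_bij (fun p _ => σ p)
      · intro p hp
        simpa [hσ p, hση] using hp
      · intro a _ b _ h; exact hσ.injective h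
      · intro p hp
        exact ⟨σ p, by simpa [hσ p, hση] using hp, hσ p⟩
    have hall : (Finset.univ.filter (fun p => η p ≠ 0)).card =
        (Finset.univ.filter (fun p => f p < f (σ p) ∧ η p ≠ 0)).card +
        (Finset.univ.filter (fun p => f (σ p) < f p ∧ η p ≠ 0)).card +
        (Finset.univ.filter (fun p => σ p = p ∧ η p = 1)).card +
        (Finset.univ.filter (fun p => σ p = p ∧ η p = -1)).card := by
      simp only [Finset.card_filter]
      rw [← Finset.sum_add_distrib, ← Finset.sum_add_distrib, ← Finset.sum_add_distrib]
      apply Finset.sum_congr rfl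
      intro p _
      rcases lt_trichotomy (f p) (f (σ p)) with hlt | heq | hgt
      · have hne : σ p ≠ p := fun h => by rw [h] at hlt; exact lt_irrefl _ hlt
        simp [hlt, hlt.not_gt, hne]
      · have he : σ p = p := (f.injective heq).symm
        rcases hη p with h3 | h3 | h3
        · simp [he, h3]
        · simp [he, h3, hm1.symm]
        · simp [he, h3, hm1]
      · have hne : σ p ≠ p := fun h => by rw [h] at hgt; exact lt_irrefl _ hgt
        simp [hgt, hgt.not_gt, hne]
    omega

theorem stbA_eq (q : ℚ) (hq : q ≠ 0) (δ m d : ℕ) (hd : 2 * d + m = m * m + 2 * δ * m) :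
    stbA q δ m = q ^ d := by
  induction m generalizing d with
  | zero =>
    have : d = 0 := by simpa using hd
    simp [this, stbA]
  | succ m ih =>
    have hge : m + δ ≤ d := by nlinarith
    obtain ⟨d', rfl⟩ := Nat.exists_eq_add_of_le hge
    rw [stbA, ih d' (by nlinarith), ← pow_add]

/-- cardinality of a space of symmetric or alternating matrices -/
theorem symMat_card (F : Type) [Field F] [Fintype F] (h2 : (2 : F) ≠ 0) {J : Type} [Fintype J]
    (ε : F) (δ : ℕ) (hε : (ε = 1 ∧ δ = 0) ∨ (ε = -1 ∧ δ = 1)) :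
    (Nat.card (symSub F (Prod.swap : J × J → J × J) (fun _ => -ε)) : ℚ) =
      stbA (Fintype.card F) δ (Fintype.card J) := by
  classical
  have hm1 : (-1 : F) ≠ 1 := by
    intro h; apply h2; linear_combination -h
  obtain ⟨d, hd, he⟩ := symSub_card F h2 (Prod.swap : J × J → J × J) (fun p => Prod.swap_swap p)
    (fun _ => -ε) (by rcases hε with ⟨rfl, -⟩ | ⟨rfl, -⟩ <;> simp) (by simp)
  rw [hd, stbA_eq _ (stb_qpos (F := F)).ne' δ _ d]
  · push_cast; rfl
  have hdiag : (Finset.univ.filter (fun p : J × J => Prod.swap p = p)).card = Fintype.card J := by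
    rw [← Finset.card_univ]
    symm
    apply Finset.card_bij (fun j _ => (j, j))
    · simp
    · simp
    · rintro ⟨a, b⟩ h
      simp at h
      exact ⟨a, by simp, by simp [h.1]⟩
  rcases hε with ⟨rfl, rfl⟩ | ⟨rfl, rfl⟩
  · simp [hdiag, hm1] at he
    simp; exact he
  · simp [hdiag, hm1.symm] at he
    rw [he]; ring

end part6

section part7

structure JB {F V ι : Type} [Field F] [AddCommGroup V] [Module F V] (x : V →ₗ[F] V) (k : ι → ℕ)
    (e : ι → V) (b : Module.Basis (Σ j, Fin (k j)) F V) : Prop where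
  hb : ∀ j (a : Fin (k j)), b ⟨j, a⟩ = (x ^ (a : ℕ)) (e j)
  hz : ∀ j, (x ^ (k j)) (e j) = 0
  pos : ∀ j, 0 < k j

open Polynomial in
theorem jordan_exists0 {F V : Type} [Field F] [AddCommGroup V] [Module F V] [Module.Finite F V]
    (x : V →ₗ[F] V) (hx : IsNilpotent x) :
    ∃ (d : ℕ) (k : Fin d → ℕ) (e : Fin d → V) (b : Module.Basis (Σ j, Fin (k j)) F V),
      (∀ j (a : Fin (k j)), b ⟨j, a⟩ = (x ^ (a : ℕ)) (e j)) ∧ (∀ j, (x ^ (k j)) (e j) = 0) := by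
  classical
  obtain ⟨N, hN⟩ := hx
  have htor : Module.IsTorsion' (Module.AEval' x) (Submonoid.powers (X : F[X])) := by
    intro m
    refine ⟨⟨X ^ N, N, rfl⟩, ?_⟩
    have h := Module.AEval'.X_pow_smul_of x ((Module.AEval'.of x).symm m) N
    rw [hN, LinearEquiv.apply_symm_apply] at h
    have h' : (X ^ N : F[X]) • m = 0 := by simpa using h
    exact h'
  obtain ⟨d, k, ⟨Φ⟩⟩ := Module.torsion_by_prime_power_decomposition (p := (X : F[X]))
    Polynomial.irreducible_X htor
  let g : ∀ i : Fin d, DirectSum (Fin d) (fun i => F[X] ⧸ Submodule.span F[X] {(X : F[X]) ^ (k i)}) :=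
    fun i => DirectSum.lof F[X] (Fin d) (fun i => F[X] ⧸ Submodule.span F[X] {(X : F[X]) ^ (k i)}) i
      (Submodule.Quotient.mk 1)
  let e : Fin d → V := fun i => (Module.AEval'.of x).symm (Φ.symm (g i))
  have he : ∀ i (f : F[X]), aeval x f (e i) = (Module.AEval'.of x).symm (Φ.symm
      (DirectSum.lof F[X] (Fin d) (fun i => F[X] ⧸ Submodule.span F[X] {(X : F[X]) ^ (k i)}) i
      (Submodule.Quotient.mk f))) := by
    intro i f
    have h1 : (Submodule.Quotient.mk f : F[X] ⧸ Submodule.span F[X] {(X : F[X]) ^ (k i)}) =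
      f • Submodule.Quotient.mk 1 := by
      rw [← Submodule.Quotient.mk_smul]; simp
    rw [h1, map_smul, map_smul]
    rw [Module.AEval.of_symm_smul]
    rfl
  have hz : ∀ j, (x ^ (k j)) (e j) = 0 := by
    intro j
    have h1 := he j (X ^ k j)
    have h2 : (Submodule.Quotient.mk (X ^ k j : F[X]) :
        F[X] ⧸ Submodule.span F[X] {(X : F[X]) ^ (k j)}) = 0 := by
      rw [Submodule.Quotient.mk_eq_zero]
      exact Submodule.mem_span_singleton_self _
    rw [h2] at h1
    simpa using h1
  have hz2 : ∀ j s, k j ≤ s → (x ^ s) (e j) = 0 := by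
    intro j s hs
    obtain ⟨t, rfl⟩ := Nat.exists_eq_add_of_le hs
    rw [add_comm, pow_add, Module.End.mul_apply, hz, map_zero]
  let w : (Σ j, Fin (k j)) → V := fun p => (x ^ (p.2 : ℕ)) (e p.1)
  have hli : LinearIndependent F w := by
    rw [Fintype.linearIndependent_iff]
    intro c hc
    let p : Fin d → F[X] := fun j => ∑ a : Fin (k j), C (c ⟨j, a⟩) * X ^ (a : ℕ)
    have h1 : ∑ j, aeval x (p j) (e j) = 0 := by
      rw [← hc, Fintype.sum_sigma]
      apply Finset.sum_congr rfl
      intro j _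
      simp only [p, map_sum, LinearMap.sum_apply]
      apply Finset.sum_congr rfl
      intro a _
      simp [w, Module.End.mul_apply, Module.algebraMap_end_apply]
    simp_rw [he] at h1
    rw [← map_sum, LinearEquiv.map_eq_zero_iff, ← map_sum, LinearEquiv.map_eq_zero_iff] at h1
    rintro ⟨j, a⟩
    have h2 := congrArg (fun f => DirectSum.component F[X] (Fin d)
      (fun i => F[X] ⧸ Submodule.span F[X] {(X : F[X]) ^ (k i)}) j f) h1
    simp only [map_sum, map_zero] at h2
    rw [Finset.sum_eq_single j] at h2
    · rw [DirectSum.component.lof_self, Submodule.Quotient.mk_eq_zero,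
        Submodule.mem_span_singleton] at h2
      obtain ⟨r, hr⟩ := h2
      have h3 : X ^ k j ∣ p j := ⟨r, by rw [← hr, smul_eq_mul, mul_comm]⟩
      rw [Polynomial.X_pow_dvd_iff] at h3
      have h4 := h3 a a.2
      simp only [p, Polynomial.finset_sum_coeff, Polynomial.coeff_C_mul, Polynomial.coeff_X_pow] at h4
      rw [Finset.sum_eq_single a] at h4
      · simpa using h4
      · intro a' _ hne
        have : (a : ℕ) ≠ a' := fun h => hne (Fin.ext h.symm)
        simp [this]
      · simp
    · intro i _ hij
      rw [DirectSum.component.of]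
      simp [hij]
    · simp
  have hsp : ⊤ ≤ Submodule.span F (Set.range w) := by
    intro v _
    obtain ⟨y, rfl⟩ : ∃ y, v = (Module.AEval'.of x).symm (Φ.symm y) :=
      ⟨Φ (Module.AEval'.of x v), by simp⟩
    induction y using DirectSum.induction_on with
    | zero => simp
    | add a b ha hb =>
      rw [map_add, map_add]
      exact Submodule.add_mem _ (ha trivial) (hb trivial)
    | of i z =>
      obtain ⟨f, rfl⟩ := Submodule.Quotient.mk_surjective _ z
      have := he i f
      rw [DirectSum.lof_eq_of] at this
      rw [← this, Polynomial.aeval_eq_sum_range, LinearMap.sum_apply]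
      apply Submodule.sum_mem
      intro a _
      rw [LinearMap.smul_apply]
      apply Submodule.smul_mem
      by_cases ha : a < k i
      · exact Submodule.subset_span ⟨⟨i, ⟨a, ha⟩⟩, rfl⟩
      · rw [hz2 i a (by omega)]; exact Submodule.zero_mem _
  refine ⟨d, k, e, Module.Basis.mk hli hsp, ?_, hz⟩
  intro j a
  rw [Module.Basis.mk_apply]

theorem jordan_exists {F V : Type} [Field F] [AddCommGroup V] [Module F V] [Module.Finite F V]
    (x : V →ₗ[F] V) (hx : IsNilpotent x) :
    ∃ (ι : Type) (_ : Fintype ι) (_ : DecidableEq ι) (k : ι → ℕ) (e : ι → V)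
      (b : Module.Basis (Σ j, Fin (k j)) F V), JB x k e b := by
  obtain ⟨d, k, e, b, h1, h2⟩ := jordan_exists0 x hx
  let E : (Σ j : Fin d, Fin (k j)) ≃ (Σ j : {j : Fin d // 0 < k j}, Fin (k j.1)) :=
    { toFun := fun p => ⟨⟨p.1, p.2.pos⟩, p.2⟩
      invFun := fun p => ⟨p.1.1, p.2⟩
      left_inv := fun _ => rfl
      right_inv := fun _ => rfl }
  refine ⟨{j : Fin d // 0 < k j}, inferInstance, inferInstance, fun j => k j.1, fun j => e j.1,
    b.reindex E, ?_, fun j => h2 j.1, fun j => j.2⟩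
  intro j a
  rw [Module.Basis.reindex_apply]
  exact h1 _ _

variable {F V ι : Type} [Field F] [AddCommGroup V] [Module F V] [Fintype ι] [DecidableEq ι]
  {x : V →ₗ[F] V} {k : ι → ℕ} {e : ι → V} {b : Module.Basis (Σ j, Fin (k j)) F V}

theorem JB.zero (H : JB x k e b) (j : ι) (s : ℕ) (hs : k j ≤ s) : (x ^ s) (e j) = 0 := by
  obtain ⟨t, rfl⟩ := Nat.exists_eq_add_of_le hs
  rw [add_comm, pow_add, Module.End.mul_apply, H.hz, map_zero]

theorem JB.crd (H : JB x k e b) (m : ι) (r : Fin (k m)) (j : ι) (s : ℕ) :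
    b.coord ⟨m, r⟩ ((x ^ s) (e j)) = if m = j ∧ (r : ℕ) = s then 1 else 0 := by
  by_cases hs : s < k j
  · have := H.hb j ⟨s, hs⟩
    simp only at this
    rw [← this, Module.Basis.coord_apply, Module.Basis.repr_self, Finsupp.single_apply]
    congr 1
    apply propext
    constructor
    · intro h
      cases h
      exact ⟨rfl, rfl⟩
    · rintro ⟨rfl, h⟩
      congr 1
      exact Fin.ext h.symm
  · rw [H.zero j s (by omega), map_zero, if_neg]
    rintro ⟨rfl, h⟩
    have := r.2
    omega

/-- coordinate of `e m`. -/
noncomputable def JB.co (H : JB x k e b) (m : ι) : V →ₗ[F] F := b.coord ⟨m, ⟨0, H.pos m⟩⟩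

/-- extensionality on the vectors `x^s e_j`. -/
theorem JB.ext (H : JB x k e b) {M : Type} [AddCommGroup M] [Module F M] {f g : V →ₗ[F] M}
    (hfg : ∀ j s, f ((x ^ s) (e j)) = g ((x ^ s) (e j))) : f = g := by
  apply b.ext
  rintro ⟨j, a⟩
  rw [H.hb]
  exact hfg j a

theorem JB.coord_pow (H : JB x k e b) (m : ι) (r : ℕ) (hr : r < k m) (v : V) :
    b.coord ⟨m, ⟨r, hr⟩⟩ ((x ^ r) v) = H.co m v := by
  have : b.coord ⟨m, ⟨r, hr⟩⟩ ∘ₗ (x ^ r) = H.co m := by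
    apply H.ext
    intro j s
    rw [LinearMap.comp_apply, ← Module.End.mul_apply, ← pow_add, H.crd, JB.co, H.crd]
    congr 1
    apply propext
    simp only
    constructor
    · rintro ⟨h1, h2⟩; exact ⟨h1, by omega⟩
    · rintro ⟨h1, h2⟩; exact ⟨h1, by omega⟩
  exact LinearMap.congr_fun this v

theorem JB.coord_lt (H : JB x k e b) (m : ι) (r : ℕ) (hr : r < k m) (t : ℕ) (ht : r < t) (v : V) :
    b.coord ⟨m, ⟨r, hr⟩⟩ ((x ^ t) v) = 0 := by
  have : b.coord ⟨m, ⟨r, hr⟩⟩ ∘ₗ (x ^ t) = 0 := by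
    apply H.ext
    intro j s
    rw [LinearMap.comp_apply, ← Module.End.mul_apply, ← pow_add, H.crd, if_neg]
    · rfl
    · simp only; omega
  exact LinearMap.congr_fun this v

theorem JB.co_tri (H : JB x k e b) (m : ι) (r : ℕ) (hr : r < k m) (v : V) (hv : (x ^ r) v = 0) :
    H.co m v = 0 := by
  rw [← H.coord_pow m r hr, hv, map_zero]

theorem JB.co_x (H : JB x k e b) (m : ι) (v : V) : H.co m (x v) = 0 := by
  have := H.coord_lt m 0 (H.pos m) 1 (by omega) v
  rw [pow_one] at this
  exact this

theorem JB.co_e (H : JB x k e b) (m j : ι) : H.co m (e j) = if m = j then 1 else 0 := by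
  have := H.crd m ⟨0, H.pos m⟩ j 0
  simp only [and_true, pow_zero] at this
  exact this

theorem JB.decomp (H : JB x k e b) (v : V) : ∃ w, v = ∑ m, H.co m v • e m + x w := by
  have hv : v ∈ Submodule.span F (Set.range b) := by rw [b.span_eq]; trivial
  induction hv using Submodule.span_induction with
  | zero => exact ⟨0, by simp⟩
  | add a c _ _ ha hc =>
    obtain ⟨w1, h1⟩ := ha
    obtain ⟨w2, h2⟩ := hc
    refine ⟨w1 + w2, ?_⟩
    conv_lhs => rw [h1, h2]
    simp only [map_add, add_smul, Finset.sum_add_distrib]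
    abel
  | smul t a _ ha =>
    obtain ⟨w1, h1⟩ := ha
    refine ⟨t • w1, ?_⟩
    conv_lhs => rw [h1]
    simp only [map_smul, smul_add, Finset.smul_sum, smul_smul, smul_eq_mul]
  | mem a ha =>
    obtain ⟨⟨j, r⟩, rfl⟩ := ha
    rw [H.hb]
    rcases hr : (r : ℕ) with _ | r'
    · refine ⟨0, ?_⟩
      simp [H.co_e]
    · refine ⟨(x ^ r') (e j), ?_⟩
      rw [pow_succ', Module.End.mul_apply]
      simp [H.co_x]

theorem JB.rank_pow (H : JB x k e b) (t : ℕ) :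
    Module.finrank F (LinearMap.range (x ^ t)) = ∑ j, (k j - t) := by
  classical
  let w : {p : Σ j, Fin (k j) // t ≤ p.2} → V := fun p => b p.1
  have hw : LinearIndependent F w := b.linearIndependent.comp _ Subtype.val_injective
  have hr : LinearMap.range (x ^ t) = Submodule.span F (Set.range w) := by
    apply le_antisymm
    · rintro _ ⟨v, rfl⟩
      have hv : v ∈ Submodule.span F (Set.range b) := by rw [b.span_eq]; trivial
      induction hv using Submodule.span_induction with
      | zero => simp
      | add a c _ _ ha hc => rw [map_add]; exact Submodule.add_mem _ ha hc
      | smul s a _ ha => rw [map_smul]; exact Submodule.smul_mem _ _ ha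
      | mem a ha =>
        obtain ⟨⟨j, r⟩, rfl⟩ := ha
        rw [H.hb, ← Module.End.mul_apply, ← pow_add]
        by_cases hs : t + r < k j
        · apply Submodule.subset_span
          exact ⟨⟨⟨j, ⟨t + r, hs⟩⟩, by simp⟩, H.hb _ _⟩
        · rw [H.zero _ _ (by omega)]; exact Submodule.zero_mem _
    · rw [Submodule.span_le]
      rintro _ ⟨⟨⟨j, r⟩, hp⟩, rfl⟩
      refine ⟨(x ^ ((r : ℕ) - t)) (e j), ?_⟩
      rw [← Module.End.mul_apply, ← pow_add]
      simp only [w]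
      simp only at hp
      rw [H.hb, Nat.add_sub_cancel' hp]
  rw [hr, finrank_span_eq_card hw, Fintype.card_subtype, Finset.card_filter, Fintype.sum_sigma]
  apply Finset.sum_congr rfl
  intro j _
  rw [Fin.sum_univ_eq_sum_range (fun i => if t ≤ i then 1 else 0), ← Finset.card_filter]
  have : (Finset.range (k j)).filter (fun i => t ≤ i) = Finset.Ico t (k j) := by
    ext; simp; omega
  rw [this, Nat.card_Ico]

theorem JB.finrank_eq (H : JB x k e b) : Module.finrank F V = ∑ j, k j := by
  rw [Module.finrank_eq_card_basis b, Fintype.card_sigma]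
  simp

end part7

section part8

variable {F V ι : Type} [Field F] [AddCommGroup V] [Module F V] [Fintype ι] [DecidableEq ι]
  {x : V →ₗ[F] V} {k : ι → ℕ} {e : ι → V} {b : Module.Basis (Σ j, Fin (k j)) F V}

theorem comm_pow_apply {x y : V →ₗ[F] V} (h : x * y = y * x) (s : ℕ) (v : V) :
    y ((x ^ s) v) = (x ^ s) (y v) := by
  have : (y * x ^ s) v = (x ^ s * y) v := by
    rw [(Commute.pow_left h s : x ^ s * y = y * x ^ s)]
  exact this

theorem comm_apply {x y : V →ₗ[F] V} (h : x * y = y * x) (v : V) : y (x v) = x (y v) := by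
  have := comm_pow_apply h 1 v
  simpa using this

noncomputable def JB.ybar (H : JB x k e b) (y : V →ₗ[F] V) : Matrix ι ι F :=
  Matrix.of fun m j => H.co m (y (e j))

theorem JB.ybar_co (H : JB x k e b) (y : V →ₗ[F] V) (hy : x * y = y * x) (m : ι) (v : V) :
    H.co m (y v) = ∑ p, H.ybar y m p * H.co p v := by
  obtain ⟨w, hw⟩ := H.decomp v
  conv_lhs => rw [hw]
  rw [map_add, comm_apply hy, map_add, H.co_x, add_zero, map_sum, map_sum]
  apply Finset.sum_congr rfl
  intro p _
  rw [map_smul, map_smul, smul_eq_mul, mul_comm]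
  rfl

theorem JB.ybar_mul (H : JB x k e b) (y z : V →ₗ[F] V) (hy : x * y = y * x) :
    H.ybar (y * z) = H.ybar y * H.ybar z := by
  ext m j
  rw [Matrix.mul_apply]
  exact H.ybar_co y hy m (z (e j))

theorem JB.ybar_one (H : JB x k e b) : H.ybar 1 = 1 := by
  ext m j
  simp [JB.ybar, H.co_e, Matrix.one_apply]

theorem JB.ybar_pow (H : JB x k e b) (y : V →ₗ[F] V) (hy : x * y = y * x) (N : ℕ) :
    H.ybar (y ^ N) = H.ybar y ^ N := by
  induction N with
  | zero => simp [H.ybar_one]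
  | succ N ih => rw [pow_succ', H.ybar_mul _ _ hy, ih, pow_succ']

theorem JB.ybar_tri (H : JB x k e b) (y : V →ₗ[F] V) (hy : x * y = y * x) (m j : ι)
    (h : k j < k m) : H.ybar y m j = 0 := by
  apply H.co_tri m (k j) h
  rw [← comm_pow_apply hy, H.hz, map_zero]

abbrev JBlk (k : ι → ℕ) (i : ℕ) : Type := {j : ι // k j = i + 1}

noncomputable def JB.rho (H : JB x k e b) (i : ℕ) (y : V →ₗ[F] V) : Matrix (JBlk k i) (JBlk k i) F :=
  (H.ybar y).submatrix Subtype.val Subtype.val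

theorem sum_blk (k : ι → ℕ) (i : ℕ) {M : Type} [AddCommMonoid M] (f : ι → M)
    (hf : ∀ p, k p ≠ i + 1 → f p = 0) : ∑ p, f p = ∑ p : JBlk k i, f p.1 := by
  rw [← Fintype.sum_subtype_add_sum_subtype (fun p => k p = i + 1) f]
  rw [Finset.sum_eq_zero (s := (Finset.univ : Finset {p // ¬ k p = i + 1})), add_zero]
  intro p _
  exact hf p.1 p.2

theorem JB.rho_mul (H : JB x k e b) (i : ℕ) (y z : V →ₗ[F] V) (hy : x * y = y * x)
    (hz : x * z = z * x) : H.rho i (y * z) = H.rho i y * H.rho i z := by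
  ext m j
  rw [Matrix.mul_apply]
  simp only [JB.rho, Matrix.submatrix_apply]
  rw [H.ybar_mul _ _ hy, Matrix.mul_apply]
  apply sum_blk k i
  intro p hp
  rcases lt_or_gt_of_ne hp with h | h
  · rw [H.ybar_tri y hy m.1 p (by have := m.2; omega), zero_mul]
  · rw [H.ybar_tri z hz p j.1 (by have := j.2; omega), mul_zero]

theorem JB.rho_one (H : JB x k e b) (i : ℕ) : H.rho i 1 = 1 := by
  ext m j
  simp [JB.rho, H.ybar_one, Matrix.one_apply, Subtype.ext_iff]

theorem JB.rho_pow (H : JB x k e b) (i : ℕ) (y : V →ₗ[F] V) (hy : x * y = y * x) (N : ℕ) :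
    H.rho i (y ^ N) = H.rho i y ^ N := by
  induction N with
  | zero => simp [H.rho_one]
  | succ N ih =>
    rw [pow_succ', H.rho_mul _ _ _ hy ((Commute.pow_right hy N)), ih, pow_succ']

theorem JB.nil_iff (H : JB x k e b) (M : ℕ) (hM : ∀ j, k j ≤ M) (y : V →ₗ[F] V)
    (hy : x * y = y * x) : IsNilpotent y ↔ ∀ i : Fin M, IsNilpotent (H.rho i y) := by
  constructor
  · rintro ⟨N, hN⟩ i
    refine ⟨N, ?_⟩
    rw [← H.rho_pow _ _ hy, hN]
    ext m j
    simp [JB.rho, JB.ybar]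
  · intro h
    choose n hn using h
    set N := ∑ i, n i with hN
    have h1 : ∀ i : Fin M, H.rho i (y ^ N) = 0 := by
      intro i
      rw [H.rho_pow _ _ hy]
      exact pow_eq_zero_of_le (Finset.single_le_sum (fun _ _ => Nat.zero_le _) (Finset.mem_univ i)) (hn i)
    set z := y ^ N with hz
    have hzc : x * z = z * x := Commute.pow_right hy N
    have h2 : ∀ t m j, k j < k m + t → (H.ybar z ^ t) m j = 0 := by
      intro t
      induction t with
      | zero =>
        intro m j hlt
        have : m ≠ j := fun h => by rw [h] at hlt; simp at hlt
        simp [Matrix.one_apply, this]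
      | succ t ih =>
        intro m j hlt
        rw [pow_succ, Matrix.mul_apply]
        apply Finset.sum_eq_zero
        intro p _
        by_cases hp : k p < k m + t
        · rw [ih m p hp, zero_mul]
        · have hjp : k j ≤ k p := by omega
          rcases hjp.lt_or_eq with h3 | h3
          · rw [H.ybar_tri z hzc _ _ h3, mul_zero]
          · have hpos := H.pos p
            have hpM := hM p
            have h4 := congrFun (congrFun (h1 ⟨k p - 1, by omega⟩) ⟨p, by simp only; omega⟩)
              ⟨j, by simp only; omega⟩
            have h5 : H.ybar z p j = 0 := h4
            rw [h5, mul_zero]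
    have h3 : H.ybar (z ^ M) = 0 := by
      rw [H.ybar_pow z hzc]
      ext m j
      exact h2 M m j (by have := hM j; have := H.pos m; omega)
    set u := z ^ M with hu
    have huc : x * u = u * x := Commute.pow_right hzc M
    have h4 : ∀ v, ∃ w, u v = x w := by
      intro v
      obtain ⟨w, hw⟩ := H.decomp (u v)
      refine ⟨w, hw.trans ?_⟩
      rw [Finset.sum_eq_zero, zero_add]
      intro m _
      rw [H.ybar_co u huc, h3]
      simp
    have h5 : ∀ r v, ∃ w, (u ^ r) v = (x ^ r) w := by
      intro r
      induction r with
      | zero => intro v; exact ⟨v, rfl⟩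
      | succ r ih =>
        intro v
        obtain ⟨w, hw⟩ := ih v
        obtain ⟨w', hw'⟩ := h4 w
        refine ⟨w', ?_⟩
        rw [pow_succ', Module.End.mul_apply, hw, comm_pow_apply huc, hw', pow_succ,
          Module.End.mul_apply]
    have hxM : x ^ M = 0 := by
      apply H.ext
      intro j s
      rw [← Module.End.mul_apply, ← pow_add, H.zero j _ (by have := hM j; omega)]
      rfl
    have h6 : u ^ M = 0 := by
      ext v
      obtain ⟨w, hw⟩ := h5 M v
      rw [hw, hxM]; rfl
    refine ⟨N * M * M, ?_⟩
    rw [pow_mul, pow_mul]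
    exact h6

end part8

section part9

theorem EForm.repr {F V : Type} [Field F] [AddCommGroup V] [Module F V] [Module.Finite F V]
    {B : LinearMap.BilinForm F V} {ε : F} {δ : ℕ} (h : EForm B ε δ) (f : V →ₗ[F] F) :
    ∃ u, B u = f := by
  have hinj : Function.Injective (B : V →ₗ[F] Module.Dual F V) := by
    rw [← LinearMap.ker_eq_bot, LinearMap.ker_eq_bot']
    intro a ha
    apply h.nd
    intro b
    rw [ha]; rfl
  have hs := (LinearMap.injective_iff_surjective_of_finrank_eq_finrank
    (Subspace.dual_finrank_eq (K := F) (V := V)).symm).1 hinj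
  exact hs f

theorem SkewEnd.pow {F V : Type} [Field F] [AddCommGroup V] [Module F V]
    {B : LinearMap.BilinForm F V} {x : V →ₗ[F] V} (hx : SkewEnd B x) (s : ℕ) (a b : V) :
    B ((x ^ s) a) b = (-1) ^ s * B a ((x ^ s) b) := by
  induction s generalizing a b with
  | zero => simp
  | succ s ih =>
    rw [pow_succ', Module.End.mul_apply, hx, ih, ← Module.End.mul_apply, ← pow_succ, ← pow_succ',
      pow_succ (-1 : F)]
    ring

section nt
variable {F J : Type} [Field F] [Fintype F] [Fintype J] [DecidableEq J]

/-- matrices `T(j,l) = B(y δ_j) δ_l` of nilpotent skew endomorphisms. -/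
def ntSet (B : LinearMap.BilinForm F (J → F)) : Set (J × J → F) :=
  {T | ∃ y, SkewEnd B y ∧ IsNilpotent y ∧ ∀ p : J × J, T p = B (y (Pi.single p.1 1)) (Pi.single p.2 1)}

theorem EForm.eq_of_single {B : LinearMap.BilinForm F (J → F)} {ε : F} {δ : ℕ} (h : EForm B ε δ)
    (y z : (J → F) →ₗ[F] (J → F))
    (hyz : ∀ j l, B (y (Pi.single j 1)) (Pi.single l 1) = B (z (Pi.single j 1)) (Pi.single l 1)) :
    y = z := by
  apply (Pi.basisFun F J).ext
  intro j
  rw [Pi.basisFun_apply, ← sub_eq_zero]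
  apply h.nd
  intro b
  have : B (y (Pi.single j 1) - z (Pi.single j 1)) = 0 := by
    apply (Pi.basisFun F J).ext
    intro l
    rw [Pi.basisFun_apply, map_sub, LinearMap.sub_apply, hyz, sub_self]
    rfl
  rw [this]; rfl

theorem ntSet_sub {B : LinearMap.BilinForm F (J → F)} {ε : F} {δ : ℕ} (h : EForm B ε δ) :
    ntSet B ⊆ (symSub F (Prod.swap : J × J → J × J) (fun _ => -ε) : Set (J × J → F)) := by
  rintro T ⟨y, hy, -, hT⟩
  rw [SetLike.mem_coe, mem_symSub]
  intro p
  rw [hT, hT]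
  simp only [Prod.fst_swap, Prod.snd_swap]
  rw [hy, h.symm]
  ring

theorem ntSet_card {B : LinearMap.BilinForm F (J → F)} {ε : F} {δ : ℕ} (h : EForm B ε δ) :
    (Fintype.card F : ℚ) ^ (Fintype.card J / 2) * (Nat.card (ntSet B) : ℚ) =
      Nat.card (symSub F (Prod.swap : J × J → J × J) (fun _ => -ε)) := by
  have h1 := steinberg h
  rw [symMat_card F h.two ε δ h.eps, ← Module.finrank_fintype_fun_eq_card F (η := J), ← h1]
  congr 2
  symm
  apply Nat.card_congr
  refine Equiv.ofBijective (fun y => ⟨fun p => B (y.1 (Pi.single p.1 1)) (Pi.single p.2 1),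
    y.1, y.2.1, y.2.2, fun _ => rfl⟩) ⟨?_, ?_⟩
  · intro y z hyz
    apply Subtype.ext
    apply h.eq_of_single
    intro j l
    exact congrFun (congrArg Subtype.val hyz) (j, l)
  · rintro ⟨T, y, hy, hn, hT⟩
    exact ⟨⟨y, hy, hn⟩, Subtype.ext (funext fun p => (hT p).symm)⟩

end nt

variable {F V ι : Type} [Field F] [Fintype F] [AddCommGroup V] [Module F V] [Fintype ι] [DecidableEq ι]
  {x : V →ₗ[F] V} {k : ι → ℕ} {e : ι → V} {b : Module.Basis (Σ j, Fin (k j)) F V}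
  {B : LinearMap.BilinForm F V}

noncomputable def blkE (F : Type) {V ι : Type} [Field F] [AddCommGroup V] [Module F V] [Fintype ι]
    [DecidableEq ι] (k : ι → ℕ) (e : ι → V) (i : ℕ) :
    (JBlk k i → F) →ₗ[F] V :=
  Fintype.linearCombination F (fun m : JBlk k i => e m.1)

theorem blkE_apply (i : ℕ) (a : JBlk k i → F) : blkE F k e i a = ∑ m, a m • e m.1 := rfl

theorem blkE_single (i : ℕ) (m : JBlk k i) : blkE F k e i (Pi.single m 1) = e m.1 := by
  rw [blkE, Fintype.linearCombination_apply_single, one_smul]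

noncomputable def blkB (B : LinearMap.BilinForm F V) (x : V →ₗ[F] V) (k : ι → ℕ) (e : ι → V) (i : ℕ) :
    LinearMap.BilinForm F (JBlk k i → F) :=
  LinearMap.compl₁₂ B (blkE F k e i) ((x ^ i) ∘ₗ blkE F k e i)

theorem blkB_apply (i : ℕ) (a c : JBlk k i → F) :
    blkB B x k e i a c = B (blkE F k e i a) ((x ^ i) (blkE F k e i c)) := rfl

theorem JB.blkE_zero (H : JB x k e b) (i s : ℕ) (hs : i < s) (a : JBlk k i → F) :
    (x ^ s) (blkE F k e i a) = 0 := by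
  rw [blkE_apply, map_sum]
  apply Finset.sum_eq_zero
  intro m _
  rw [map_smul, H.zero m.1 s (by have := m.2; omega), smul_zero]

theorem JB.blkE_ker (H : JB x k e b) (hB : EForm B (-1) 1) (hx : SkewEnd B x) (i : ℕ)
    (m : ι) (hm : k m < i + 1) (a : V) : B (e m) ((x ^ i) a) = 0 := by
  have := hx.pow i (e m) a
  rw [H.zero m i (by omega), map_zero, LinearMap.zero_apply] at this
  rcases mul_eq_zero.1 this.symm with h | h
  · exact absurd h (pow_ne_zero _ (by simp))
  · exact h

theorem JB.blkE_xk (H : JB x k e b) (hx : SkewEnd B x) (i : ℕ)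
    (w : V) (a : JBlk k i → F) : B (x w) ((x ^ i) (blkE F k e i a)) = 0 := by
  rw [hx, ← Module.End.mul_apply, ← pow_succ', H.blkE_zero i (i + 1) (by omega), map_zero, neg_zero]

theorem JB.blk_eform [Finite V] (H : JB x k e b) (hB : EForm B (-1) 1) (hx : SkewEnd B x) (i : ℕ) :
    EForm (blkB B x k e i) ((-1) ^ (i + 1)) (if Even i then 1 else 0) where
  symm a c := by
    rw [blkB_apply, blkB_apply, hB.symm, hx.pow, pow_succ]
    ring
  two := hB.two
  eps := by
    by_cases h : Even i
    · right
      refine ⟨?_, by simp [h]⟩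
      exact Odd.neg_one_pow (by simpa [Nat.odd_add_one] using h)
    · left
      refine ⟨?_, by simp [h]⟩
      exact Even.neg_one_pow (by simpa [Nat.even_add_one] using h)
  nd a ha := by
    set w := (x ^ i) (blkE F k e i a) with hw
    have h0 : ∀ v, (x ^ (i + 1)) v = 0 → B w v = 0 := by
      intro v hv
      obtain ⟨u, hu⟩ := H.decomp v
      have h1 : B (∑ m, H.co m v • e m + x u) w = 0 := by
        rw [map_add, LinearMap.add_apply, H.blkE_xk hx, add_zero, map_sum, LinearMap.sum_apply]
        apply Finset.sum_eq_zero
        intro m _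
        rw [map_smul, LinearMap.smul_apply]
        rcases lt_trichotomy (k m) (i + 1) with h | h | h
        · rw [H.blkE_ker hB hx i m h, smul_zero]
        · have h2 := ha (Pi.single ⟨m, h⟩ 1)
          rw [blkB_apply, blkE_single] at h2
          have h3 := hx.pow i (blkE F k e i a) (e m)
          rw [h2, mul_zero] at h3
          rw [hB.symm0 h3, smul_zero]
        · rw [H.co_tri m (i + 1) h v hv, zero_smul]
      rw [← hu] at h1
      exact hB.symm0 h1
    have h1 : B w ∈ LinearMap.range (LinearMap.dualMap (x ^ (i + 1))) := by
      rw [LinearMap.range_dualMap_eq_dualAnnihilator_ker, Submodule.mem_dualAnnihilator]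
      intro v hv
      exact h0 v hv
    obtain ⟨g, hg⟩ := h1
    obtain ⟨u, hu⟩ := hB.repr g
    have h2 : w = (x ^ (i + 1)) (((-1 : F) ^ (i + 1)) • u) := by
      rw [← sub_eq_zero]
      apply hB.nd
      intro v
      rw [map_sub, LinearMap.sub_apply, map_smul, map_smul, LinearMap.smul_apply, hx.pow (i + 1), ← hg, hu,
        LinearMap.dualMap_apply, smul_eq_mul, ← mul_assoc, ← mul_pow]
      simp
    funext m
    have h3 := H.coord_lt m.1 i (by have := m.2; omega) (i + 1) (by omega) (((-1 : F) ^ (i + 1)) • u)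
    rw [← h2, hw, H.coord_pow, blkE_apply, map_sum, Finset.sum_eq_single m] at h3
    · rw [map_smul, H.co_e, if_pos rfl] at h3
      simpa using h3
    · intro c _ hc
      rw [map_smul, H.co_e, if_neg (fun h => hc (Subtype.ext h.symm)), smul_zero]
    · simp

theorem JB.rho_form (H : JB x k e b) (hB : EForm B (-1) 1) (hx : SkewEnd B x) (i : ℕ)
    (y : V →ₗ[F] V) (hy : x * y = y * x) (a c : JBlk k i → F) :
    blkB B x k e i (Matrix.toLin' (H.rho i y) a) c =
      B (y (blkE F k e i a)) ((x ^ i) (blkE F k e i c)) := by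
  obtain ⟨w, hw⟩ := H.decomp (y (blkE F k e i a))
  conv_rhs => rw [hw]
  rw [map_add, LinearMap.add_apply, H.blkE_xk hx, add_zero, blkB_apply]
  rw [map_sum, LinearMap.sum_apply, sum_blk k i]
  · conv_lhs => rw [blkE_apply, map_sum, LinearMap.sum_apply]
    apply Finset.sum_congr rfl
    intro m _
    congr 3
    rw [Matrix.toLin'_apply, Matrix.mulVec, dotProduct, blkE_apply, map_sum, map_sum]
    apply Finset.sum_congr rfl
    intro j _
    rw [map_smul, map_smul, smul_eq_mul, mul_comm]
    rfl
  · intro m hm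
    rw [map_smul, LinearMap.smul_apply]
    rcases lt_or_gt_of_ne hm with h | h
    · rw [H.blkE_ker hB hx i m h, smul_zero]
    · rw [H.co_tri m (i + 1) h, zero_smul]
      rw [← comm_pow_apply hy, H.blkE_zero i (i + 1) (by omega), map_zero]

theorem JB.rho_skew [Finite V] (H : JB x k e b) (hB : EForm B (-1) 1) (hx : SkewEnd B x) (i : ℕ)
    (y : V →ₗ[F] V) (hy : x * y = y * x) (hs : SkewEnd B y) :
    SkewEnd (blkB B x k e i) (Matrix.toLin' (H.rho i y)) := by
  intro a c
  rw [(H.blk_eform hB hx i).symm a, H.rho_form hB hx i y hy, H.rho_form hB hx i y hy, hs,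
    comm_pow_apply hy, hB.symm, hx.pow, pow_succ]
  ring

theorem JB.nt_iff [Finite V] (H : JB x k e b) (hB : EForm B (-1) 1) (hx : SkewEnd B x) (i : ℕ)
    (y : V →ₗ[F] V) (hy : x * y = y * x) (hs : SkewEnd B y) :
    IsNilpotent (H.rho i y) ↔
      (fun p : JBlk k i × JBlk k i => B (y (e p.1.1)) ((x ^ i) (e p.2.1))) ∈
        ntSet (blkB B x k e i) := by
  have key : ∀ j l : JBlk k i, blkB B x k e i (Matrix.toLin' (H.rho i y) (Pi.single j 1))
      (Pi.single l 1) = B (y (e j.1)) ((x ^ i) (e l.1)) := by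
    intro j l
    rw [H.rho_form hB hx i y hy, blkE_single, blkE_single]
  constructor
  · intro h
    exact ⟨Matrix.toLin' (H.rho i y), H.rho_skew hB hx i y hy hs,
      (Matrix.isNilpotent_toLin'_iff _).2 h, fun p => (key p.1 p.2).symm⟩
  · rintro ⟨z, hz, hzn, hT⟩
    have : Matrix.toLin' (H.rho i y) = z := by
      apply (H.blk_eform hB hx i).eq_of_single
      intro j l
      rw [key]
      exact hT (j, l)
    rw [← this] at hzn
    exact (Matrix.isNilpotent_toLin'_iff _).1 hzn

end part9

section part10

theorem card_preimage_mul {A C : Type} [AddCommGroup A] [AddCommGroup C] [Finite A]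
    (f : A →+ C) (hf : Function.Surjective f) (S : Set C) :
    Nat.card {a // f a ∈ S} * Nat.card C = Nat.card A * Nat.card S := by
  obtain ⟨g, hg⟩ := hf.hasRightInverse
  have key : ∀ S : Set C, Nat.card {a // f a ∈ S} = Nat.card S * Nat.card f.ker := by
    intro S
    rw [← Nat.card_prod]
    apply Nat.card_congr
    exact
      { toFun := fun a => (⟨f a.1, a.2⟩, ⟨a.1 - g (f a.1), by
          rw [AddMonoidHom.mem_ker, map_sub, hg, sub_self]⟩)
        invFun := fun p => ⟨p.2.1 + g p.1.1, by
          have := p.2.2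
          rw [AddMonoidHom.mem_ker] at this
          rw [map_add, this, hg, zero_add]
          exact p.1.2⟩
        left_inv := fun a => by simp
        right_inv := fun p => by
          have := p.2.2
          rw [AddMonoidHom.mem_ker] at this
          have h2 : f (p.2.1 + g p.1.1) = p.1.1 := by rw [map_add, this, hg, zero_add]
          apply Prod.ext
          · exact Subtype.ext h2
          · apply Subtype.ext
            simp only [h2, add_sub_cancel_right] }
  have h1 := key Set.univ
  have h2 : Nat.card {a // f a ∈ (Set.univ : Set C)} = Nat.card A :=
    Nat.card_congr (Equiv.subtypeUnivEquiv (fun _ => trivial))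
  have h3 : Nat.card (Set.univ : Set C) = Nat.card C := Nat.card_congr (Equiv.Set.univ C)
  rw [key S, ← h2, h1, h3]
  ring

def gSwap (ι : Type) (M : ℕ) : ι × ι × Fin M → ι × ι × Fin M := fun p => (p.2.1, p.1, p.2.2)

def gEta (F : Type) [Field F] {ι : Type} (k : ι → ℕ) (M : ℕ) : ι × ι × Fin M → F := fun p =>
  if (p.2.2 : ℕ) < k p.1 ∧ (p.2.2 : ℕ) < k p.2.1 then (-1) ^ (p.2.2 : ℕ) else 0

theorem sum_fin_lt (M a : ℕ) (ha : a ≤ M) (P : ℕ → Prop) [DecidablePred P] :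
    (∑ s : Fin M, if ((s : ℕ) < a ∧ P s) then 1 else 0) = ∑ s ∈ Finset.range a, if P s then 1 else 0 := by
  rw [Fin.sum_univ_eq_sum_range (fun s => if (s < a ∧ P s) then 1 else 0) M]
  have : Finset.range a ⊆ Finset.range M := Finset.range_subset_range.2 ha
  rw [← Finset.sum_subset this]
  · apply Finset.sum_congr rfl
    intro s hs
    rw [Finset.mem_range] at hs
    simp [hs]
  · intro s _ hs
    rw [Finset.mem_range] at hs
    simp [hs]

theorem sum_even (a : ℕ) : (∑ s ∈ Finset.range a, if Even s then 1 else 0) = (a + 1) / 2 := by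
  induction a with
  | zero => simp
  | succ a ih =>
    rw [Finset.sum_range_succ, ih]
    by_cases h : Even a
    · rw [if_pos h]; obtain ⟨c, rfl⟩ := h; omega
    · rw [if_neg h]; rw [Nat.not_even_iff_odd] at h; obtain ⟨c, rfl⟩ := h; omega

theorem sum_odd (a : ℕ) : (∑ s ∈ Finset.range a, if ¬ Even s then 1 else 0) = a / 2 := by
  induction a with
  | zero => simp
  | succ a ih =>
    rw [Finset.sum_range_succ, ih]
    by_cases h : Even a
    · rw [if_neg (not_not.2 h)]; obtain ⟨c, rfl⟩ := h; omega
    · rw [if_pos h]; rw [Nat.not_even_iff_odd] at h; obtain ⟨c, rfl⟩ := h; omega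

theorem gSub_card (F : Type) [Field F] [Fintype F] (h2 : (2 : F) ≠ 0) {ι : Type} [Fintype ι]
    [DecidableEq ι] (k : ι → ℕ) (M : ℕ) (hM : ∀ j, k j ≤ M) :
    ∃ d : ℕ, Nat.card (symSub F (gSwap ι M) (gEta F k M)) = Fintype.card F ^ d ∧
      2 * d = (∑ j, ∑ l, min (k j) (k l)) + (Finset.univ.filter (fun j => Odd (k j))).card := by
  classical
  have hm1 : (-1 : F) ≠ 1 := by
    intro h; apply h2; linear_combination -h
  have hpow : ∀ s : ℕ, (-1 : F) ^ s = 1 ↔ Even s := by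
    intro s
    rcases Nat.even_or_odd s with h | h
    · simp [h, h.neg_one_pow]
    · simp [h.neg_one_pow, hm1, h]
  have hpow' : ∀ s : ℕ, (-1 : F) ^ s = -1 ↔ ¬ Even s := by
    intro s
    rcases Nat.even_or_odd s with h | h
    · simp [h, h.neg_one_pow, hm1.symm]
    · simp [h.neg_one_pow, h]
  obtain ⟨d, hd, he⟩ := symSub_card F h2 (gSwap ι M) (fun p => rfl) (gEta F k M)
    (by
      intro p
      unfold gEta
      split_ifs
      · rcases Nat.even_or_odd (p.2.2 : ℕ) with h | h
        · simp [h.neg_one_pow]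
        · simp [h.neg_one_pow]
      · simp)
    (by
      intro p
      simp only [gEta, gSwap, and_comm])
  refine ⟨d, hd, ?_⟩
  have c1 : (Finset.univ.filter (fun p => gEta F k M p ≠ 0)).card = ∑ j, ∑ l, min (k j) (k l) := by
    rw [Finset.card_filter, Fintype.sum_prod_type]
    apply Finset.sum_congr rfl
    intro j _
    rw [Fintype.sum_prod_type]
    apply Finset.sum_congr rfl
    intro l _
    have := sum_fin_lt M (min (k j) (k l)) (le_trans (min_le_left _ _) (hM j)) (fun _ => True)
    simp only [and_true, if_true, Finset.sum_const, Finset.card_range, smul_eq_mul, mul_one] at this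
    rw [← this]
    apply Finset.sum_congr rfl
    intro s _
    simp [gEta]
  have c2 : (Finset.univ.filter (fun p => gSwap ι M p = p ∧ gEta F k M p = 1)).card =
      ∑ j, (k j + 1) / 2 := by
    rw [Finset.card_filter, Fintype.sum_prod_type]
    apply Finset.sum_congr rfl
    intro j _
    rw [Fintype.sum_prod_type, Finset.sum_eq_single j]
    · rw [← sum_even, ← sum_fin_lt M (k j) (hM j)]
      apply Finset.sum_congr rfl
      intro s _
      simp only [gEta, gSwap, and_self, true_and]
      by_cases h : (s : ℕ) < k j
      · simp [h, hpow]
      · simp [h]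
    · intro l _ hl
      apply Finset.sum_eq_zero
      intro s _
      simp [gSwap, hl]
    · simp
  have c3 : (Finset.univ.filter (fun p => gSwap ι M p = p ∧ gEta F k M p = -1)).card =
      ∑ j, (k j) / 2 := by
    rw [Finset.card_filter, Fintype.sum_prod_type]
    apply Finset.sum_congr rfl
    intro j _
    rw [Fintype.sum_prod_type, Finset.sum_eq_single j]
    · rw [← sum_odd, ← sum_fin_lt M (k j) (hM j)]
      apply Finset.sum_congr rfl
      intro s _
      simp only [gEta, gSwap, and_self, true_and]
      by_cases h : (s : ℕ) < k j
      · simp only [h, if_true, hpow', true_and]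
      · simp [h]
    · intro l _ hl
      apply Finset.sum_eq_zero
      intro s _
      simp [gSwap, hl]
    · simp
  have c4 : (∑ j, (k j + 1) / 2) = (∑ j, (k j) / 2) +
      (Finset.univ.filter (fun j => Odd (k j))).card := by
    rw [Finset.card_filter, ← Finset.sum_add_distrib]
    apply Finset.sum_congr rfl
    intro j _
    by_cases h : Odd (k j)
    · rw [if_pos h]; obtain ⟨c, hc⟩ := h; omega
    · rw [if_neg h]; rw [Nat.not_odd_iff_even] at h; obtain ⟨c, hc⟩ := h; omega
  rw [c1, c2, c3, c4] at he
  omega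

variable {F V ι : Type} [Field F] [Fintype F] [AddCommGroup V] [Module F V] [Finite V]
  [Fintype ι] [DecidableEq ι]
  {x : V →ₗ[F] V} {k : ι → ℕ} {e : ι → V} {b : Module.Basis (Σ j, Fin (k j)) F V}
  {B : LinearMap.BilinForm F V}

theorem JB.c_pow (H : JB x k e b) (hx : SkewEnd B x) (y : V →ₗ[F] V) (hy : x * y = y * x)
    (j l : ι) (a a' : ℕ) : B (y ((x ^ a) (e j))) ((x ^ a') (e l)) =
      (-1) ^ a * B (y (e j)) ((x ^ (a + a')) (e l)) := by
  rw [comm_pow_apply hy, hx.pow, ← Module.End.mul_apply, ← pow_add]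

theorem JB.c_mem (H : JB x k e b) (hB : EForm B (-1) 1) (hx : SkewEnd B x) (M : ℕ)
    (y : V →ₗ[F] V) (hs : SkewEnd B y) (hy : x * y = y * x) :
    (fun p : ι × ι × Fin M => B (y (e p.1)) ((x ^ (p.2.2 : ℕ)) (e p.2.1))) ∈
      symSub F (gSwap ι M) (gEta F k M) := by
  rw [mem_symSub]
  rintro ⟨j, l, s⟩
  simp only [gSwap, gEta]
  have h1 : B (y (e l)) ((x ^ (s : ℕ)) (e j)) = (-1) ^ (s : ℕ) * B (y (e j)) ((x ^ (s : ℕ)) (e l)) := by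
    rw [hs, comm_pow_apply hy, hB.symm, hx.pow]; ring
  split_ifs with h
  · exact h1
  · rw [zero_mul]
    rcases not_and_or.1 h with h | h
    · rw [H.zero j _ (by omega), map_zero]
    · rw [h1, H.zero l _ (by omega), map_zero, mul_zero]

theorem JB.c_inj (H : JB x k e b) (hB : EForm B (-1) 1) (hx : SkewEnd B x) (M : ℕ)
    (hM : ∀ j, k j ≤ M)
    (y z : V →ₗ[F] V) (hy : x * y = y * x) (hz : x * z = z * x)
    (h : ∀ p : ι × ι × Fin M, B (y (e p.1)) ((x ^ (p.2.2 : ℕ)) (e p.2.1)) =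
      B (z (e p.1)) ((x ^ (p.2.2 : ℕ)) (e p.2.1))) : y = z := by
  apply H.ext
  intro j a
  rw [← sub_eq_zero]
  apply hB.nd
  intro v
  have : B (y ((x ^ a) (e j)) - z ((x ^ a) (e j))) = 0 := by
    apply H.ext
    intro l a'
    rw [map_sub, LinearMap.sub_apply, H.c_pow hx y hy, H.c_pow hx z hz, LinearMap.zero_apply, sub_eq_zero]
    by_cases hs : a + a' < M
    · rw [h (j, l, ⟨a + a', hs⟩)]
    · rw [H.zero l _ (by have := hM l; omega), map_zero, map_zero]
  rw [this]; rfl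

theorem JB.c_surj (H : JB x k e b) (hB : EForm B (-1) 1) (hx : SkewEnd B x) (M : ℕ)
    (hM : ∀ j, k j ≤ M) (c : ι × ι × Fin M → F) (hc : c ∈ symSub F (gSwap ι M) (gEta F k M)) :
    ∃ y : V →ₗ[F] V, SkewEnd B y ∧ x * y = y * x ∧
      ∀ p : ι × ι × Fin M, B (y (e p.1)) ((x ^ (p.2.2 : ℕ)) (e p.2.1)) = c p := by
  rw [mem_symSub] at hc
  let ct : ι → ι → ℕ → F := fun j l s => if h : s < M then c (j, l, ⟨s, h⟩) else 0
  have hct : ∀ j l s, ct l j s = (if s < k j ∧ s < k l then (-1) ^ s else 0) * ct j l s := by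
    intro j l s
    simp only [ct]
    by_cases h : s < M
    · simp only [h, dif_pos]
      exact hc (j, l, ⟨s, h⟩)
    · simp [h]
  have hz1 : ∀ j l s, k l ≤ s → ct j l s = 0 := by
    intro j l s h
    rw [hct l j s, if_neg (by omega), zero_mul]
  have hz2 : ∀ j l s, k j ≤ s → ct j l s = 0 := by
    intro j l s h
    rw [hct l j s, if_neg (by omega), zero_mul]
  have hsy : ∀ j l s, ct l j s = (-1) ^ s * ct j l s := by
    intro j l s
    by_cases h : s < k j ∧ s < k l
    · rw [hct j l s, if_pos h]
    · rw [hct j l s, if_neg h, zero_mul]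
      rcases not_and_or.1 h with h | h
      · rw [hz2 _ _ _ (by omega), mul_zero]
      · rw [hz1 _ _ _ (by omega), mul_zero]
  let β : V →ₗ[F] V →ₗ[F] F := b.constr F (fun p => b.constr F (fun p' =>
    (-1) ^ (p.2 : ℕ) * ct p.1 p'.1 (p.2 + p'.2)))
  have hβ : ∀ j l a a', β ((x ^ a) (e j)) ((x ^ a') (e l)) = (-1) ^ a * ct j l (a + a') := by
    intro j l a a'
    by_cases h1 : a < k j
    · by_cases h2 : a' < k l
      · have e1 := H.hb j ⟨a, h1⟩
        have e2 := H.hb l ⟨a', h2⟩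
        simp only at e1 e2
        rw [← e1, ← e2]
        simp only [β, Module.Basis.constr_basis]
      · rw [H.zero l a' (by omega), map_zero, hz1 _ _ _ (by omega), mul_zero]
    · rw [H.zero j a (by omega), map_zero, LinearMap.zero_apply, hz2 _ _ _ (by omega), mul_zero]
  choose u hu using fun p => hB.repr (β (b p))
  let y : V →ₗ[F] V := b.constr F u
  have hy : ∀ v w, B (y v) w = β v w := by
    have : B ∘ₗ y = β := by
      apply b.ext
      intro p
      rw [LinearMap.comp_apply]
      simp only [y, Module.Basis.constr_basis]
      rw [hu]
    intro v w
    rw [← this]; rfl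
  have hβx : ∀ v w, β (x v) w = - β v (x w) := by
    have : β ∘ₗ x = - LinearMap.compl₂ β x := by
      apply H.ext
      intro j a
      apply H.ext
      intro l a'
      have e1 := hβ j l (a + 1) a'
      have e2 := hβ j l a (a' + 1)
      rw [pow_succ', Module.End.mul_apply] at e1
      rw [pow_succ' x, Module.End.mul_apply] at e2
      rw [LinearMap.comp_apply, e1, LinearMap.neg_apply, LinearMap.neg_apply,
        LinearMap.compl₂_apply, e2, show a + 1 + a' = a + (a' + 1) by ring]
      ring
    intro v w
    have := congrFun (congrArg DFunLike.coe (congrFun (congrArg DFunLike.coe this) v)) w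
    exact this
  have hβs : ∀ v w, β v w = β w v := by
    have : β = LinearMap.flip β := by
      apply H.ext
      intro j a
      apply H.ext
      intro l a'
      rw [LinearMap.flip_apply, hβ, hβ, hsy j l, add_comm a' a, ← mul_assoc, ← pow_add]
      congr 1
      rw [show a' + (a + a') = a + 2 * a' by ring, pow_add, pow_mul]
      simp
    intro v w
    have := congrFun (congrArg DFunLike.coe (congrFun (congrArg DFunLike.coe this) v)) w
    exact this
  refine ⟨y, ?_, ?_, ?_⟩
  · intro v w
    rw [hy, hβs, hB.symm v, hy]; ring
  · apply LinearMap.ext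
    intro v
    rw [Module.End.mul_apply, Module.End.mul_apply, ← sub_eq_zero]
    apply hB.nd
    intro w
    rw [map_sub, LinearMap.sub_apply, hx, hy, hy, hβx, sub_self]
  · rintro ⟨j, l, s⟩
    rw [hy]
    have := hβ j l 0 s
    simp only [pow_zero, Module.End.one_apply, one_mul, zero_add] at this
    rw [this]
    simp [ct]

end part10

section part11

variable {F V ι : Type} [Field F] [Fintype F] [AddCommGroup V] [Module F V] [Finite V]
  [Fintype ι] [DecidableEq ι]
  {x : V →ₗ[F] V} {k : ι → ℕ} {e : ι → V} {b : Module.Basis (Σ j, Fin (k j)) F V}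
  {B : LinearMap.BilinForm F V}

/-- projection to the top coefficients -/
def topMap (F : Type) [Field F] {ι : Type} (k : ι → ℕ) (M : ℕ) :
    symSub F (gSwap ι M) (gEta F k M) →+
      (Π i : Fin M, symSub F (Prod.swap : JBlk k i × JBlk k i → JBlk k i × JBlk k i)
        (fun _ => -((-1 : F) ^ ((i : ℕ) + 1)))) where
  toFun c := fun i => ⟨fun p => c.1 (p.1.1, p.2.1, i), by
    rw [mem_symSub]
    rintro ⟨j, l⟩
    have h := (mem_symSub _ _ _).1 c.2 (j.1, l.1, i)
    have h1 := j.2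
    have h2 := l.2
    simp only [gSwap, gEta] at h
    rw [if_pos (by omega)] at h
    simp only [Prod.fst_swap, Prod.snd_swap]
    rw [h, pow_succ]
    ring⟩
  map_zero' := rfl
  map_add' _ _ := rfl

theorem topMap_surj (F : Type) [Field F] {ι : Type} (k : ι → ℕ) (M : ℕ) :
    Function.Surjective (topMap F k M) := by
  classical
  intro t
  let c : ι × ι × Fin M → F := fun p =>
    if h : k p.1 = p.2.2 + 1 ∧ k p.2.1 = p.2.2 + 1 then (t p.2.2).1 (⟨p.1, h.1⟩, ⟨p.2.1, h.2⟩) else 0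
  have hc : c ∈ symSub F (gSwap ι M) (gEta F k M) := by
    rw [mem_symSub]
    rintro ⟨j, l, s⟩
    simp only [c, gSwap, gEta]
    by_cases h : k j = s + 1 ∧ k l = s + 1
    · rw [dif_pos h, dif_pos h.symm, if_pos (by omega)]
      have := (mem_symSub _ _ _).1 (t s).2 (⟨j, h.1⟩, ⟨l, h.2⟩)
      simp only [Prod.swap_prod_mk] at this
      rw [this]
      congr 1
      rw [pow_succ]
      ring
    · rw [dif_neg h, dif_neg (fun h' => h h'.symm), mul_zero]
  refine ⟨⟨c, hc⟩, ?_⟩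
  funext i
  apply Subtype.ext
  funext p
  obtain ⟨j, l⟩ := p
  have : c (j.1, l.1, i) = (t i).1 (j, l) := by
    simp only [c]
    rw [dif_pos ⟨j.2, l.2⟩]
  exact this

theorem JB.count (H : JB x k e b) (hB : EForm B (-1) 1) (hx : SkewEnd B x) (M : ℕ)
    (hM : ∀ j, k j ≤ M) :
    ∃ d : ℕ, Nat.card {y : V →ₗ[F] V // SkewEnd B y ∧ IsNilpotent y ∧ x * y = y * x} *
        Fintype.card F ^ (∑ i : Fin M, Fintype.card (JBlk k i) / 2) = Fintype.card F ^ d ∧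
      2 * d = (∑ j, ∑ l, min (k j) (k l)) + (Finset.univ.filter (fun j => Odd (k j))).card := by
  classical
  obtain ⟨d, hd, he⟩ := gSub_card F hB.two k M hM
  refine ⟨d, ?_, he⟩
  let S : Set (Π i : Fin M, symSub F (Prod.swap : JBlk k i × JBlk k i → JBlk k i × JBlk k i)
        (fun _ => -((-1 : F) ^ ((i : ℕ) + 1)))) := {t | ∀ i : Fin M, (t i).1 ∈ ntSet (blkB B x k e i)}
  have h1 := card_preimage_mul (topMap F k M) (topMap_surj F k M) S
  have h2 : Nat.card {y : V →ₗ[F] V // SkewEnd B y ∧ IsNilpotent y ∧ x * y = y * x} =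
      Nat.card {a // topMap F k M a ∈ S} := by
    apply Nat.card_congr
    refine Equiv.ofBijective (fun y => ⟨⟨_, H.c_mem hB hx M y.1 y.2.1 y.2.2.2⟩, ?_⟩) ⟨?_, ?_⟩
    · intro i
      exact (H.nt_iff hB hx i y.1 y.2.2.2 y.2.1).1 ((H.nil_iff M hM y.1 y.2.2.2).1 y.2.2.1 i)
    · intro y z hyz
      apply Subtype.ext
      apply H.c_inj hB hx M hM _ _ y.2.2.2 z.2.2.2
      intro p
      exact congrFun (congrArg Subtype.val (congrArg Subtype.val hyz)) p
    · rintro ⟨⟨c, hc⟩, hS⟩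
      obtain ⟨y, hy, hyx, hyc⟩ := H.c_surj hB hx M hM c hc
      refine ⟨⟨y, hy, ?_, hyx⟩, ?_⟩
      · rw [H.nil_iff M hM y hyx]
        intro i
        rw [H.nt_iff hB hx i y hyx hy]
        have h3 := hS i
        convert h3 using 1
        funext p
        exact hyc (p.1.1, p.2.1, i)
      · apply Subtype.ext
        apply Subtype.ext
        funext p
        exact hyc p
  have h3 : Nat.card S = ∏ i : Fin M, Nat.card (ntSet (blkB B x k e i)) := by
    rw [← Nat.card_pi]
    apply Nat.card_congr
    exact
      { toFun := fun t i => ⟨(t.1 i).1, t.2 i⟩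
        invFun := fun t => ⟨fun i => ⟨(t i).1, ntSet_sub (H.blk_eform hB hx i) (t i).2⟩,
          fun i => (t i).2⟩
        left_inv := fun _ => rfl
        right_inv := fun _ => rfl }
  have h4 : ∀ i : Fin M, Nat.card (symSub F (Prod.swap : JBlk k i × JBlk k i → JBlk k i × JBlk k i)
        (fun _ => -((-1 : F) ^ ((i : ℕ) + 1)))) =
      Fintype.card F ^ (Fintype.card (JBlk k i) / 2) * Nat.card (ntSet (blkB B x k e i)) := by
    intro i
    have := ntSet_card (H.blk_eform hB hx i)
    exact_mod_cast this.symm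
  have h5 : 0 < ∏ i : Fin M, Nat.card (ntSet (blkB B x k e i)) := by
    apply Finset.prod_pos
    intro i _
    have : Nonempty (ntSet (blkB B x k e i)) :=
      ⟨⟨0, 0, fun a b => by simp, IsNilpotent.zero, fun p => by simp⟩⟩
    exact Nat.card_pos
  rw [Nat.card_pi, h3, ← h2, hd, Finset.prod_congr rfl (fun i _ => h4 i), Finset.prod_mul_distrib,
    Finset.prod_pow_eq_pow_sum, ← mul_assoc] at h1
  exact Nat.eq_of_mul_eq_mul_right h5 h1

end part11

section part12

theorem ms_min (A : Multiset ℕ) (m : ℕ) : (A.map (fun p => min (m + 1) p)).sum =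
    (A.map (fun p => min m p)).sum + Multiset.card (A.filter (fun p => m + 1 ≤ p)) := by
  induction A using Multiset.induction with
  | empty => simp
  | cons a A ih =>
    rw [Multiset.map_cons, Multiset.map_cons, Multiset.sum_cons, Multiset.sum_cons, ih]
    by_cases h : m + 1 ≤ a
    · rw [Multiset.filter_cons_of_pos (p := fun p => m + 1 ≤ p) _ h, Multiset.card_cons]; omega
    · rw [Multiset.filter_cons_of_neg (p := fun p => m + 1 ≤ p) _ h]; omega

theorem ms_count (A : Multiset ℕ) (m : ℕ) : Multiset.card (A.filter (fun p => m + 1 ≤ p)) =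
    Multiset.count (m + 1) A + Multiset.card (A.filter (fun p => m + 1 + 1 ≤ p)) := by
  induction A using Multiset.induction with
  | empty => simp
  | cons a A ih =>
    rw [Multiset.count_cons]
    by_cases h : m + 1 ≤ a
    · rw [Multiset.filter_cons_of_pos (p := fun p => m + 1 ≤ p) _ h, Multiset.card_cons, ih]
      by_cases h' : m + 1 + 1 ≤ a
      · rw [Multiset.filter_cons_of_pos (p := fun p => m + 1 + 1 ≤ p) _ h', Multiset.card_cons, if_neg (by omega)]; omega
      · rw [Multiset.filter_cons_of_neg (p := fun p => m + 1 + 1 ≤ p) _ h', if_pos (by omega)]; omega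
    · rw [Multiset.filter_cons_of_neg (p := fun p => m + 1 ≤ p) _ h, ih, Multiset.filter_cons_of_neg (p := fun p => m + 1 + 1 ≤ p) _ (by omega),
        if_neg (by omega)]
      omega

theorem ms_eq (A C : Multiset ℕ) (hA : ∀ a ∈ A, 0 < a) (hC : ∀ a ∈ C, 0 < a)
    (h : ∀ m, 1 ≤ m → (A.map (fun p => min m p)).sum = (C.map (fun p => min m p)).sum) : A = C := by
  have h0 : ∀ m, (A.map (fun p => min m p)).sum = (C.map (fun p => min m p)).sum := by
    intro m
    rcases Nat.eq_zero_or_pos m with rfl | hm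
    · simp
    · exact h m hm
  have h1 : ∀ m, Multiset.card (A.filter (fun p => m + 1 ≤ p)) =
      Multiset.card (C.filter (fun p => m + 1 ≤ p)) := by
    intro m
    have e1 := ms_min A m
    have e2 := ms_min C m
    have e3 := h0 m
    have e4 := h0 (m + 1)
    omega
  ext m
  rcases m with _ | m
  · rw [Multiset.count_eq_zero_of_notMem (fun h => absurd (hA _ h) (by omega)),
      Multiset.count_eq_zero_of_notMem (fun h => absurd (hC _ h) (by omega))]
  · have e1 := ms_count A m
    have e2 := ms_count C m
    have e3 := h1 m
    have e4 := h1 (m + 1)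
    omega

theorem sum_min_eq {ι : Type} [Fintype ι] (k : ι → ℕ) (M : ℕ) (hM : ∀ j, k j ≤ M) :
    (∑ j, ∑ l, min (k j) (k l)) =
      ∑ s ∈ Finset.range M, ((Finset.univ.filter (fun j => s + 1 ≤ k j)).card) ^ 2 := by
  have h1 : ∀ s, ((Finset.univ.filter (fun j => s + 1 ≤ k j)).card) ^ 2 =
      ∑ j, ∑ l, if s < min (k j) (k l) ∧ True then 1 else 0 := by
    intro s
    rw [Finset.card_filter, sq, Finset.sum_mul_sum]
    apply Finset.sum_congr rfl
    intro j _
    apply Finset.sum_congr rfl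
    intro l _
    by_cases h1 : s + 1 ≤ k j <;> by_cases h2 : s + 1 ≤ k l
    · rw [if_pos h1, if_pos h2, if_pos ⟨by omega, trivial⟩]
      norm_num
    · rw [if_pos h1, if_neg h2, if_neg (fun h => by omega)]
      norm_num
    · rw [if_neg h1, if_pos h2, if_neg (fun h => by omega)]
      norm_num
    · rw [if_neg h1, if_neg h2, if_neg (fun h => by omega)]
      norm_num
  simp_rw [h1]
  rw [Finset.sum_comm (s := Finset.range M)]
  apply Finset.sum_congr rfl
  intro j _
  rw [Finset.sum_comm (s := Finset.range M)]
  apply Finset.sum_congr rfl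
  intro l _
  have := sum_fin_lt M (min (k j) (k l)) (le_trans (min_le_left _ _) (hM j)) (fun _ => True)
  rw [← Fin.sum_univ_eq_sum_range (fun s => if s < min (k j) (k l) ∧ True then 1 else 0), this]
  simp

theorem sympJ_transpose (F : Type) [Field F] (n : ℕ) : (sympJ F n)ᵀ = - sympJ F n := by
  simp [sympJ, Matrix.fromBlocks_transpose, Matrix.fromBlocks_neg]

theorem sympJ_sq (F : Type) [Field F] (n : ℕ) : sympJ F n * sympJ F n = -1 := by
  rw [sympJ, Matrix.fromBlocks_multiply, ← Matrix.fromBlocks_one, Matrix.fromBlocks_neg]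
  simp

noncomputable def sympB (F : Type) [Field F] (n : ℕ) : LinearMap.BilinForm F (Fin n ⊕ Fin n → F) :=
  Matrix.toBilin' (sympJ F n)

theorem sympB_apply (F : Type) [Field F] (n : ℕ) (v w : Fin n ⊕ Fin n → F) :
    sympB F n v w = v ⬝ᵥ sympJ F n *ᵥ w := Matrix.toBilin'_apply' _ _ _

theorem sympB_eform (F : Type) [Field F] (h2 : (2 : F) ≠ 0) (n : ℕ) : EForm (sympB F n) (-1) 1 where
  symm v w := by
    rw [sympB_apply, sympB_apply, Matrix.dotProduct_mulVec, ← Matrix.mulVec_transpose,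
      sympJ_transpose, dotProduct_comm, Matrix.neg_mulVec, dotProduct_neg]
    ring
  nd v hv := by
    have h1 : ∀ w, v ⬝ᵥ w = 0 := by
      intro w
      have := hv (- sympJ F n *ᵥ w)
      rw [sympB_apply, Matrix.mulVec_mulVec, mul_neg, sympJ_sq, neg_neg, Matrix.one_mulVec] at this
      exact this
    exact dotProduct_eq_zero v h1
  eps := Or.inr ⟨rfl, rfl⟩
  two := h2

theorem sympB_skew (F : Type) [Field F] (n : ℕ) (y : Matrix (Fin n ⊕ Fin n) (Fin n ⊕ Fin n) F) :
    SkewEnd (sympB F n) (Matrix.toLin' y) ↔ y * sympJ F n = (y * sympJ F n)ᵀ := by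
  have h1 : SkewEnd (sympB F n) (Matrix.toLin' y) ↔ yᵀ * sympJ F n = - (sympJ F n * y) := by
    have e1 : ∀ v w, sympB F n (Matrix.toLin' y v) w = Matrix.toBilin' (yᵀ * sympJ F n) v w := by
      intro v w
      rw [sympB_apply, Matrix.toBilin'_apply', ← Matrix.mulVec_mulVec, Matrix.toLin'_apply,
        Matrix.dotProduct_mulVec v, Matrix.vecMul_transpose]
    have e2 : ∀ v w, sympB F n v (Matrix.toLin' y w) = Matrix.toBilin' (sympJ F n * y) v w := by
      intro v w
      rw [sympB_apply, Matrix.toBilin'_apply', ← Matrix.mulVec_mulVec, Matrix.toLin'_apply]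
    constructor
    · intro h
      apply (Matrix.toBilin' (R₁ := F) (n := Fin n ⊕ Fin n)).injective
      rw [map_neg]
      apply LinearMap.ext; intro v
      apply LinearMap.ext; intro w
      rw [LinearMap.neg_apply, LinearMap.neg_apply, ← e1, ← e2]
      exact h v w
    · intro h v w
      rw [e1, e2, h, map_neg]
      rfl
  rw [h1, Matrix.transpose_mul, sympJ_transpose, neg_mul]
  have hJ := sympJ_sq F n
  set J := sympJ F n
  constructor
  · intro h
    have h2 : J * (yᵀ * J) * J = J * (-(J * y)) * J := by rw [h]
    have h3 : J * (yᵀ * J) * J = - (J * yᵀ) := by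
      rw [mul_assoc, mul_assoc, hJ]; simp
    have h4 : J * (-(J * y)) * J = y * J := by
      rw [mul_neg, ← mul_assoc, hJ]; simp
    rw [← h3, h2, h4]
  · intro h
    have h2 : J * (y * J) * J = J * (-(J * yᵀ)) * J := by rw [h]
    have h3 : J * (y * J) * J = - (J * y) := by
      rw [mul_assoc, mul_assoc, hJ]; simp
    have h4 : J * (-(J * yᵀ)) * J = yᵀ * J := by
      rw [mul_neg, ← mul_assoc, hJ]; simp
    rw [← h3, h2, h4]

end part12

theorem card_nilpotent_centralizer_symplectic
    (q : ℕ) (hq : ∃ p m : ℕ, p.Prime ∧ 0 < m ∧ q = p ^ m) (hodd : Odd q)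
    (F : Type) [Field F] [Fintype F] (hF : Fintype.card F = q)
    (n : ℕ) (hn : 1 ≤ n) (lam : Nat.Partition (2 * n))
    (x : Matrix (Fin n ⊕ Fin n) (Fin n ⊕ Fin n) F)
    (hx : x * sympJ F n = (x * sympJ F n)ᵀ)
    (hnil : x ^ (2 * n) = 0)
    (htype : ∀ k : ℕ, 1 ≤ k → ((2 * n : ℕ) : ℤ) - Matrix.rank (x ^ k) =
      (lam.parts.map (fun p => min k p)).sum) :
    ∃ e : ℕ,
      2 * e + 2 * (∑ i ∈ Finset.range (2 * n), Multiset.count (i + 1) lam.parts / 2) =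
        (∑ k ∈ Finset.range (2 * n),
          (Multiset.card (lam.parts.filter (fun p => k + 1 ≤ p))) ^ 2) +
        Multiset.card (lam.parts.filter (fun p => Odd p)) ∧
      Nat.card {y : Matrix (Fin n ⊕ Fin n) (Fin n ⊕ Fin n) F //
          y * sympJ F n = (y * sympJ F n)ᵀ ∧ IsNilpotent y ∧ x * y = y * x} = q ^ e := by
  classical
  have h2 : (2 : F) ≠ 0 := by
    intro h
    have h1 : ((Fintype.card F : ℕ) : F) = 0 := FiniteField.cast_card_eq_zero F
    rw [hF] at h1
    obtain ⟨c, rfl⟩ := hodd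
    push_cast at h1
    rw [h, zero_mul, zero_add] at h1
    exact one_ne_zero h1
  have hB := sympB_eform F h2 n
  have hxs := (sympB_skew F n x).2 hx
  have hxn : IsNilpotent (Matrix.toLin' x) := (Matrix.isNilpotent_toLin'_iff x).2 ⟨2 * n, hnil⟩
  obtain ⟨ι, _, _, k, e, b, H⟩ := jordan_exists (Matrix.toLin' x) hxn
  have hsum : ∑ j, k j = 2 * n := by
    rw [← H.finrank_eq, Module.finrank_fintype_fun_eq_card]
    simp; ring
  have hM : ∀ j, k j ≤ 2 * n := by
    intro j
    rw [← hsum]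
    exact Finset.single_le_sum (fun _ _ => Nat.zero_le _) (Finset.mem_univ j)
  have hlam : lam.parts = Finset.univ.val.map k := by
    apply ms_eq
    · intro a ha
      exact lam.parts_pos ha
    · intro a ha
      obtain ⟨j, -, rfl⟩ := Multiset.mem_map.1 ha
      exact H.pos j
    · intro m hm
      have h3 := htype m hm
      have h4 := H.rank_pow m
      rw [← Matrix.toLin'_pow] at h4
      have h5 : Matrix.rank (x ^ m) = ∑ j, (k j - m) := h4
      rw [h5] at h3
      have h6 : ∑ j, (k j - m) + ∑ j, min m (k j) = 2 * n := by
        rw [← hsum, ← Finset.sum_add_distrib]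
        apply Finset.sum_congr rfl
        intro j _
        omega
      rw [Multiset.map_map]
      have h7 : (Multiset.map ((fun p => min m p) ∘ k) Finset.univ.val).sum = ∑ j, min m (k j) := rfl
      rw [h7]
      have h8 : ((lam.parts.map (fun p => min m p)).sum : ℤ) = ((∑ j, min m (k j) : ℕ) : ℤ) := by
        have h9 : ((∑ j, (k j - m) : ℕ) : ℤ) + ((∑ j, min m (k j) : ℕ) : ℤ) = ((2 * n : ℕ) : ℤ) := by
          exact_mod_cast h6
        rw [← h3]
        linarith
      exact_mod_cast h8
  obtain ⟨d, hd, he⟩ := H.count hB hxs (2 * n) hM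
  have hcard : Nat.card {y : Matrix (Fin n ⊕ Fin n) (Fin n ⊕ Fin n) F //
      y * sympJ F n = (y * sympJ F n)ᵀ ∧ IsNilpotent y ∧ x * y = y * x} =
      Nat.card {y : (Fin n ⊕ Fin n → F) →ₗ[F] (Fin n ⊕ Fin n → F) //
        SkewEnd (sympB F n) y ∧ IsNilpotent y ∧ Matrix.toLin' x * y = y * Matrix.toLin' x} := by
    apply Nat.card_congr
    apply Equiv.subtypeEquiv (Matrix.toLin' (R := F) (m := Fin n ⊕ Fin n) (n := Fin n ⊕ Fin n)).toEquiv
    intro y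
    have e1 : Matrix.toLin' x * Matrix.toLin' y = Matrix.toLin' (x * y) :=
      (Matrix.toLin'_mul x y).symm
    have e2 : Matrix.toLin' y * Matrix.toLin' x = Matrix.toLin' (y * x) :=
      (Matrix.toLin'_mul y x).symm
    simp only [LinearEquiv.coe_toEquiv]
    rw [sympB_skew, Matrix.isNilpotent_toLin'_iff, e1, e2, EmbeddingLike.apply_eq_iff_eq]
  rw [hcard]
  set c := Nat.card {y : (Fin n ⊕ Fin n → F) →ₗ[F] (Fin n ⊕ Fin n → F) //
        SkewEnd (sympB F n) y ∧ IsNilpotent y ∧ Matrix.toLin' x * y = y * Matrix.toLin' x} with hc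
  rw [hF] at hd
  have hq1 : 1 < q := by rw [← hF]; exact Fintype.one_lt_card
  have hcpos : 0 < c := by
    rcases Nat.eq_zero_or_pos c with h | h
    · rw [h, zero_mul] at hd
      exact absurd hd.symm (pow_ne_zero _ (by omega))
    · exact h
  have hr : (∑ i : Fin (2 * n), Fintype.card (JBlk k i) / 2) =
      ∑ i ∈ Finset.range (2 * n), Multiset.count (i + 1) lam.parts / 2 := by
    rw [Fin.sum_univ_eq_sum_range (fun i => Fintype.card (JBlk k i) / 2)]
    apply Finset.sum_congr rfl
    intro i _
    congr 1
    rw [hlam, Multiset.count_map, Fintype.card_subtype, Finset.card_def, Finset.filter_val]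
    congr 2
    funext j
    exact propext eq_comm
  rw [hr] at hd
  set r := ∑ i ∈ Finset.range (2 * n), Multiset.count (i + 1) lam.parts / 2 with hrdef
  have hrd : r ≤ d := by
    rw [← Nat.pow_le_pow_iff_right hq1, ← hd]
    exact Nat.le_mul_of_pos_left _ hcpos
  refine ⟨d - r, ?_, ?_⟩
  · have e1 : ∀ (P : ℕ → Prop) [DecidablePred P], Multiset.card (lam.parts.filter P) =
        (Finset.univ.filter (fun j => P (k j))).card := by
      intro P _
      rw [hlam, Multiset.filter_map, Multiset.card_map, Finset.card_def, Finset.filter_val]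
      rfl
    rw [e1]
    simp_rw [e1]
    rw [← sum_min_eq k (2 * n) hM, ← he]
    omega
  · have hqp : 0 < q ^ r := by positivity
    apply Nat.eq_of_mul_eq_mul_right hqp
    rw [hd, ← pow_add, Nat.sub_add_cancel hrd]
end

section
/- Let q be an odd prime power and let u be a real number with |u| < 1/q. Then the family of factors (1 − u^d)^{−(N̄(2d,q) + M̄(d,q))}, indexed by integers d ≥ 1, is multipliable in ℝ and ∏_{d ≥ 1} (1 − u^d)^{−N̄(2d,q)} (1 − u^d)^{−M̄(d,q)} = (1 − u)/(1 − qu). -/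
/-- `φ̄(X) = (-1)^{deg φ} φ(-X)`. -/
noncomputable def polyBar {F : Type} [Field F] (f : Polynomial F) : Polynomial F :=
  (-1) ^ f.natDegree * f.comp (-Polynomial.X)

/-- `N̄(2d,q)`: the number of monic irreducible polynomials `φ` of degree `2d`
over `F` with `φ̄ = φ`. -/
noncomputable def Nbar (F : Type) [Field F] (d : ℕ) : ℕ :=
  Nat.card {f : Polynomial F //
    f.Monic ∧ Irreducible f ∧ f.natDegree = 2 * d ∧ polyBar f = f}

/-- `M̄(d,q)`: the number of unordered pairs `{φ, φ̄}` of monic irreducible polynomials of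
degree `d` over `F` with `φ ≠ φ̄`, i.e. half the number of monic irreducible `φ` of degree
`d` with `φ̄ ≠ φ`. -/
noncomputable def Mbar (F : Type) [Field F] (d : ℕ) : ℕ :=
  Nat.card {f : Polynomial F //
    f.Monic ∧ Irreducible f ∧ f.natDegree = d ∧ polyBar f ≠ f} / 2


open Polynomial in
lemma polyBar_natDegree {F : Type} [Field F] (f : F[X]) : (polyBar f).natDegree = f.natDegree := by
  unfold polyBar
  have : ((-1 : F[X]) ^ f.natDegree) = C ((-1) ^ f.natDegree) := by simp
  rw [this, natDegree_C_mul (by simp), natDegree_comp]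
  simp

open Polynomial in
lemma polyBar_polyBar {F : Type} [Field F] (f : F[X]) : polyBar (polyBar f) = f := by
  have h := polyBar_natDegree f
  unfold polyBar at h ⊢
  rw [h, mul_comp, comp_neg_X_comp_neg_X, ← mul_assoc]
  have : ((-1 : F[X]) ^ f.natDegree).comp (-X) = (-1) ^ f.natDegree := by simp
  rw [this, ← mul_pow]; simp

open Polynomial in
lemma polyBar_irreducible {F : Type} [Field F] {f : F[X]} (hf : Irreducible f) :
    Irreducible (polyBar f) := by
  unfold polyBar
  have hu : IsUnit ((-1 : F[X]) ^ f.natDegree) := (isUnit_one.neg).pow _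
  rw [irreducible_isUnit_mul hu]
  exact (MulEquiv.irreducible_iff (algEquivAevalNegX (R := F))).2 hf

open Polynomial in
lemma polyBar_eq_of_dvd {F : Type} [Field F] {f : F[X]} (hm : f.Monic)
    (h : f ∣ f.comp (-X)) : polyBar f = f := by
  have h1 : f ∣ polyBar f := h.mul_left _
  exact ((eq_of_monic_of_dvd_of_natDegree_le hm hm.neg_one_pow_natDegree_mul_comp_neg_X h1
    (polyBar_natDegree f).le))

lemma even_of_polyBar {F : Type} [Field F] (h2 : (2 : F) ≠ 0) {f : Polynomial F}
    (hb : polyBar f = f) (h0 : f.coeff 0 ≠ 0) : Even f.natDegree := by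
  by_contra h
  rw [Nat.not_even_iff_odd] at h
  apply h0
  unfold polyBar at hb
  rw [h.neg_one_pow] at hb
  have := congrArg (Polynomial.eval 0) hb
  simp [Polynomial.eval_comp] at this
  rw [Polynomial.coeff_zero_eq_eval_zero]
  have h3 : 2 * Polynomial.eval 0 f = 0 := by linear_combination -this
  simpa [h2] using h3

open Polynomial in
lemma expand_of_polyBar {F : Type} [Field F] (h2 : (2 : F) ≠ 0) {f : F[X]}
    (hb : polyBar f = f) (he : Even f.natDegree) : expand F 2 (contract 2 f) = f := by
  unfold polyBar at hb
  rw [he.neg_one_pow, one_mul] at hb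
  ext n
  rw [coeff_expand (by norm_num), coeff_contract (by norm_num)]
  split_ifs with h
  · rw [Nat.div_mul_cancel h]
  · have hn : Odd n := by rw [← Nat.not_even_iff_odd, even_iff_two_dvd]; exact h
    have h3 := congrArg (fun g => coeff g n) hb
    have h4 : (-X : F[X]) = C (-1) * X := by simp
    simp only [h4, comp_C_mul_X_coeff, hn.neg_one_pow] at h3
    have h5 : 2 * f.coeff n = 0 := by linear_combination -h3
    simpa [h2, eq_comm] using h5

open Polynomial in
lemma dvd_sub_one_iff {F : Type} [Field F] [Fintype F] {f : F[X]} (hf : Irreducible f)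
    (h0 : f.coeff 0 ≠ 0) (n : ℕ) :
    f ∣ X ^ (Fintype.card F ^ n - 1) - 1 ↔ f.natDegree ∣ n := by
  rw [hf.natDegree_dvd_iff_dvd_X_pow_card_pow_sub_X, Nat.card_eq_fintype_card]
  have h1 : 1 ≤ Fintype.card F ^ n := Nat.one_le_pow _ _ Fintype.card_pos
  have : (X ^ Fintype.card F ^ n - X : F[X]) = X * (X ^ (Fintype.card F ^ n - 1) - 1) := by
    rw [mul_sub, ← pow_succ', Nat.sub_add_cancel h1, mul_one]
  rw [this, hf.prime.dvd_mul]
  constructor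
  · exact Or.inr
  · rintro (h | h)
    · exfalso
      have : Associated f X := hf.associated_of_dvd irreducible_X h
      exact h0 (X_dvd_iff.1 this.symm.dvd)
    · exact h

open Polynomial in
lemma dvd_big_iff {F : Type} [Field F] [Fintype F] (h2 : (2 : F) ≠ 0) {f : F[X]} (hm : f.Monic)
    (hf : Irreducible f) (n : ℕ) (hn : n ≠ 0) :
    f ∣ X ^ (2 * (Fintype.card F ^ n - 1)) - 1 ↔
      (polyBar f = f ∧ ∃ d, d ∣ n ∧ f.natDegree = 2 * d) ∨
      (polyBar f ≠ f ∧ f.natDegree ∣ n) := by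
  have h1 : 1 < Fintype.card F ^ n := Nat.one_lt_pow hn Fintype.one_lt_card
  obtain ⟨N, hN⟩ : ∃ N, Fintype.card F ^ n = N + 1 := ⟨_, (Nat.sub_add_cancel h1.le).symm⟩
  have hN0 : N ≠ 0 := by omega
  -- the constant coefficient
  have hdX : f.coeff 0 = 0 → f = X := fun h =>
    (eq_of_monic_of_associated hm monic_X
      (irreducible_X.associated_of_dvd hf (X_dvd_iff.2 h)).symm)
  have hself : f.coeff 0 ≠ 0 → polyBar f = f →
      (f ∣ X ^ (2 * (Fintype.card F ^ n - 1)) - 1 ↔ ∃ d, d ∣ n ∧ f.natDegree = 2 * d) := by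
    intro h0 hb
    have he := expand_of_polyBar h2 hb (even_of_polyBar h2 hb h0)
    set g := contract 2 f
    have hg : Irreducible g := of_irreducible_expand two_ne_zero (he.symm ▸ hf)
    have hd : f.natDegree = 2 * g.natDegree := by rw [← he, natDegree_expand, mul_comm]
    have hg0 : g.coeff 0 ≠ 0 := by
      simpa [g, coeff_contract] using h0
    have hex : (X ^ (2 * (Fintype.card F ^ n - 1)) - 1 : F[X])
        = expand F 2 (X ^ (Fintype.card F ^ n - 1) - 1) := by
      simp [pow_mul]
    have key : f ∣ X ^ (2 * (Fintype.card F ^ n - 1)) - 1 ↔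
        g ∣ X ^ (Fintype.card F ^ n - 1) - 1 := by
      rw [hex]
      constructor
      · intro h
        by_contra hc
        have hcop := (hg.coprime_iff_not_dvd.2 hc)
        have := hcop.map (expand F 2 : F[X] →+* F[X])
        have hu := this.isUnit_of_dvd' (x := f) (by simp [he]) (by simpa using h)
        exact hf.not_isUnit hu
      · intro h
        have h9 := map_dvd (expand F 2) h
        rwa [he] at h9
    rw [key, dvd_sub_one_iff hg hg0, hd]
    constructor
    · intro h; exact ⟨_, h, rfl⟩
    · rintro ⟨d, h, h'⟩
      have : g.natDegree = d := by omega
      rwa [this]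
  have hnot : f.coeff 0 ≠ 0 → polyBar f ≠ f →
      (f ∣ X ^ (2 * (Fintype.card F ^ n - 1)) - 1 ↔ f.natDegree ∣ n) := by
    intro h0 hb
    rw [← dvd_sub_one_iff hf h0]
    have hfac : (X ^ (2 * (Fintype.card F ^ n - 1)) - 1 : F[X]) =
        (X ^ (Fintype.card F ^ n - 1) - 1) * (X ^ (Fintype.card F ^ n - 1) + 1) := by
      rw [mul_comm 2, pow_mul]; ring
    rw [hfac]
    constructor
    · intro h
      rcases hf.prime.dvd_or_dvd h with h | h
      · exact h
      · exfalso
        apply hb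
        apply polyBar_eq_of_dvd hm
        have h3 : f ∣ X ^ (Fintype.card F ^ n) - (-X) := by
          rw [hN] at h ⊢
          have : (X ^ (N + 1) - (-X) : F[X]) = (X ^ (N + 1 - 1) + 1) * X := by
            simp; ring
          rw [this]; exact h.mul_right _
        have h4 : ∀ k, f.comp (X ^ (Fintype.card F ^ k)) = f ^ (Fintype.card F ^ k) := by
          intro k
          induction k with
          | zero => simp
          | succ k ih =>
            rw [← expand_eq_comp_X_pow] at ih ⊢
            rw [pow_succ, mul_comm, expand_mul, ih, map_pow, FiniteField.expand_card, ← pow_mul]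
        have h5 : (X ^ (Fintype.card F ^ n) - (-X) : F[X]) ∣
            f.comp (X ^ (Fintype.card F ^ n)) - f.comp (-X) := by
          have := sub_dvd_eval_sub (X ^ (Fintype.card F ^ n) : F[X]) (-X) (f.map C)
          simpa [comp, eval_map] using this
        have h6 := h3.trans h5
        rw [h4] at h6
        exact (dvd_sub_right (dvd_pow_self f (by omega))).1 h6
    · intro h; exact h.mul_right _
  by_cases h0 : f.coeff 0 = 0
  · have hX := hdX h0
    have hb : polyBar f = f := by rw [hX]; simp [polyBar]
    constructor
    · intro h
      exfalso
      have h7 : X ∣ (X ^ (2 * (Fintype.card F ^ n - 1)) - 1 : F[X]) := hX ▸ h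
      have h8 := (dvd_sub_right (dvd_pow_self (X : F[X])
        (n := 2 * (Fintype.card F ^ n - 1)) (by omega))).1 h7
      exact irreducible_X.not_isUnit (isUnit_of_dvd_one h8)
    · rintro (⟨-, d, -, h⟩ | ⟨h, -⟩)
      · rw [hX, natDegree_X] at h; omega
      · exact absurd hb h
  · by_cases hb : polyBar f = f
    · rw [hself h0 hb]; simp [hb]
    · rw [hnot h0 hb]; simp [hb]

open Polynomial in
lemma count_identity {F : Type} [Field F] [Fintype F] (h2 : (2 : F) ≠ 0) (n : ℕ) (hn : n ≠ 0) :
    ∑ d ∈ n.divisors, d * (Nbar F d + Mbar F d) = Fintype.card F ^ n - 1 := by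
  classical
  have h1 : 1 < Fintype.card F ^ n := Nat.one_lt_pow hn Fintype.one_lt_card
  set P : F[X] := X ^ (2 * (Fintype.card F ^ n - 1)) - 1 with hP
  have hPm : P.Monic := monic_X_pow_sub_C 1 (by omega)
  have hPd : P.natDegree = 2 * (Fintype.card F ^ n - 1) := natDegree_X_pow_sub_C
  have hsep : P.Separable := by
    rw [hP, X_pow_sub_one_separable_iff]
    rw [Nat.cast_mul, Nat.cast_sub h1.le]
    simp [hn, h2]
  set S := (UniqueFactorizationMonoid.normalizedFactors P).toFinset with hS
  have hmem : ∀ f, f ∈ S ↔ f.Monic ∧ Irreducible f ∧ f ∣ P := by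
    intro f
    rw [hS, Multiset.mem_toFinset, Polynomial.mem_normalizedFactors_iff hPm.ne_zero]
    tauto
  have hsum : ∑ f ∈ S, f.natDegree = 2 * (Fintype.card F ^ n - 1) := by
    have hnd := (UniqueFactorizationMonoid.squarefree_iff_nodup_normalizedFactors
      hPm.ne_zero).1 hsep.squarefree
    have hprod : ∏ f ∈ S, f = P := by
      rw [Finset.prod_eq_multiset_prod, hS, Multiset.toFinset_val, hnd.dedup, Multiset.map_id']
      rw [UniqueFactorizationMonoid.prod_normalizedFactors_eq hPm.ne_zero]
      exact hPm.normalize_eq_self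
    rw [← hPd, ← hprod, natDegree_prod_of_monic]
    intro f hf; exact ((hmem f).1 hf).1
  have hchar : ∀ f, f ∈ S ↔ f.Monic ∧ Irreducible f ∧
      ((polyBar f = f ∧ ∃ d, d ∣ n ∧ f.natDegree = 2 * d) ∨
      (polyBar f ≠ f ∧ f.natDegree ∣ n)) := by
    intro f
    rw [hmem]
    constructor
    · rintro ⟨a, b, c⟩; exact ⟨a, b, (dvd_big_iff h2 a b n hn).1 c⟩
    · rintro ⟨a, b, c⟩; exact ⟨a, b, (dvd_big_iff h2 a b n hn).2 c⟩
  have hN : ∀ d ∈ n.divisors, Nbar F d =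
      (S.filter (fun f => polyBar f = f ∧ f.natDegree = 2 * d)).card := by
    intro d hd
    have hd' := Nat.dvd_of_mem_divisors hd
    unfold Nbar
    refine Nat.subtype_card _ ?_
    intro f
    rw [Finset.mem_filter, hchar]
    constructor
    · rintro ⟨⟨a, b, c⟩, e, g⟩; exact ⟨a, b, g, e⟩
    · rintro ⟨a, b, g, e⟩; exact ⟨⟨a, b, Or.inl ⟨e, d, hd', g⟩⟩, e, g⟩
  have hA : ∀ d ∈ n.divisors, 2 * Mbar F d =
      (S.filter (fun f => polyBar f ≠ f ∧ f.natDegree = d)).card := by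
    intro d hd
    have hd' := Nat.dvd_of_mem_divisors hd
    set T := S.filter (fun f => polyBar f ≠ f ∧ f.natDegree = d) with hT
    have hTm : ∀ f, f ∈ T ↔ f.Monic ∧ Irreducible f ∧ f.natDegree = d ∧ polyBar f ≠ f := by
      intro f
      rw [hT, Finset.mem_filter, hchar]
      constructor
      · rintro ⟨⟨a, b, c⟩, e, g⟩; exact ⟨a, b, g, e⟩
      · rintro ⟨a, b, g, e⟩; exact ⟨⟨a, b, Or.inr ⟨e, g ▸ hd'⟩⟩, e, g⟩
    have hc : Nat.card {f : Polynomial F //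
        f.Monic ∧ Irreducible f ∧ f.natDegree = d ∧ polyBar f ≠ f} = T.card :=
      Nat.subtype_card _ hTm
    unfold Mbar
    rw [hc]
    apply Nat.mul_div_cancel'
    have hz : ∑ f ∈ T, (1 : ZMod 2) = 0 := by
      refine Finset.sum_involution (fun f _ => polyBar f) ?_ ?_ ?_ ?_
      · intro f hf; decide
      · intro f hf _; exact ((hTm f).1 hf).2.2.2
      · intro f hf
        obtain ⟨a, b, c, e⟩ := (hTm f).1 hf
        refine (hTm _).2 ⟨a.neg_one_pow_natDegree_mul_comp_neg_X, polyBar_irreducible b,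
          (polyBar_natDegree f).trans c, ?_⟩
        rw [polyBar_polyBar]; exact e.symm
      · intro f hf; exact polyBar_polyBar f
    simp only [Finset.sum_const, nsmul_eq_mul, mul_one] at hz
    exact (ZMod.natCast_eq_zero_iff _ _).1 hz
  have hfib : ∑ f ∈ S, f.natDegree = ∑ d ∈ n.divisors,
      ∑ f ∈ S.filter (fun f => (if polyBar f = f then f.natDegree / 2 else f.natDegree) = d),
        f.natDegree := by
    rw [Finset.sum_fiberwise_of_maps_to]
    intro f hf
    rw [Nat.mem_divisors]
    refine ⟨?_, hn⟩
    obtain ⟨a, b, ⟨c, d, e, g⟩ | ⟨c, e⟩⟩ := (hchar f).1 hf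
    · rw [if_pos c, g]; simpa using e
    · rw [if_neg c]; exact e
  have hin : ∀ d ∈ n.divisors,
      ∑ f ∈ S.filter (fun f => (if polyBar f = f then f.natDegree / 2 else f.natDegree) = d),
        f.natDegree = 2 * (d * (Nbar F d + Mbar F d)) := by
    intro d hd
    rw [← Finset.sum_filter_add_sum_filter_not _ (fun f => polyBar f = f),
      Finset.filter_filter, Finset.filter_filter]
    have e1 : S.filter (fun f => (if polyBar f = f then f.natDegree / 2 else f.natDegree) = d ∧
        polyBar f = f) = S.filter (fun f => polyBar f = f ∧ f.natDegree = 2 * d) := by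
      apply Finset.filter_congr
      intro f hf
      constructor
      · rintro ⟨x, y⟩
        rw [if_pos y] at x
        obtain ⟨a, b, ⟨c, d', e, g⟩ | ⟨c, e⟩⟩ := (hchar f).1 hf
        · exact ⟨y, by omega⟩
        · exact absurd y c
      · rintro ⟨x, y⟩
        rw [if_pos x]; exact ⟨by omega, x⟩
    have e2 : S.filter (fun f => (if polyBar f = f then f.natDegree / 2 else f.natDegree) = d ∧
        ¬ polyBar f = f) = S.filter (fun f => polyBar f ≠ f ∧ f.natDegree = d) := by
      apply Finset.filter_congr
      intro f hf
      constructor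
      · rintro ⟨x, y⟩
        rw [if_neg y] at x
        exact ⟨y, x⟩
      · rintro ⟨x, y⟩
        rw [if_neg x]; exact ⟨y, x⟩
    rw [e1, e2, Finset.sum_congr rfl (g := fun _ => 2 * d),
      Finset.sum_congr (s₁ := S.filter (fun f => polyBar f ≠ f ∧ f.natDegree = d)) rfl
        (g := fun _ => d)]
    · rw [Finset.sum_const, Finset.sum_const, ← hN d hd, ← hA d hd]
      simp; ring
    · intro f hf; exact (Finset.mem_filter.1 hf).2.2
    · intro f hf; exact (Finset.mem_filter.1 hf).2.2
  rw [hfib, Finset.sum_congr rfl hin, ← Finset.mul_sum] at hsum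
  omega

lemma analytic_part (q : ℕ) (hq : 1 < q) (c : ℕ → ℕ)
    (hc : ∀ n, n ≠ 0 → ∑ d ∈ n.divisors, d * c d = q ^ n - 1)
    (u : ℝ) (hu : |u| < 1 / q) :
    HasProd (fun d : ℕ => ((1 - u ^ (d + 1))⁻¹) ^ (c (d + 1))) ((1 - u) / (1 - q * u)) := by
  have hq0 : (0 : ℝ) < q := by positivity
  have hq1 : (1 : ℝ) < q := by exact_mod_cast hq
  have hqu' : q * |u| < 1 := by rwa [lt_div_iff₀ hq0, mul_comm] at hu
  have hu1 : |u| < 1 := by nlinarith [abs_nonneg u]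
  have hqu : |q * u| < 1 := by rwa [abs_mul, abs_of_pos hq0]
  have h1u : 0 < 1 - u := by have := (abs_lt.1 hu1).2; linarith
  have h1qu : 0 < 1 - q * u := by have := (abs_lt.1 hqu).2; linarith
  -- inner divisor sums
  have inner : ∀ (v : ℝ) (n : ℕ+), ∑ x : (n : ℕ).divisorsAntidiagonal,
      (c x.1.1 : ℝ) * v ^ (x.1.1 * x.1.2) / x.1.2 = ((q * v) ^ (n : ℕ) - v ^ (n : ℕ)) / n := by
    intro v n
    rw [Finset.univ_eq_attach, Finset.sum_attach (n : ℕ).divisorsAntidiagonal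
      (fun x => (c x.1 : ℝ) * v ^ (x.1 * x.2) / x.2)]
    have h := hc n n.ne_zero
    have hR : ∑ d ∈ (n : ℕ).divisors, (d : ℝ) * c d = (q : ℝ) ^ (n : ℕ) - 1 := by
      have h3 : 1 ≤ q ^ (n : ℕ) := Nat.one_le_pow _ _ (by omega)
      have h4 := congrArg (Nat.cast : ℕ → ℝ) h
      rw [Nat.cast_sub h3] at h4
      push_cast at h4
      exact h4
    rw [mul_pow, show ((q : ℝ) ^ (n : ℕ) * v ^ (n : ℕ) - v ^ (n : ℕ)) / n =
      ((q : ℝ) ^ (n : ℕ) - 1) * (v ^ (n : ℕ) / n) by ring, ← hR, Finset.sum_mul]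
    rw [Nat.sum_divisorsAntidiagonal (fun x y => (c x : ℝ) * v ^ (x * y) / y)]
    apply Finset.sum_congr rfl
    intro d hd
    have hd' := Nat.dvd_of_mem_divisors hd
    have hn0 : ((n : ℕ) : ℝ) ≠ 0 := by exact_mod_cast n.ne_zero
    have hd0 : (d : ℝ) ≠ 0 := by
      have := Nat.pos_of_mem_divisors hd
      positivity
    rw [Nat.mul_div_cancel' hd', Nat.cast_div hd' hd0]
    field_simp
  have hlog : ∀ v : ℝ, |v| < 1 → HasSum (fun n : ℕ+ => v ^ (n : ℕ) / n) (-Real.log (1 - v)) := by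
    intro v hv
    have := Real.hasSum_pow_div_log_of_abs_lt_one hv
    rw [← Equiv.pnatEquivNat.symm.hasSum_iff]
    convert this using 2 with n
    simp
  have outer : ∀ v : ℝ, |v| < 1 → |q * v| < 1 →
      HasSum (fun n : ℕ+ => ((q * v) ^ (n : ℕ) - v ^ (n : ℕ)) / n)
        (-Real.log (1 - q * v) - -Real.log (1 - v)) := by
    intro v h1 h2
    have h3 : (fun n : ℕ+ => ((q * v) ^ (n : ℕ) - v ^ (n : ℕ)) / (n : ℝ)) =
        fun n : ℕ+ => (q * v) ^ (n : ℕ) / (n : ℝ) - v ^ (n : ℕ) / (n : ℝ) := by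
      funext n; ring
    rw [h3]
    exact (hlog _ h2).sub (hlog _ h1)
  let f : ℝ → ℕ+ × ℕ+ → ℝ := fun v x => (c x.1 : ℝ) * v ^ ((x.1 : ℕ) * x.2) / (x.2 : ℕ)
  have hsig : Summable (fun x : Σ n : ℕ+, (n : ℕ).divisorsAntidiagonal =>
      (c x.2.1.1 : ℝ) * u ^ (x.2.1.1 * x.2.1.2) / x.2.1.2) := by
    apply Summable.of_norm
    have : ∀ x : Σ n : ℕ+, (n : ℕ).divisorsAntidiagonal,
        ‖(c x.2.1.1 : ℝ) * u ^ (x.2.1.1 * x.2.1.2) / x.2.1.2‖ =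
          (c x.2.1.1 : ℝ) * |u| ^ (x.2.1.1 * x.2.1.2) / x.2.1.2 := by
      intro x; simp
    rw [funext this, summable_sigma_of_nonneg (fun x => by positivity)]
    refine ⟨fun n => (hasSum_fintype _).summable, ?_⟩
    simp only [tsum_fintype, inner]
    exact (outer |u| (by simpa) (by simpa using hqu)).summable
  have htot : HasSum (fun x : Σ n : ℕ+, (n : ℕ).divisorsAntidiagonal =>
      (c x.2.1.1 : ℝ) * u ^ (x.2.1.1 * x.2.1.2) / x.2.1.2)
      (-Real.log (1 - q * u) - -Real.log (1 - u)) := by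
    have h3 := hsig.hasSum.sigma (fun n => hasSum_fintype _)
    simp only [inner] at h3
    rw [← h3.unique (outer u hu1 hqu)]
    exact hsig.hasSum
  have hprod : HasSum (f u) (-Real.log (1 - q * u) - -Real.log (1 - u)) := by
    rw [← sigmaAntidiagonalEquivProd.hasSum_iff]
    exact htot
  have hupow : ∀ d : ℕ+, |u ^ (d : ℕ)| < 1 := fun d => by
    rw [abs_pow]; exact pow_lt_one₀ (abs_nonneg u) hu1 d.ne_zero
  have hfin := hprod.prod_fiberwise (g := fun d : ℕ+ => (c d : ℝ) * -Real.log (1 - u ^ (d : ℕ)))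
    (fun d => by
      have h3 : (fun k : ℕ+ => f u (d, k)) =
          fun k : ℕ+ => (c d : ℝ) * ((u ^ (d : ℕ)) ^ (k : ℕ) / (k : ℝ)) := by
        funext k
        simp only [f, pow_mul, mul_div_assoc]
      rw [h3]
      exact (hlog _ (hupow d)).mul_left (c d : ℝ))
  have hexp := hfin.rexp
  rw [← Equiv.pnatEquivNat.symm.hasProd_iff] at hexp
  convert hexp using 1
  · ext d
    have h5 : 0 < 1 - u ^ (d + 1) := by
      have := (abs_lt.1 (hupow d.succPNat)).2
      simp at this; linarith
    simp [mul_comm (c (d + 1) : ℝ), Real.exp_mul, Real.exp_neg, Real.exp_log h5]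
  · rw [Real.exp_sub, Real.exp_neg, Real.exp_neg, Real.exp_log h1u, Real.exp_log h1qu]
    field_simp

theorem prod_selfconjugate_polys
    (q : ℕ) (hq : ∃ p m : ℕ, p.Prime ∧ 0 < m ∧ q = p ^ m) (hodd : Odd q)
    (F : Type) [Field F] [Fintype F] (hF : Fintype.card F = q)
    (u : ℝ) (hu : |u| < 1 / q) :
    Multipliable (fun d : ℕ =>
      ((1 - u ^ (d + 1))⁻¹) ^ (Nbar F (d + 1) + Mbar F (d + 1))) ∧
    ∏' d : ℕ, ((1 - u ^ (d + 1))⁻¹) ^ (Nbar F (d + 1)) *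
        ((1 - u ^ (d + 1))⁻¹) ^ (Mbar F (d + 1)) =
      (1 - u) / (1 - q * u) := by
  have hchar : ringChar F ≠ 2 := by
    intro h
    have := FiniteField.even_card_of_char_two h
    rw [hF] at this
    obtain ⟨k, hk⟩ := hodd
    omega
  have h2 : (2 : F) ≠ 0 := Ring.two_ne_zero hchar
  have h1 : 1 < q := hF ▸ Fintype.one_lt_card
  have key := analytic_part q h1 (fun d => Nbar F d + Mbar F d)
    (fun n hn => by rw [← hF]; exact count_identity h2 n hn) u hu
  refine ⟨key.multipliable, ?_⟩
  rw [← key.tprod_eq]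
  exact tprod_congr (fun d => (pow_add _ _ _).symm)
end

section
/- Let q be an odd prime power and let u be a real number with |u| < 1/q. Then the family of factors (1 + u^d)^{−N̄(2d,q)} (1 − u^d)^{−M̄(d,q)}, indexed by integers d ≥ 1, is multipliable in ℝ and ∏_{d ≥ 1} (1 + u^d)^{−N̄(2d,q)} (1 − u^d)^{−M̄(d,q)} = 1. -/
namespace PB
open Polynomial

variable {F : Type} [Field F]

lemma natDegree_bar (f : F[X]) : (polyBar f).natDegree = f.natDegree := by
  unfold polyBar
  rcases Nat.even_or_odd f.natDegree with h | h
  · simp [h.neg_one_pow, natDegree_comp]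
  · simp [h.neg_one_pow, natDegree_comp]

lemma coeff_bar (f : F[X]) (i : ℕ) :
    (polyBar f).coeff i = (-1) ^ f.natDegree * ((-1) ^ i * f.coeff i) := by
  unfold polyBar
  have : ((-1 : F[X]) ^ f.natDegree) = C ((-1) ^ f.natDegree) := by simp
  rw [this, coeff_C_mul]
  congr 1
  have h : (-X : F[X]) = C (-1) * X := by simp
  rw [h, comp_C_mul_X_coeff, mul_comm]

lemma bar_bar (f : F[X]) : polyBar (polyBar f) = f := by
  ext i
  rw [coeff_bar, coeff_bar, natDegree_bar]
  have h1 : ((-1 : F) ^ f.natDegree) * (-1) ^ f.natDegree = 1 := by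
    rw [← mul_pow]; simp
  have h2 : ((-1 : F) ^ i) * (-1) ^ i = 1 := by
    rw [← mul_pow]; simp
  linear_combination (f.coeff i) * ((-1 : F) ^ i * (-1) ^ i) * h1 + f.coeff i * h2

lemma bar_mul (f g : F[X]) : polyBar (f * g) = polyBar f * polyBar g := by
  by_cases hf : f = 0
  · simp [hf, polyBar]
  by_cases hg : g = 0
  · simp [hg, polyBar]
  unfold polyBar
  rw [natDegree_mul hf hg, mul_comp]; ring

noncomputable def barEquiv : F[X] ≃* F[X] where
  toFun := polyBar
  invFun := polyBar
  left_inv := bar_bar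
  right_inv := bar_bar
  map_mul' := bar_mul

lemma irr_bar {f : F[X]} (h : Irreducible f) : Irreducible (polyBar f) :=
  (MulEquiv.irreducible_iff (barEquiv (F := F))).2 h

lemma monic_bar {f : F[X]} (h : f.Monic) : (polyBar f).Monic := by
  unfold Monic leadingCoeff
  rw [coeff_bar, natDegree_bar, h.coeff_natDegree, mul_one, ← mul_pow]; simp

lemma bar_dvd {f g : F[X]} (h : f ∣ g) : polyBar f ∣ polyBar g := by
  obtain ⟨k, rfl⟩ := h
  rw [bar_mul]; exact dvd_mul_right _ _

lemma bar_expand (g : F[X]) : polyBar (expand F 2 g) = expand F 2 g := by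
  ext i
  rw [coeff_bar, natDegree_expand, coeff_expand (by norm_num)]
  split_ifs with h
  · obtain ⟨k, rfl⟩ := h
    have h1 : ((-1 : F) ^ g.natDegree) ^ 2 = 1 := by rw [← pow_mul, mul_comm, pow_mul]; simp
    simp [pow_mul, h1]
  · simp

lemma expand_contract_of_bar (h2 : (2 : F) ≠ 0) {f : F[X]} (hf : polyBar f = f)
    (he : Even f.natDegree) : expand F 2 (contract 2 f) = f := by
  ext i
  rw [coeff_expand (by norm_num), coeff_contract (by norm_num)]
  split_ifs with h
  · rw [Nat.div_mul_cancel h]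
  · have h1 := coeff_bar f i
    rw [hf, he.neg_one_pow, (Nat.not_even_iff_odd.1 (fun h' => h h'.two_dvd)).neg_one_pow] at h1
    have : (2 : F) * f.coeff i = 0 := by linear_combination h1
    exact ((mul_eq_zero.1 this).resolve_left h2).symm

lemma expand_dvd_iff {a b : F[X]} : expand F 2 a ∣ expand F 2 b ↔ a ∣ b := by
  constructor
  · intro h
    by_cases ha : a = 0
    · subst ha
      rw [map_zero, zero_dvd_iff, expand_eq_zero (by norm_num)] at h
      simp [h]
    have hm := EuclideanDomain.div_add_mod b a
    rw [← hm, map_add, map_mul, dvd_add_right (dvd_mul_right _ _)] at h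
    by_cases hr : b % a = 0
    · exact (EuclideanDomain.mod_eq_zero).1 hr
    exfalso
    have hr' : expand F 2 (b % a) ≠ 0 := by rwa [Ne, expand_eq_zero (by norm_num)]
    have := natDegree_le_of_dvd h hr'
    rw [natDegree_expand, natDegree_expand] at this
    have h3 := natDegree_lt_natDegree hr (EuclideanDomain.mod_lt b ha)
    omega
  · rintro ⟨k, rfl⟩
    rw [map_mul]; exact dvd_mul_right _ _

lemma monic_of_expand {g : F[X]} (h : (expand F 2 g).Monic) : g.Monic :=
  (monic_expand_iff (by norm_num)).1 h

lemma X_of_irr {f : F[X]} (hm : f.Monic) (hi : Irreducible f) (h0 : f.coeff 0 = 0) : f = X := by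
  have := X_dvd_iff.2 h0
  exact (eq_of_monic_of_associated monic_X hm
    ((irreducible_X).associated_of_dvd hi this)).symm

lemma even_of_bar (h2 : (2 : F) ≠ 0) {f : F[X]} (hm : f.Monic) (hi : Irreducible f)
    (hf : polyBar f = f) (hX : f ≠ X) : Even f.natDegree := by
  by_contra h
  apply hX
  apply X_of_irr hm hi
  have h1 := coeff_bar f 0
  rw [hf, (Nat.not_even_iff_odd.1 h).neg_one_pow] at h1
  have : (2 : F) * f.coeff 0 = 0 := by linear_combination h1
  exact (mul_eq_zero.1 this).resolve_left h2

lemma expand_mulbar (h2 : (2 : F) ≠ 0) {h : F[X]} (hm : h.Monic) :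
    expand F 2 (contract 2 (h * polyBar h)) = h * polyBar h := by
  apply expand_contract_of_bar h2
  · rw [bar_mul, bar_bar, mul_comm]
  · rw [natDegree_mul hm.ne_zero (monic_bar hm).ne_zero, natDegree_bar]
    exact ⟨_, rfl⟩

lemma dvd_or_bar {h : F[X]} (hm : h.Monic) (hi : Irreducible h) (hb : polyBar h ≠ h) {f : F[X]}
    (hf : h ∣ f) (hf' : polyBar h ∣ f) : h * polyBar h ∣ f := by
  apply IsCoprime.mul_dvd _ hf hf'
  rw [hi.coprime_iff_not_dvd]
  intro hd
  exact hb (eq_of_monic_of_associated hm (monic_bar hm)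
    (hi.associated_of_dvd (irr_bar hi) hd)).symm

def Aset (F : Type) [Field F] (d : ℕ) : Set F[X] :=
  {f | f.Monic ∧ Irreducible f ∧ f.natDegree = d ∧ polyBar f ≠ f}
def Sset (F : Type) [Field F] (d : ℕ) : Set F[X] :=
  {f | f.Monic ∧ Irreducible f ∧ f.natDegree = d ∧ polyBar f = f}
def Bset (F : Type) [Field F] (d : ℕ) : Set F[X] :=
  {f | f.Monic ∧ Irreducible f ∧ f.natDegree = d ∧ f ≠ X ∧ ¬ Irreducible (expand F 2 f)}
def Eset (F : Type) [Field F] (d : ℕ) : Set F[X] :=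
  {f | f.Monic ∧ Irreducible f ∧ f.natDegree = d ∧ f ≠ X ∧ Irreducible (expand F 2 f)}

lemma mapsTo_B (h2 : (2 : F) ≠ 0) (d : ℕ) {h : F[X]} (hh : h ∈ Aset F d) :
    contract 2 (h * polyBar h) ∈ Bset F d := by
  obtain ⟨hm, hi, hd, hb⟩ := hh
  have hE := expand_mulbar h2 hm
  set g := contract 2 (h * polyBar h) with hg
  have hmb := monic_bar hm
  have hgm : g.Monic := by
    apply monic_of_expand; rw [hE]; exact hm.mul hmb
  have hgd : g.natDegree = d := by
    have := congrArg natDegree hE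
    rw [natDegree_expand, hm.natDegree_mul hmb, natDegree_bar] at this
    omega
  have hd0 : 0 < d := hd ▸ hi.natDegree_pos
  have key : ∀ a : F[X], h ∣ expand F 2 a → g ∣ a := by
    intro a ha
    rw [← expand_dvd_iff, hE]
    apply dvd_or_bar hm hi hb ha
    rw [← bar_expand]; exact bar_dvd ha
  have hgi : Irreducible g := by
    rw [irreducible_iff_prime]
    refine ⟨hgm.ne_zero, fun hu => ?_, fun a b hab => ?_⟩
    · rw [natDegree_eq_zero_of_isUnit hu] at hgd; omega
    · rw [← expand_dvd_iff, map_mul, hE] at hab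
      rcases hi.prime.dvd_or_dvd ((dvd_mul_right _ _).trans hab) with h' | h'
      · exact Or.inl (key a h')
      · exact Or.inr (key b h')
  refine ⟨hgm, hgi, hgd, ?_, ?_⟩
  · intro hX
    rw [hX, expand_X] at hE
    have h1 : h ∣ X ^ 2 := hE ▸ dvd_mul_right _ _
    have h3 : h = X := eq_of_monic_of_associated hm monic_X
      (hi.associated_of_dvd irreducible_X (hi.prime.dvd_of_dvd_pow h1))
    apply hb
    simp [h3, polyBar]
  · rw [hE]
    intro h'
    rcases h'.isUnit_or_isUnit rfl with h' | h'
    · exact hi.not_isUnit h'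
    · exact (irr_bar hi).not_isUnit h'

lemma surj_B (h2 : (2 : F) ≠ 0) (d : ℕ) {g : F[X]} (hg : g ∈ Bset F d) :
    ∃ h ∈ Aset F d, contract 2 (h * polyBar h) = g := by
  obtain ⟨hm, hi, hd, hX, hn⟩ := hg
  have hGm : (expand F 2 g).Monic := (monic_expand_iff (by norm_num)).2 hm
  have hG1 : expand F 2 g ≠ 1 := by
    intro h
    have := congrArg natDegree h
    rw [natDegree_expand, natDegree_one] at this
    have := hi.natDegree_pos
    omega
  obtain ⟨h, hhm, hhi, hhd⟩ := exists_monic_irreducible_factor (expand F 2 g)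
    (fun hu => hG1 (hGm.eq_one_of_isUnit hu))
  have hhd' : polyBar h ∣ expand F 2 g := by
    rw [← bar_expand]; exact bar_dvd hhd
  by_cases hb : polyBar h = h
  · exfalso
    have hhX : h ≠ X := by
      rintro rfl
      apply hX
      apply X_of_irr hm hi
      have := X_dvd_iff.1 hhd
      rw [coeff_expand (by norm_num)] at this
      simpa using this
    have hE := expand_contract_of_bar h2 hb (even_of_bar h2 hhm hhi hb hhX)
    have h1 : contract 2 h ∣ g := by rw [← expand_dvd_iff, hE]; exact hhd
    have hki : Irreducible (contract 2 h) :=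
      of_irreducible_expand (p := 2) (by norm_num) (by rwa [hE])
    have hkm : (contract 2 h).Monic := monic_of_expand (hE.symm ▸ hhm)
    have := eq_of_monic_of_associated hkm hm (hki.associated_of_dvd hi h1)
    rw [← this, hE] at hn
    exact hn hhi
  · have hE := expand_mulbar h2 hhm
    have hA : h ∈ Aset F h.natDegree := ⟨hhm, hhi, rfl, hb⟩
    have hB := mapsTo_B h2 _ hA
    have h1 : contract 2 (h * polyBar h) ∣ g := by
      rw [← expand_dvd_iff, hE]; exact dvd_or_bar hhm hhi hb hhd hhd'
    have h3 := eq_of_monic_of_associated hB.1 hm (hB.2.1.associated_of_dvd hi h1)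
    refine ⟨h, ⟨hhm, hhi, ?_, hb⟩, h3⟩
    rw [← hB.2.2.1, h3, hd]

lemma bij_E (h2 : (2 : F) ≠ 0) (d : ℕ) (hd : 0 < d) :
    Set.BijOn (expand F 2) (Eset F d) (Sset F (2 * d)) := by
  refine ⟨?_, ?_, ?_⟩
  · rintro g ⟨hm, hi, hgd, hX, hE⟩
    exact ⟨(monic_expand_iff (by norm_num)).2 hm, hE, by rw [natDegree_expand]; omega, bar_expand g⟩
  · exact (expand_injective (by norm_num)).injOn
  · rintro f ⟨hm, hi, hfd, hb⟩
    have hE := expand_contract_of_bar h2 hb (hfd ▸ even_two_mul d)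
    refine ⟨contract 2 f, ⟨monic_of_expand (hE.symm ▸ hm), ?_, ?_, ?_, by rwa [hE]⟩, hE⟩
    · exact of_irreducible_expand (p := 2) (by norm_num) (by rwa [hE])
    · have := congrArg natDegree hE
      rw [natDegree_expand] at this; omega
    · intro hX
      rw [hX, expand_X] at hE
      rw [← hE] at hi
      rcases hi.isUnit_or_isUnit (pow_two X) with h | h <;> exact not_isUnit_X h

lemma union1 (d : ℕ) : Aset F d ∪ (Sset F d \ {X}) = Eset F d ∪ Bset F d := by
  have hX : polyBar (X : F[X]) = X := by simp [polyBar]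
  ext f
  simp only [Aset, Sset, Eset, Bset, Set.mem_union, Set.mem_sdiff, Set.mem_ofPred_eq,
    Set.mem_singleton_iff]
  have : polyBar f ≠ f → f ≠ X := by rintro h rfl; exact h hX
  tauto

lemma coeff_inj (d : ℕ) : Set.InjOn (fun (f : F[X]) (i : Fin d) => f.coeff i)
    {f | f.Monic ∧ f.natDegree = d} := by
  rintro f ⟨hf, hfd⟩ g ⟨hg, hgd⟩ h
  ext i
  rcases lt_trichotomy i d with hi | hi | hi
  · exact congrFun h ⟨i, hi⟩
  · subst hi
    rw [← hfd, hf.coeff_natDegree, hfd, ← hgd, hg.coeff_natDegree]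
  · rw [coeff_eq_zero_of_natDegree_lt (by omega), coeff_eq_zero_of_natDegree_lt (by omega)]

variable [Fintype F]

lemma fin_monic (d : ℕ) : {f : F[X] | f.Monic ∧ f.natDegree = d}.Finite :=
  Set.Finite.of_finite_image (Set.toFinite _) (coeff_inj d)

lemma card_monic (d : ℕ) :
    {f : F[X] | f.Monic ∧ f.natDegree = d}.ncard ≤ Fintype.card F ^ d := by
  rw [← (coeff_inj (F := F) d).ncard_image]
  refine (Set.ncard_le_ncard (Set.subset_univ _)).trans ?_
  rw [Set.ncard_univ]; simp

lemma finA (d : ℕ) : (Aset F d).Finite := (fin_monic d).subset fun _ h => ⟨h.1, h.2.2.1⟩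
lemma finB (d : ℕ) : (Bset F d).Finite := (fin_monic d).subset fun _ h => ⟨h.1, h.2.2.1⟩
lemma finE (d : ℕ) : (Eset F d).Finite := (fin_monic d).subset fun _ h => ⟨h.1, h.2.2.1⟩
lemma finS (d : ℕ) : (Sset F d).Finite := (fin_monic d).subset fun _ h => ⟨h.1, h.2.2.1⟩

lemma cardE (h2 : (2 : F) ≠ 0) (d : ℕ) (hd : 0 < d) : Nbar F d = (Eset F d).ncard := by
  have h := bij_E h2 d hd
  rw [← h.injOn.ncard_image, h.image_eq]; rfl

lemma N_le (h2 : (2 : F) ≠ 0) (d : ℕ) (hd : 0 < d) : Nbar F d ≤ Fintype.card F ^ d := by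
  rw [cardE h2 d hd]
  have hsub : Eset F d ⊆ {f : F[X] | f.Monic ∧ f.natDegree = d} := fun _ h => ⟨h.1, h.2.2.1⟩
  exact (Set.ncard_le_ncard hsub (fin_monic d)).trans (card_monic d)

lemma cardA (h2 : (2 : F) ≠ 0) (d : ℕ) : (Aset F d).ncard = 2 * (Bset F d).ncard := by
  classical
  rw [Set.ncard_eq_toFinset_card _ (finA d), Set.ncard_eq_toFinset_card _ (finB d)]
  rw [Finset.card_eq_sum_card_fiberwise (f := fun h => contract 2 (h * polyBar h))
    (t := (finB (F := F) d).toFinset), Finset.sum_const_nat (m := 2), mul_comm]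
  · intro g hg
    rw [Set.Finite.mem_toFinset] at hg
    obtain ⟨h, hh, rfl⟩ := surj_B h2 d hg
    rw [Finset.card_eq_two]
    refine ⟨h, polyBar h, hh.2.2.2.symm, ?_⟩
    ext k
    simp only [Finset.mem_filter, Set.Finite.mem_toFinset, Finset.mem_insert, Finset.mem_singleton]
    constructor
    · rintro ⟨hk, hkk⟩
      have := congrArg (expand F 2) hkk
      rw [expand_mulbar h2 hk.1, expand_mulbar h2 hh.1] at this
      have hd : k ∣ h * polyBar h := this ▸ dvd_mul_right _ _
      rcases hk.2.1.prime.dvd_or_dvd hd with h' | h'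
      · left
        exact eq_of_monic_of_associated hk.1 hh.1 (hk.2.1.associated_of_dvd hh.2.1 h')
      · right
        exact eq_of_monic_of_associated hk.1 (monic_bar hh.1)
          (hk.2.1.associated_of_dvd (irr_bar hh.2.1) h')
    · rintro (rfl | rfl)
      · exact ⟨hh, rfl⟩
      · refine ⟨⟨monic_bar hh.1, irr_bar hh.2.1, by rw [natDegree_bar]; exact hh.2.2.1, ?_⟩, ?_⟩
        · rw [bar_bar]; exact hh.2.2.2.symm
        · rw [bar_bar, mul_comm]
  · intro h hh
    simp only [Set.Finite.coe_toFinset] at hh ⊢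
    exact mapsTo_B h2 d hh

lemma cardB (h2 : (2 : F) ≠ 0) (d : ℕ) : Mbar F d = (Bset F d).ncard := by
  have : Mbar F d = (Aset F d).ncard / 2 := rfl
  rw [this, cardA h2]; simp

lemma main_count (h2 : (2 : F) ≠ 0) (d : ℕ) (hd : 0 < d) :
    Nbar F d = Mbar F d + (Sset F d \ {X}).ncard := by
  have h := congrArg Set.ncard (union1 (F := F) d)
  rw [Set.ncard_union_eq _ (finA d) ((finS d).subset Set.sdiff_subset),
    Set.ncard_union_eq _ (finE d) (finB d), cardA h2, ← cardE h2 d hd, ← cardB h2] at h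
  · omega
  · rw [Set.disjoint_left]; intro f h1 h3; exact h3.2.2.2.2 h1.2.2.2.2
  · rw [Set.disjoint_left]; intro f h1 h3; exact h1.2.2.2 h3.1.2.2.2

lemma count_odd (h2 : (2 : F) ≠ 0) (d : ℕ) (hd : Odd d) : Nbar F d = Mbar F d := by
  rw [main_count h2 d hd.pos]
  have : Sset F d \ {X} = ∅ := by
    rw [Set.eq_empty_iff_forall_notMem]
    rintro f ⟨⟨hm, hi, hfd, hb⟩, hX⟩
    have := even_of_bar h2 hm hi hb hX
    rw [hfd] at this
    exact (Nat.not_even_iff_odd.2 hd) this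
  simp [this]

lemma count_even (h2 : (2 : F) ≠ 0) (d : ℕ) (hd : 0 < d) :
    Nbar F (2 * d) = Mbar F (2 * d) + Nbar F d := by
  rw [main_count h2 (2 * d) (by omega)]
  have : Sset F (2 * d) \ {X} = Sset F (2 * d) := by
    apply Set.sdiff_singleton_eq_self
    rintro ⟨_, _, h, _⟩
    rw [natDegree_X] at h; omega
  rw [this]; rfl

end PB

theorem prod_selfconjugate_polys_two
    (q : ℕ) (hq : ∃ p m : ℕ, p.Prime ∧ 0 < m ∧ q = p ^ m) (hodd : Odd q)
    (F : Type) [Field F] [Fintype F] (hF : Fintype.card F = q)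
    (u : ℝ) (hu : |u| < 1 / q) :
    Multipliable (fun d : ℕ =>
      ((1 + u ^ (d + 1))⁻¹) ^ (Nbar F (d + 1)) *
        ((1 - u ^ (d + 1))⁻¹) ^ (Mbar F (d + 1))) ∧
    ∏' d : ℕ, ((1 + u ^ (d + 1))⁻¹) ^ (Nbar F (d + 1)) *
        ((1 - u ^ (d + 1))⁻¹) ^ (Mbar F (d + 1)) = 1 := by
  have h2 : (2 : F) ≠ 0 := by
    apply Ring.two_ne_zero
    intro h
    have := FiniteField.even_card_iff_char_two.1 h
    rw [hF] at this
    rw [Nat.odd_iff] at hodd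
    omega
  have hN : ∀ k, Nbar F (k + 1) ≤ q ^ (k + 1) := fun k => hF ▸ PB.N_le h2 (k + 1) (by omega)
  have hq3 : (3 : ℝ) ≤ q := by
    obtain ⟨p, m, hp, hm, rfl⟩ := hq
    have h1 : 1 < p ^ m := Nat.one_lt_pow hm.ne' hp.one_lt
    rw [Nat.odd_iff] at hodd
    have : 3 ≤ p ^ m := by omega
    exact_mod_cast this
  have hqu : (q : ℝ) * |u| < 1 := by
    rwa [lt_div_iff₀ (by linarith), mul_comm] at hu
  have hu3 : |u| < 1 / 2 := by nlinarith [abs_nonneg u]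
  have hx : ∀ k : ℕ, |u ^ (k + 1)| < 1 / 2 := by
    intro k
    rw [abs_pow, pow_succ]
    have := pow_le_one₀ (n := k) (abs_nonneg u) (by linarith)
    nlinarith [abs_nonneg u]
  set s : ℕ → ℝ := fun k => (Nbar F (k + 1) : ℝ) * Real.log (1 - (u ^ (k + 1)) ^ 2) with hs
  have hsum : Summable s := by
    apply Summable.of_norm_bounded (g := fun k => 2 * |u| ^ (k + 1))
    · apply Summable.mul_left
      exact (summable_nat_add_iff 1).2
        (summable_geometric_of_lt_one (abs_nonneg u) (by linarith))
    · intro k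
      have hk := hx k
      have hy : |(u ^ (k + 1)) ^ 2| ≤ 1 / 2 := by
        rw [abs_pow]; nlinarith [abs_nonneg (u ^ (k + 1))]
      have h1 := Real.abs_log_sub_add_sum_range_le (x := (u ^ (k + 1)) ^ 2) (by linarith) 0
      simp only [Finset.range_zero, Finset.sum_empty, zero_add, pow_one] at h1
      have h3 : |Real.log (1 - (u ^ (k + 1)) ^ 2)| ≤ 2 * |(u ^ (k + 1)) ^ 2| := by
        refine h1.trans ?_
        rw [div_le_iff₀ (by linarith)]
        nlinarith [abs_nonneg ((u ^ (k + 1)) ^ 2)]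
      have h4 : (Nbar F (k + 1) : ℝ) ≤ (q : ℝ) ^ (k + 1) := by exact_mod_cast hN k
      have h5 : (q : ℝ) ^ (k + 1) * |u| ^ (k + 1) ≤ 1 := by
        rw [← mul_pow]
        exact pow_le_one₀ (by positivity) hqu.le
      rw [hs, Real.norm_eq_abs, abs_mul, Nat.abs_cast]
      calc (Nbar F (k + 1) : ℝ) * |Real.log (1 - (u ^ (k + 1)) ^ 2)|
          ≤ (q : ℝ) ^ (k + 1) * (2 * |(u ^ (k + 1)) ^ 2|) := by gcongr
        _ = 2 * |u| ^ (k + 1) * ((q : ℝ) ^ (k + 1) * |u| ^ (k + 1)) := by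
          rw [abs_pow, abs_pow]; ring
        _ ≤ 2 * |u| ^ (k + 1) * 1 := by gcongr
        _ = _ := by ring
  set e : ℕ → ℝ := fun n => if n % 2 = 1 then s (n / 2) else 0 with he
  have hesum : HasSum e (∑' k, s k) := by
    have hinj : Function.Injective (fun k : ℕ => 2 * k + 1) := by
      intro a b h; simp only at h; omega
    rw [← hinj.hasSum_iff]
    · convert! hsum.hasSum using 1
      funext k
      have h1 : (2 * k + 1) % 2 = 1 := by omega
      have h3 : (2 * k + 1) / 2 = k := by omega
      simp only [he, Function.comp, h1, h3, if_true]
    · intro n hn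
      have : ¬ n % 2 = 1 := fun h => hn ⟨n / 2, by simp only; omega⟩
      simp only [he, this, if_false]
  have htot : HasSum (fun n => - s n + e n) 0 := by
    have := hsum.hasSum.neg.add hesum
    simpa using this
  have hexp : ∀ k, Real.exp (s k) = (1 - (u ^ (k + 1)) ^ 2) ^ (Nbar F (k + 1)) := by
    intro k
    rw [hs, Real.exp_nat_mul, Real.exp_log]
    have := abs_lt.1 (hx k)
    nlinarith
  have hprod := htot.rexp
  rw [Real.exp_zero] at hprod
  have hfun : (fun d : ℕ =>
      ((1 + u ^ (d + 1))⁻¹) ^ (Nbar F (d + 1)) *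
        ((1 - u ^ (d + 1))⁻¹) ^ (Mbar F (d + 1))) = Real.exp ∘ (fun n => - s n + e n) := by
    funext n
    have hxn := abs_lt.1 (hx n)
    have hp : 1 + u ^ (n + 1) ≠ 0 := by linarith
    have hm : 1 - u ^ (n + 1) ≠ 0 := by linarith
    have hfac : 1 - (u ^ (n + 1)) ^ 2 = (1 + u ^ (n + 1)) * (1 - u ^ (n + 1)) := by ring
    simp only [Function.comp]
    rw [Real.exp_add, Real.exp_neg, hexp, hfac, mul_pow, mul_inv, inv_pow, inv_pow, mul_assoc]
    congr 1
    by_cases h : n % 2 = 1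
    · obtain ⟨k, rfl⟩ : ∃ k, n = 2 * k + 1 := ⟨n / 2, by omega⟩
      have h3 : (2 * k + 1) / 2 = k := by omega
      have hc : Nbar F (2 * k + 1 + 1) = Mbar F (2 * k + 1 + 1) + Nbar F (k + 1) :=
        PB.count_even h2 (k + 1) (by omega)
      have hpw : (u ^ (k + 1)) ^ 2 = u ^ (2 * k + 1 + 1) := by ring
      simp only [he, h, if_true, h3]
      rw [hexp, hc, hpw, pow_add (1 - u ^ (2 * k + 1 + 1))]
      rw [mul_inv, mul_assoc, inv_mul_cancel₀ (pow_ne_zero _ hm), mul_one]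
    · have hc := PB.count_odd h2 (n + 1) (Nat.odd_iff.2 (by omega))
      simp only [he, h, if_false]
      rw [hc]; simp
  rw [← hfun] at hprod
  exact ⟨hprod.multipliable, hprod.tprod_eq⟩
end
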